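/- arXiv:2212.06069 — 11 statements merged into one kernel-verified Lean document; each statement's English description precedes it below -/
import Mathlib

section
/- (Adapted law-of-total-variance bound.) Let (Ω, 𝒜, P) be a probability space with a filtration 𝒢_0 ⊆ 𝒢_1 ⊆ … ⊆ 𝒢_H. For h = 1, …, H let Y_h be a bounded 𝒢_h-measurable random variable; for h = 1, …, H let V_h be a bounded 𝒢_{h−1}-measurable random variable and set V_{H+1} := 0; define r_h := Y_h − V_{h+1}. Let A ∈ 𝒢_H be an event and for h = 1, …, H let Q_h be a bounded 𝒢_{h−1}-measurable random variable with 𝟙_A · Q_h = 𝟙_A · V_h almost surely. Then, almost surely, E[ Σ_{h=1}^H Var(Y_h | 𝒢_{h−1}) | 𝒢_0 ] ≤ 2 E[ ( Σ_{h=1}^H r_h − V_1 )² | 𝒢_0 ] + 2 E[ ( 𝟙_A Σ_{h=1}^H ( Q_h − E[Y_h | 𝒢_{h−1}] ) )² | 𝒢_0 ] + 2 E[ ( 𝟙_{A^c} Σ_{h=1}^H ( V_h − E[Y_h | 𝒢_{h−1}] ) )² | 𝒢_0 ]. -/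
open MeasureTheory Finset

/-- The conditional variance `Var(X | m') = E[(X - E[X|m'])² | m']` as a function on `Ω`. -/
noncomputable def condVarFun {Ω : Type*} {m0 : MeasurableSpace Ω}
    (m' : MeasurableSpace Ω) (μ : @Measure Ω m0) (X : Ω → ℝ) : Ω → ℝ :=
  μ[fun ω => (X ω - (μ[X | m']) ω) ^ 2 | m']

/-- Conditional orthogonality of square-integrable martingale differences. -/
lemma condExp_sq_sum_of_condExp_eq_zero {Ω : Type*} {m : MeasurableSpace Ω} (μ : Measure Ω)
    [IsFiniteMeasure μ] {𝒢 : ℕ → MeasurableSpace Ω} (hmono : Monotone 𝒢) (hle : ∀ h, 𝒢 h ≤ m)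
    {D : ℕ → Ω → ℝ} {n : ℕ} (hmeas : ∀ h ∈ Finset.Icc 1 n, StronglyMeasurable[𝒢 h] (D h))
    (hD : ∀ h ∈ Finset.Icc 1 n, MemLp (D h) 2 μ)
    (hzero : ∀ h ∈ Finset.Icc 1 n, μ[D h | 𝒢 (h - 1)] =ᵐ[μ] 0) :
    μ[fun ω => ∑ h ∈ Finset.Icc 1 n, (μ[fun ω' => D h ω' ^ 2 | 𝒢 (h - 1)]) ω | 𝒢 0]
      =ᵐ[μ] μ[fun ω => (∑ h ∈ Finset.Icc 1 n, D h ω) ^ 2 | 𝒢 0] := by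
  induction n with
  | zero => simp
  | succ n ih =>
    have hsub : ∀ h ∈ Finset.Icc 1 n, h ∈ Finset.Icc 1 (n + 1) := fun h hh => by
      simp only [Finset.mem_Icc] at hh ⊢; lia
    have hlast : n + 1 ∈ Finset.Icc 1 (n + 1) := by simp
    specialize ih (fun h hh => hmeas h (hsub h hh)) (fun h hh => hD h (hsub h hh))
      (fun h hh => hzero h (hsub h hh))
    set S : Ω → ℝ := fun ω => ∑ h ∈ Finset.Icc 1 n, D h ω with hS
    set E : Ω → ℝ := D (n + 1) with hE
    have hS2 : MemLp S 2 μ := memLp_finsetSum _ fun h hh => hD h (hsub h hh)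
    have hE2 : MemLp E 2 μ := hD _ hlast
    have hSm : StronglyMeasurable[𝒢 n] S :=
      Finset.stronglyMeasurable_fun_sum _ fun h hh =>
        (hmeas h (hsub h hh)).mono (hmono (Finset.mem_Icc.1 hh).2)
    have hSE : Integrable (S * E) μ := hS2.integrable_mul hE2
    have hcross : μ[S * E | 𝒢 0] =ᵐ[μ] 0 := by
      have h1 : μ[S * E | 𝒢 n] =ᵐ[μ] 0 := by
        have h2 : μ[E | 𝒢 n] =ᵐ[μ] 0 := hzero _ hlast
        filter_upwards [condExp_mul_of_stronglyMeasurable_left hSm hSE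
          (hE2.integrable one_le_two), h2] with ω h3 h4
        simp [h3, h4]
      refine (condExp_condExp_of_le (hmono n.zero_le) (hle n)).symm.trans
        ((condExp_congr_ae h1).trans ?_)
      rw [condExp_zero]
    have hsq : (fun ω => (∑ h ∈ Finset.Icc 1 (n + 1), D h ω) ^ 2)
        = (fun ω => S ω ^ 2) + (((2 : ℝ) • (S * E)) + fun ω => E ω ^ 2) := by
      funext ω
      simp only [Finset.sum_Icc_succ_top (Nat.le_add_left 1 n), Pi.add_apply, Pi.smul_apply,
        Pi.mul_apply, smul_eq_mul, hS, hE]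
      ring
    have hlhs : (fun ω => ∑ h ∈ Finset.Icc 1 (n + 1),
          (μ[fun ω' => D h ω' ^ 2 | 𝒢 (h - 1)]) ω)
        = (fun ω => ∑ h ∈ Finset.Icc 1 n, (μ[fun ω' => D h ω' ^ 2 | 𝒢 (h - 1)]) ω)
          + μ[fun ω => E ω ^ 2 | 𝒢 n] := by
      funext ω
      simp [Finset.sum_Icc_succ_top, hE]
    rw [hsq, hlhs]
    filter_upwards [ih, hcross, condExp_smul (μ := μ) (2 : ℝ) (S * E) (𝒢 0),
      condExp_add hS2.integrable_sq ((hSE.smul (2 : ℝ)).add hE2.integrable_sq) (𝒢 0),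
      condExp_add (hSE.smul (2 : ℝ)) hE2.integrable_sq (𝒢 0),
      condExp_add (integrable_finsetSum (Finset.Icc 1 n) fun h _ =>
        integrable_condExp (μ := μ) (m := 𝒢 (h - 1)) (f := fun ω' => D h ω' ^ 2))
        (integrable_condExp (μ := μ) (m := 𝒢 n) (f := fun ω => E ω ^ 2)) (𝒢 0),
      condExp_condExp_of_le (μ := μ) (f := fun ω => E ω ^ 2) (hmono n.zero_le) (hle n)]
      with ω h1 h2 h3 h4 h5 h6 h7
    simp only [Pi.add_apply, Pi.smul_apply, Pi.zero_apply, smul_eq_mul] at *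
    rw [h4, h5, h6, h7, h3, h2, h1]
    ring

/-- Multiplying by the indicator of a measurable set preserves membership in `L^p`. -/
lemma MeasureTheory.MemLp.indicator_one_mul {Ω : Type*} {m : MeasurableSpace Ω} {μ : Measure Ω}
    {p : ENNReal} {f : Ω → ℝ} (hf : MemLp f p μ) {B : Set Ω} (hB : MeasurableSet B) :
    MemLp (fun ω => B.indicator (fun _ => (1 : ℝ)) ω * f ω) p μ := by
  convert hf.indicator hB using 1
  funext ω
  by_cases h : ω ∈ B <;> simp [h]

/-- **Adapted law-of-total-variance bound.** With `Y_h` bounded `𝒢_h`-measurable,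
`V_h` bounded `𝒢_{h-1}`-measurable, `V_{H+1} = 0`, `r_h := Y_h - V_{h+1}`, an event
`A ∈ 𝒢_H`, and bounded `𝒢_{h-1}`-measurable `Q_h` with `𝟙_A Q_h = 𝟙_A V_h` a.s., one has
almost surely
`E[∑_h Var(Y_h|𝒢_{h-1}) | 𝒢_0]
  ≤ 2 E[(∑_h r_h - V_1)² | 𝒢_0]
    + 2 E[(𝟙_A ∑_h (Q_h - E[Y_h|𝒢_{h-1}]))² | 𝒢_0]
    + 2 E[(𝟙_{Aᶜ} ∑_h (V_h - E[Y_h|𝒢_{h-1}]))² | 𝒢_0]`. -/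
theorem stmt3 {Ω : Type*} {m : MeasurableSpace Ω} (μ : Measure Ω) [IsProbabilityMeasure μ]
    (H : ℕ) (hH : 0 < H)
    (𝒢 : ℕ → MeasurableSpace Ω)
    (hmono : ∀ h, 𝒢 h ≤ 𝒢 (h + 1))
    (hle : ∀ h, 𝒢 h ≤ m)
    (Y V Q : ℕ → Ω → ℝ)
    (hYmeas : ∀ h ∈ Finset.Icc 1 H, Measurable[𝒢 h] (Y h))
    (hYbdd : ∀ h ∈ Finset.Icc 1 H, ∃ C, ∀ ω, |Y h ω| ≤ C)
    (hVmeas : ∀ h ∈ Finset.Icc 1 H, Measurable[𝒢 (h - 1)] (V h))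
    (hVbdd : ∀ h ∈ Finset.Icc 1 H, ∃ C, ∀ ω, |V h ω| ≤ C)
    (hVend : V (H + 1) = fun _ => 0)
    (r : ℕ → Ω → ℝ) (hr : ∀ h, r h = fun ω => Y h ω - V (h + 1) ω)
    (A : Set Ω) (hA : MeasurableSet[𝒢 H] A)
    (hQmeas : ∀ h ∈ Finset.Icc 1 H, Measurable[𝒢 (h - 1)] (Q h))
    (hQbdd : ∀ h ∈ Finset.Icc 1 H, ∃ C, ∀ ω, |Q h ω| ≤ C)
    (hQA : ∀ h ∈ Finset.Icc 1 H, ∀ᵐ ω ∂μ,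
      A.indicator (fun _ => (1 : ℝ)) ω * Q h ω = A.indicator (fun _ => (1 : ℝ)) ω * V h ω) :
    ∀ᵐ ω ∂μ,
      (μ[fun ω' => ∑ h ∈ Finset.Icc 1 H, condVarFun (𝒢 (h - 1)) μ (Y h) ω' | 𝒢 0]) ω
        ≤ 2 * (μ[fun ω' =>
              ((∑ h ∈ Finset.Icc 1 H, r h ω') - V 1 ω') ^ 2 | 𝒢 0]) ω
          + 2 * (μ[fun ω' =>
              (A.indicator (fun _ => (1 : ℝ)) ω' *
                ∑ h ∈ Finset.Icc 1 H, (Q h ω' - (μ[Y h | 𝒢 (h - 1)]) ω')) ^ 2 | 𝒢 0]) ω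
          + 2 * (μ[fun ω' =>
              (Aᶜ.indicator (fun _ => (1 : ℝ)) ω' *
                ∑ h ∈ Finset.Icc 1 H, (V h ω' - (μ[Y h | 𝒢 (h - 1)]) ω')) ^ 2 | 𝒢 0]) ω := by
  have hmon : Monotone 𝒢 := monotone_nat_of_le_succ hmono
  have memLp_of_bdd : ∀ {f : Ω → ℝ} {k : ℕ}, Measurable[𝒢 k] f → (∃ C, ∀ ω, |f ω| ≤ C) →
      MemLp f 2 μ := by
    rintro f k hf ⟨C, hC⟩
    exact MemLp.of_bound (hf.mono (hle k) le_rfl).aestronglyMeasurable C (.of_forall hC)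
  have hY2 : ∀ h ∈ Finset.Icc 1 H, MemLp (Y h) 2 μ := fun h hh =>
    memLp_of_bdd (hYmeas h hh) (hYbdd h hh)
  have hV2 : ∀ h ∈ Finset.Icc 1 H, MemLp (V h) 2 μ := fun h hh =>
    memLp_of_bdd (hVmeas h hh) (hVbdd h hh)
  have hQ2 : ∀ h ∈ Finset.Icc 1 H, MemLp (Q h) 2 μ := fun h hh =>
    memLp_of_bdd (hQmeas h hh) (hQbdd h hh)
  have hP2 : ∀ h ∈ Finset.Icc 1 H, MemLp (μ[Y h | 𝒢 (h - 1)]) 2 μ := fun h hh =>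
    (hY2 h hh).condExp one_le_two
  set D : ℕ → Ω → ℝ := fun h ω => Y h ω - (μ[Y h | 𝒢 (h - 1)]) ω with hDdef
  have hD2 : ∀ h ∈ Finset.Icc 1 H, MemLp (D h) 2 μ := fun h hh => (hY2 h hh).sub (hP2 h hh)
  have hDm : ∀ h ∈ Finset.Icc 1 H, StronglyMeasurable[𝒢 h] (D h) := fun h hh =>
    (hYmeas h hh).stronglyMeasurable.sub
      (stronglyMeasurable_condExp.mono (hmon (Nat.sub_le h 1)))
  have hD0 : ∀ h ∈ Finset.Icc 1 H, μ[D h | 𝒢 (h - 1)] =ᵐ[μ] 0 := fun h hh => by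
    have h1 := condExp_sub ((hY2 h hh).integrable one_le_two)
      (integrable_condExp (μ := μ) (m := 𝒢 (h - 1)) (f := Y h)) (𝒢 (h - 1))
    refine h1.trans ?_
    rw [condExp_of_stronglyMeasurable (hle _) stronglyMeasurable_condExp integrable_condExp,
      sub_self]
  have hkey := condExp_sq_sum_of_condExp_eq_zero μ hmon hle hDm hD2 hD0
  set a : Ω → ℝ := fun ω => (∑ h ∈ Finset.Icc 1 H, r h ω) - V 1 ω with ha
  set b : Ω → ℝ := fun ω => A.indicator (fun _ => (1 : ℝ)) ω *
    ∑ h ∈ Finset.Icc 1 H, (Q h ω - (μ[Y h | 𝒢 (h - 1)]) ω) with hb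
  set c : Ω → ℝ := fun ω => Aᶜ.indicator (fun _ => (1 : ℝ)) ω *
    ∑ h ∈ Finset.Icc 1 H, (V h ω - (μ[Y h | 𝒢 (h - 1)]) ω) with hc
  have hAm : MeasurableSet A := hle H A hA
  have hb2 : MemLp b 2 μ :=
    (memLp_finsetSum _ fun h hh => (hQ2 h hh).sub (hP2 h hh)).indicator_one_mul hAm
  have hc2 : MemLp c 2 μ :=
    (memLp_finsetSum _ fun h hh => (hV2 h hh).sub (hP2 h hh)).indicator_one_mul hAm.compl
  have ha_eq : ∀ ω, a ω = ∑ h ∈ Finset.Icc 1 H, (Y h ω - V h ω) := by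
    intro ω
    have htel : ∀ n, ∑ h ∈ Finset.Icc 1 n, V (h + 1) ω + V 1 ω
        = ∑ h ∈ Finset.Icc 1 n, V h ω + V (n + 1) ω := by
      intro n
      induction n with
      | zero => simp
      | succ n ih =>
        simp only [Finset.sum_Icc_succ_top (Nat.le_add_left 1 n)]
        linarith
    have h1 := htel H
    simp only [hVend, add_zero] at h1
    simp only [ha, hr, Finset.sum_sub_distrib]
    linarith
  have ha2 : MemLp a 2 μ := by
    rw [funext ha_eq]
    exact memLp_finsetSum _ fun h hh => (hY2 h hh).sub (hV2 h hh)
  have hbound : (fun ω => (∑ h ∈ Finset.Icc 1 H, D h ω) ^ 2) ≤ᵐ[μ]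
      ((2 : ℝ) • fun ω => a ω ^ 2) + ((2 : ℝ) • fun ω => b ω ^ 2)
        + ((2 : ℝ) • fun ω => c ω ^ 2) := by
    filter_upwards [(ae_ball_iff (Finset.Icc 1 H).countable_toSet).2 hQA] with ω hω
    have hsum : ∑ h ∈ Finset.Icc 1 H, D h ω = a ω + (b ω + c ω) := by
      have hbc : b ω + c ω = ∑ h ∈ Finset.Icc 1 H, (V h ω - (μ[Y h | 𝒢 (h - 1)]) ω) := by
        by_cases hωA : ω ∈ A
        · have hQV : ∀ h ∈ Finset.Icc 1 H, Q h ω = V h ω := fun h hh => by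
            simpa [hωA] using hω h hh
          simp only [hb, hc, hωA, Set.indicator_of_mem, Set.mem_compl_iff, not_true_eq_false,
            not_false_eq_true, Set.indicator_of_notMem, one_mul, zero_mul, add_zero]
          exact Finset.sum_congr rfl fun h hh => by rw [hQV h hh]
        · simp [hb, hc, hωA]
      rw [hbc, ha_eq, ← Finset.sum_add_distrib]
      exact Finset.sum_congr rfl fun h _ => by simp only [hDdef]; ring
    have hbc0 : b ω * c ω = 0 := by
      by_cases hωA : ω ∈ A <;> simp [hb, hc, hωA]
    simp only [Pi.add_apply, Pi.smul_apply, smul_eq_mul, hsum]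
    nlinarith [sq_nonneg (a ω - (b ω + c ω))]
  have hia := ha2.integrable_sq.smul (2 : ℝ)
  have hib := hb2.integrable_sq.smul (2 : ℝ)
  have hic := hc2.integrable_sq.smul (2 : ℝ)
  filter_upwards [hkey,
    condExp_mono (m := 𝒢 0) (memLp_finsetSum _ hD2).integrable_sq ((hia.add hib).add hic) hbound,
    condExp_add (hia.add hib) hic (𝒢 0), condExp_add hia hib (𝒢 0),
    condExp_smul (μ := μ) (2 : ℝ) (fun ω => a ω ^ 2) (𝒢 0),
    condExp_smul (μ := μ) (2 : ℝ) (fun ω => b ω ^ 2) (𝒢 0),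
    condExp_smul (μ := μ) (2 : ℝ) (fun ω => c ω ^ 2) (𝒢 0)] with ω h1 h2 h3 h4 h5 h6 h7
  simp only [Pi.add_apply, Pi.smul_apply, smul_eq_mul] at h3 h4 h5 h6 h7
  rw [h3, h4, h5, h6, h7, ← h1] at h2
  exact h2
end

section
/- (Peeling corollary of Freedman's inequality.) Let M ≥ m > 0 and V ≥ v > 0 be constants, and let (x_i)_{i=1}^t be a stochastic process adapted to a filtration (ℋ_i)_{i=0}^t such that E[x_i | ℋ_{i−1}] = 0, |x_i| ≤ M almost surely, and Σ_{i=1}^t E[x_i² | ℋ_{i−1}] ≤ V² almost surely. Then for any δ ∈ (0, 1), setting ι := √( log( (2 log(V/v) + 2)(log(M/m) + 2) / δ ) ), one has P( Σ_{i=1}^t x_i > ι √( 2 ( 2 Σ_{i=1}^t E[x_i² | ℋ_{i−1}] + v² ) ) + (2/3) ι² ( 2 max_{i∈[t]} |x_i| + m ) ) ≤ δ. -/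
open MeasureTheory Finset

/-- The Bernstein-type upper bound for the exponential. -/
theorem exp_le_one_add_add_sq_div {u : ℝ} (hu : u < 3) :
    Real.exp u ≤ 1 + u + u ^ 2 / (2 * (1 - u / 3)) := by
  set h : ℝ → ℝ := fun u => (1 + u + u ^ 2 / (2 * (1 - u / 3))) * Real.exp (-u) with h_def
  have hd : ∀ w < (3 : ℝ),
      HasDerivAt h (w ^ 3 / (2 * (3 - w) ^ 2) * Real.exp (-w)) w := by
    intro w hw
    have hw' : 3 - w ≠ 0 := by linarith
    have hw'' : 1 - w / 3 ≠ 0 := by intro h; apply hw'; linarith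
    have h2 : HasDerivAt (fun u : ℝ => 2 * (1 - u / 3)) (2 * (-(1 / 3))) w :=
      (((hasDerivAt_id w).div_const 3).const_sub 1).const_mul 2
    have h3 : HasDerivAt (fun u : ℝ => u ^ 2) (2 * w) w := by simpa using hasDerivAt_pow 2 w
    have h4 := (((hasDerivAt_id w).const_add 1).add
      (h3.div h2 (mul_ne_zero two_ne_zero hw''))).mul (hasDerivAt_neg w).exp
    refine h4.congr_deriv ?_
    simp only [id, Pi.add_apply, Pi.div_apply]
    have : 1 - w / 3 = (3 - w) / 3 := by ring
    rw [this]
    field_simp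
    ring
  have hcont : ContinuousOn h (Set.Iio 3) := fun w hw =>
    (hd w hw).continuousAt.continuousWithinAt
  have h0 : h 0 = 1 := by simp [h_def]
  have key : 1 ≤ h u := by
    rw [← h0]
    rcases le_total 0 u with h0u | hu0
    · refine monotoneOn_of_deriv_nonneg (convex_Ico 0 3)
        (hcont.mono fun w hw => hw.2) ?_ ?_ ⟨le_rfl, by norm_num⟩ ⟨h0u, hu⟩ h0u
      · rw [interior_Ico]
        exact fun w hw => (hd w hw.2).differentiableAt.differentiableWithinAt
      · rw [interior_Ico]
        intro w hw
        rw [(hd w hw.2).deriv]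
        have := hw.1
        positivity
    · have hlt : ∀ w : ℝ, w ≤ 0 → w < 3 := fun w hw => by linarith
      refine antitoneOn_of_deriv_nonpos (convex_Iic 0)
        (hcont.mono fun w hw => hlt w hw) ?_ ?_ hu0 Set.self_mem_Iic hu0
      · rw [interior_Iic]
        exact fun w hw => (hd w (hlt w (le_of_lt hw))).differentiableAt.differentiableWithinAt
      · rw [interior_Iic]
        intro w hw
        have hw : w < 0 := hw
        rw [(hd w (hlt w hw.le)).deriv]
        refine mul_nonpos_of_nonpos_of_nonneg ?_ (Real.exp_pos _).le
        exact div_nonpos_of_nonpos_of_nonneg (Odd.pow_nonpos (by decide) hw.le) (by positivity)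
  rw [h_def] at key
  simp only at key
  rwa [Real.exp_neg, ← div_eq_mul_inv, one_le_div (Real.exp_pos u)] at key

theorem exp_mul_truncation_le {l b : ℝ} (hl : 0 ≤ l) (hb : 0 ≤ b) (hlb : l * b < 3) (x : ℝ) :
    Real.exp (l * if x ≤ b then x else 0) ≤
      1 + l * x + l ^ 2 / (2 * (1 - l * b / 3)) * x ^ 2 := by
  have hpos : 0 < 2 * (1 - l * b / 3) := by linarith
  split_ifs with hx
  · have hlx : l * x ≤ l * b := by gcongr
    refine (exp_le_one_add_add_sq_div (hlx.trans_lt hlb)).trans ?_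
    rw [div_mul_eq_mul_div, ← mul_pow]
    gcongr
  · have hx : 0 < x := by linarith
    rw [mul_zero, Real.exp_zero]
    have : 0 ≤ l ^ 2 / (2 * (1 - l * b / 3)) * x ^ 2 := by positivity
    nlinarith [mul_nonneg hl hx.le]

section Supermartingale

variable {Ω : Type*} {m0 : MeasurableSpace Ω} {μ : Measure Ω} [IsProbabilityMeasure μ]

/-- Bernstein bound for the conditional moment generating function of a centred variable truncated
from above. -/
theorem condExp_exp_truncation_le {m : MeasurableSpace Ω} (hm : m ≤ m0) {x : Ω → ℝ}
    (hx : Measurable[m0] x) {M : ℝ} (hbound : ∀ᵐ ω ∂μ, |x ω| ≤ M) (hmean : μ[x | m] =ᵐ[μ] 0)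
    {l b : ℝ} (hl : 0 ≤ l) (hb : 0 ≤ b) (hlb : l * b < 3) :
    Integrable (fun ω => Real.exp (l * if x ω ≤ b then x ω else 0)) μ ∧
    μ[fun ω => Real.exp (l * if x ω ≤ b then x ω else 0) | m] ≤ᵐ[μ]
      fun ω => Real.exp (l ^ 2 / (2 * (1 - l * b / 3)) * (μ[fun ω' => x ω' ^ 2 | m]) ω) := by
  set p := l ^ 2 / (2 * (1 - l * b / 3))
  have hix : Integrable x μ := .of_bound hx.aestronglyMeasurable M (by simpa using hbound)
  have hix2 : Integrable (fun ω => x ω ^ 2) μ := by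
    refine .of_bound (hx.pow_const 2).aestronglyMeasurable (M ^ 2) ?_
    filter_upwards [hbound] with ω hω
    rw [Real.norm_eq_abs, abs_pow]
    gcongr
  have hiq : Integrable ((fun _ => (1 : ℝ)) + l • x + p • fun ω => x ω ^ 2) μ :=
    ((integrable_const _).add (hix.smul l)).add (hix2.smul p)
  have hie : Integrable (fun ω => Real.exp (l * if x ω ≤ b then x ω else 0)) μ := by
    have hme : Measurable[m0] (fun ω => Real.exp (l * if x ω ≤ b then x ω else 0)) :=
      ((Measurable.ite (measurableSet_le hx measurable_const) hx measurable_const).const_mul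
        l).exp
    refine .of_bound hme.aestronglyMeasurable (Real.exp (l * b)) (ae_of_all _ fun ω => ?_)
    rw [Real.norm_eq_abs, Real.abs_exp]
    gcongr
    split_ifs with h
    exacts [h, hb]
  refine ⟨hie, ?_⟩
  have hmono := condExp_mono (m := m) hie hiq
    (ae_of_all _ fun ω => by simpa using exp_mul_truncation_le hl hb hlb (x ω))
  filter_upwards [hmono, hmean,
    condExp_add (m := m) ((integrable_const (1 : ℝ)).add (hix.smul l)) (hix2.smul p),
    condExp_add (m := m) (integrable_const (1 : ℝ)) (hix.smul l),
    condExp_smul (μ := μ) l x m, condExp_smul (μ := μ) p (fun ω => x ω ^ 2) m]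
    with ω h1 h2 h3 h4 h5 h6
  refine h1.trans ?_
  rw [h3, Pi.add_apply, h4, Pi.add_apply, h5, h6, condExp_const hm, Pi.smul_apply, h2,
    Pi.smul_apply]
  simp only [Pi.zero_apply, smul_eq_mul, mul_zero, add_zero]
  linarith [Real.add_one_le_exp (p * (μ[fun ω' => x ω' ^ 2 | m]) ω)]

/-- One step of the exponential supermartingale. -/
theorem integral_mul_exp_truncation_le {m : MeasurableSpace Ω} (hm : m ≤ m0) {x : Ω → ℝ}
    (hx : Measurable[m0] x) {M : ℝ} (hbound : ∀ᵐ ω ∂μ, |x ω| ≤ M) (hmean : μ[x | m] =ᵐ[μ] 0)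
    {l b : ℝ} (hl : 0 ≤ l) (hb : 0 ≤ b) (hlb : l * b < 3) {Z : Ω → ℝ} (hZ : Measurable[m] Z)
    (hZ0 : ∀ ω, 0 ≤ Z ω) (hZi : Integrable Z μ) :
    Integrable (fun ω => Z ω * Real.exp ((l * if x ω ≤ b then x ω else 0) -
      l ^ 2 / (2 * (1 - l * b / 3)) * (μ[fun ω' => x ω' ^ 2 | m]) ω)) μ ∧
    ∫ ω, Z ω * Real.exp ((l * if x ω ≤ b then x ω else 0) -
      l ^ 2 / (2 * (1 - l * b / 3)) * (μ[fun ω' => x ω' ^ 2 | m]) ω) ∂μ ≤ ∫ ω, Z ω ∂μ := by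
  obtain ⟨hie, hce⟩ := condExp_exp_truncation_le hm hx hbound hmean hl hb hlb
  set p := l ^ 2 / (2 * (1 - l * b / 3)) with hp
  have hp0 : 0 ≤ p := div_nonneg (sq_nonneg l) (by linarith)
  set E : Ω → ℝ := fun ω => Real.exp (l * if x ω ≤ b then x ω else 0)
  set F : Ω → ℝ := fun ω => Z ω * Real.exp (-(p * (μ[fun ω' => x ω' ^ 2 | m]) ω)) with hF
  have hv0 : 0 ≤ᵐ[μ] μ[fun ω' => x ω' ^ 2 | m] :=
    condExp_nonneg (ae_of_all _ fun ω => sq_nonneg (x ω))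
  have hFm : Measurable[m] F := hZ.mul
    ((stronglyMeasurable_condExp.measurable.const_mul p).neg.exp)
  have hFi : Integrable F μ := by
    refine hZi.mono (hFm.mono hm le_rfl).aestronglyMeasurable ?_
    filter_upwards [hv0] with ω hω
    rw [hF, norm_mul, Real.norm_eq_abs (Real.exp _), Real.abs_exp]
    exact mul_le_of_le_one_right (norm_nonneg _)
      (Real.exp_le_one_iff.mpr (neg_nonpos.mpr (mul_nonneg hp0 hω)))
  have hFE : Integrable (F * E) μ := by
    refine hFi.mul_bdd (c := Real.exp (l * b)) hie.aestronglyMeasurable (ae_of_all _ fun ω => ?_)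
    rw [Real.norm_eq_abs, Real.abs_exp]
    gcongr
    split_ifs with h
    exacts [h, hb]
  have heq : (fun ω => Z ω * Real.exp ((l * if x ω ≤ b then x ω else 0) -
      p * (μ[fun ω' => x ω' ^ 2 | m]) ω)) = F * E := by
    ext ω
    simp only [F, E, Pi.mul_apply]
    rw [mul_assoc, ← Real.exp_add]
    ring_nf
  rw [heq]
  refine ⟨hFE, ?_⟩
  rw [← integral_condExp hm]
  refine integral_mono_ae integrable_condExp hZi ?_
  filter_upwards [condExp_mul_of_stronglyMeasurable_left hFm.stronglyMeasurable hFE hie, hce]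
    with ω h1 h2
  rw [h1, Pi.mul_apply]
  have hF0 : 0 ≤ F ω := mul_nonneg (hZ0 ω) (Real.exp_pos _).le
  refine (mul_le_mul_of_nonneg_left h2 hF0).trans_eq ?_
  simp only [hF]
  rw [mul_assoc, ← Real.exp_add, neg_add_cancel, Real.exp_zero, mul_one]

/-- The exponential supermartingale of the upward truncated process has expectation at most `1`. -/
theorem integral_exp_sum_truncation_le_one {t : ℕ} {ℋ : ℕ → MeasurableSpace Ω}
    (hmono : Monotone ℋ) (hle : ∀ i, ℋ i ≤ m0) {x : ℕ → Ω → ℝ}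
    (hadapted : ∀ i ∈ Finset.Icc 1 t, Measurable[ℋ i] (x i))
    (hmean : ∀ i ∈ Finset.Icc 1 t, μ[x i | ℋ (i - 1)] =ᵐ[μ] 0) {M : ℝ}
    (hbound : ∀ i ∈ Finset.Icc 1 t, ∀ᵐ ω ∂μ, |x i ω| ≤ M)
    {l b : ℝ} (hl : 0 ≤ l) (hb : 0 ≤ b) (hlb : l * b < 3) :
    Integrable (fun ω => Real.exp (∑ i ∈ Finset.Icc 1 t, ((l * if x i ω ≤ b then x i ω else 0) -
      l ^ 2 / (2 * (1 - l * b / 3)) * (μ[fun ω' => x i ω' ^ 2 | ℋ (i - 1)]) ω))) μ ∧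
    ∫ ω, Real.exp (∑ i ∈ Finset.Icc 1 t, ((l * if x i ω ≤ b then x i ω else 0) -
      l ^ 2 / (2 * (1 - l * b / 3)) * (μ[fun ω' => x i ω' ^ 2 | ℋ (i - 1)]) ω)) ∂μ ≤ 1 := by
  induction t with
  | zero => simp
  | succ n ih =>
    have hsub : Finset.Icc 1 n ⊆ Finset.Icc 1 (n + 1) := Finset.Icc_subset_Icc_right n.le_succ
    have hn : n + 1 ∈ Finset.Icc 1 (n + 1) := by simp
    obtain ⟨ihi, ihle⟩ := ih (fun i hi => hadapted i (hsub hi)) (fun i hi => hmean i (hsub hi))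
      (fun i hi => hbound i (hsub hi))
    simp only [Finset.sum_Icc_succ_top (Nat.le_add_left 1 n), Real.exp_add]
    have hZ : Measurable[ℋ n] fun ω => Real.exp (∑ i ∈ Finset.Icc 1 n,
        ((l * if x i ω ≤ b then x i ω else 0) -
          l ^ 2 / (2 * (1 - l * b / 3)) * (μ[fun ω' => x i ω' ^ 2 | ℋ (i - 1)]) ω)) := by
      refine Measurable.exp (Finset.measurable_fun_sum _ fun i hi => ?_)
      have hxi : Measurable[ℋ n] (x i) :=
        (hadapted i (hsub hi)).mono (hmono (Finset.mem_Icc.mp hi).2) le_rfl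
      have hvi : Measurable[ℋ n] (μ[fun ω' => x i ω' ^ 2 | ℋ (i - 1)]) :=
        stronglyMeasurable_condExp.measurable.mono
          (hmono ((Nat.sub_le i 1).trans (Finset.mem_Icc.mp hi).2)) le_rfl
      exact ((Measurable.ite (measurableSet_le hxi measurable_const) hxi
        measurable_const).const_mul l).sub (hvi.const_mul _)
    have hstep := integral_mul_exp_truncation_le (hle n)
      ((hadapted _ hn).mono (hle _) le_rfl) (hbound _ hn) (by simpa using hmean _ hn) hl hb hlb hZ
      (fun ω => (Real.exp_pos _).le) ihi
    exact ⟨hstep.1, hstep.2.trans ihle⟩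

/-- Chernoff bound for the upward truncated process, normalized by the conditional variance. -/
theorem measure_le_sum_truncation_le {t : ℕ} {ℋ : ℕ → MeasurableSpace Ω}
    (hmono : Monotone ℋ) (hle : ∀ i, ℋ i ≤ m0) {x : ℕ → Ω → ℝ}
    (hadapted : ∀ i ∈ Finset.Icc 1 t, Measurable[ℋ i] (x i))
    (hmean : ∀ i ∈ Finset.Icc 1 t, μ[x i | ℋ (i - 1)] =ᵐ[μ] 0) {M : ℝ}
    (hbound : ∀ i ∈ Finset.Icc 1 t, ∀ᵐ ω ∂μ, |x i ω| ≤ M)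
    {l b : ℝ} (hl : 0 ≤ l) (hb : 0 ≤ b) (hlb : l * b < 3) (L : ℝ) :
    μ {ω | L ≤ l * (∑ i ∈ Finset.Icc 1 t, if x i ω ≤ b then x i ω else 0) -
      l ^ 2 / (2 * (1 - l * b / 3)) *
        ∑ i ∈ Finset.Icc 1 t, (μ[fun ω' => x i ω' ^ 2 | ℋ (i - 1)]) ω} ≤
      ENNReal.ofReal (Real.exp (-L)) := by
  obtain ⟨hi, hle1⟩ := integral_exp_sum_truncation_le_one hmono hle hadapted hmean hbound hl hb hlb
  simp only [Finset.sum_sub_distrib, ← Finset.mul_sum] at hi hle1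
  have h := ProbabilityTheory.measure_ge_le_exp_mul_mgf (μ := μ) (t := 1) L zero_le_one
    (by simpa only [one_mul] using hi)
  rw [← ofReal_measureReal]
  refine ENNReal.ofReal_le_ofReal (h.trans ?_)
  simp only [ProbabilityTheory.mgf, one_mul, neg_mul]
  exact mul_le_of_le_one_right (Real.exp_pos _).le hle1

end Supermartingale

theorem div_add_le_sqrt {W s v : ℝ} (hW : 0 ≤ W) (hs : 0 < s) (hWs : W ≤ 3 * s ^ 2)
    (hsW : s ^ 2 ≤ W ∨ s = v) : W / (2 * s) + s ≤ Real.sqrt (2 * (2 * W + v ^ 2)) := by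
  apply Real.le_sqrt_of_sq_le
  have h1 : (W / (2 * s) + s) ^ 2 = W * W / (4 * s ^ 2) + W + s ^ 2 := by
    field_simp
    ring
  have h2 : W * W / (4 * s ^ 2) ≤ W := by
    rw [div_le_iff₀ (by positivity)]
    nlinarith
  rw [h1]
  rcases hsW with h | rfl
  · nlinarith [sq_nonneg v]
  · nlinarith [sq_nonneg s]

/-- If `S` exceeds the self-normalized threshold, the sub-gamma exponent at the parameter
`(b / 3 + s / a)⁻¹` is at least `a ^ 2`. -/
theorem sq_le_of_threshold_lt {S W X a s b m v : ℝ} (ha : 0 < a) (hs : 0 < s) (hb : 0 ≤ b)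
    (hsqrt : W / (2 * s) + s ≤ Real.sqrt (2 * (2 * W + v ^ 2))) (hbX : b ≤ 2 * (2 * X + m))
    (hS : a * Real.sqrt (2 * (2 * W + v ^ 2)) + (2 / 3) * a ^ 2 * (2 * X + m) < S) :
    a ^ 2 ≤ (b / 3 + s / a)⁻¹ * S -
      (b / 3 + s / a)⁻¹ ^ 2 / (2 * (1 - (b / 3 + s / a)⁻¹ * b / 3)) * W := by
  have hq : 0 < s / a := by positivity
  have hD : 0 < b / 3 + s / a := by positivity
  have h1 : 1 - (b / 3 + s / a)⁻¹ * b / 3 = (b / 3 + s / a)⁻¹ * (s / a) := by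
    field_simp
    ring
  have h2 : (b / 3 + s / a)⁻¹ * S -
      (b / 3 + s / a)⁻¹ ^ 2 / (2 * ((b / 3 + s / a)⁻¹ * (s / a))) * W =
      (S - a * (W / (2 * s))) / (b / 3 + s / a) := by
    field_simp
  rw [h1, h2, le_div_iff₀ hD]
  have h3 : a ^ 2 * (b / 3 + s / a) = a ^ 2 * b / 3 + a * s := by field_simp
  rw [h3]
  nlinarith [mul_le_mul_of_nonneg_left hsqrt ha.le, mul_le_mul_of_nonneg_left hbX (sq_nonneg a)]

/-- Geometric grid for the conditional variance. -/
theorem exists_variance_level {W v V : ℝ} (hv : 0 < v) (hW : 0 ≤ W) (hWV : W ≤ V ^ 2) :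
    ∃ k < ⌊2 * Real.log (V / v)⌋₊ + 1,
      W / (2 * (v * Real.exp (k / 2))) + v * Real.exp (k / 2) ≤
        Real.sqrt (2 * (2 * W + v ^ 2)) := by
  have hsq : ∀ y : ℝ, (v * Real.exp (y / 2)) ^ 2 = v ^ 2 * Real.exp y := fun y => by
    rw [mul_pow, ← Real.exp_nat_mul]
    congr 2
    push_cast
    ring
  have he : Real.exp 1 < 3 := Real.exp_one_lt_three
  rcases le_total W (v ^ 2) with hWv | hWv
  · refine ⟨0, Nat.succ_pos _, div_add_le_sqrt hW (by positivity) ?_ (.inr (by simp))⟩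
    rw [hsq]
    simp only [Nat.cast_zero, Real.exp_zero]
    nlinarith
  · have hv2 : 0 < v ^ 2 := by positivity
    have hr : 1 ≤ W / v ^ 2 := (one_le_div hv2).mpr hWv
    have hlog : 0 ≤ Real.log (W / v ^ 2) := Real.log_nonneg hr
    have hexp : v ^ 2 * Real.exp (Real.log (W / v ^ 2)) = W := by
      rw [Real.exp_log (by linarith)]
      field_simp
    refine ⟨⌊Real.log (W / v ^ 2)⌋₊, Nat.lt_succ_of_le (Nat.floor_le_floor ?_),
      div_add_le_sqrt hW (by positivity) ?_ (.inl ?_)⟩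
    · have h2 : 2 * Real.log (V / v) = Real.log (V ^ 2 / v ^ 2) := by
        rw [← div_pow, Real.log_pow]
        norm_num
      rw [h2]
      gcongr
    · rw [hsq]
      have h1 := (Nat.lt_floor_add_one (Real.log (W / v ^ 2))).le
      calc W = v ^ 2 * Real.exp (Real.log (W / v ^ 2)) := hexp.symm
        _ ≤ v ^ 2 * Real.exp (⌊Real.log (W / v ^ 2)⌋₊ + 1) := by gcongr
        _ ≤ 3 * (v ^ 2 * Real.exp ⌊Real.log (W / v ^ 2)⌋₊) := by
          rw [Real.exp_add]
          have := mul_pos hv2 (Real.exp_pos (⌊Real.log (W / v ^ 2)⌋₊ : ℝ))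
          nlinarith
    · rw [hsq]
      calc _ ≤ v ^ 2 * Real.exp (Real.log (W / v ^ 2)) := by
            gcongr
            exact Nat.floor_le hlog
        _ = W := hexp

/-- Geometric grid for the largest increment. -/
theorem exists_range_level {X m M : ℝ} (hm : 0 < m) (hX : 0 ≤ X) (hXM : X ≤ M) :
    ∃ j < ⌈Real.log (M / m)⌉₊ + 1,
      X ≤ m * Real.exp j ∧ m * Real.exp j ≤ 2 * (2 * X + m) := by
  rcases le_total X m with hXm | hmX
  · refine ⟨0, Nat.succ_pos _, ?_, ?_⟩ <;> simp <;> linarith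
  · have hXp : 0 < X := hm.trans_le hmX
    have hlog : 0 ≤ Real.log (X / m) := Real.log_nonneg ((one_le_div hm).mpr hmX)
    have hexp : m * Real.exp (Real.log (X / m)) = X := by
      rw [Real.exp_log (by positivity)]
      field_simp
    refine ⟨⌈Real.log (X / m)⌉₊, Nat.lt_succ_of_le (Nat.ceil_le_ceil ?_), ?_, ?_⟩
    · gcongr
    · calc X = m * Real.exp (Real.log (X / m)) := hexp.symm
        _ ≤ _ := by
          gcongr
          exact Nat.le_ceil _
    · calc _ ≤ m * Real.exp (Real.log (X / m) + 1) := by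
            gcongr
            exact (Nat.ceil_lt_add_one hlog).le
        _ = X * Real.exp 1 := by rw [Real.exp_add, ← mul_assoc, hexp]
        _ ≤ 2 * (2 * X + m) := by nlinarith [Real.exp_one_lt_three]

/-- **Peeling corollary of Freedman's inequality.** For a martingale difference sequence
`x_1, …, x_t` with `|x_i| ≤ M` and `∑ E[x_i²|ℋ_{i-1}] ≤ V²` almost surely, and
`ι := √(log((2 log(V/v) + 2)(log(M/m) + 2)/δ))`, one has
`P( ∑ x_i > ι √(2(2 ∑ E[x_i²|ℋ_{i-1}] + v²)) + (2/3) ι² (2 max_i |x_i| + m) ) ≤ δ`. -/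
theorem stmt4 {Ω : Type*} {m0 : MeasurableSpace Ω} (μ : Measure Ω) [IsProbabilityMeasure μ]
    (t : ℕ) (ht : 0 < t)
    (ℋ : ℕ → MeasurableSpace Ω)
    (hmono : ∀ i, ℋ i ≤ ℋ (i + 1))
    (hle : ∀ i, ℋ i ≤ m0)
    (x : ℕ → Ω → ℝ)
    (hadapted : ∀ i ∈ Finset.Icc 1 t, Measurable[ℋ i] (x i))
    (M m v V : ℝ) (hm : 0 < m) (hM : m ≤ M) (hv : 0 < v) (hV : v ≤ V)
    (hmean : ∀ i ∈ Finset.Icc 1 t, μ[x i | ℋ (i - 1)] =ᵐ[μ] 0)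
    (hbound : ∀ i ∈ Finset.Icc 1 t, ∀ᵐ ω ∂μ, |x i ω| ≤ M)
    (hvar : ∀ᵐ ω ∂μ,
      ∑ i ∈ Finset.Icc 1 t, (μ[fun ω' => (x i ω') ^ 2 | ℋ (i - 1)]) ω ≤ V ^ 2)
    (δ : ℝ) (hδ : δ ∈ Set.Ioo (0 : ℝ) 1)
    (ι : ℝ)
    (hι : ι = Real.sqrt (Real.log
      ((2 * Real.log (V / v) + 2) * (Real.log (M / m) + 2) / δ))) :
    μ {ω | ∑ i ∈ Finset.Icc 1 t, x i ω >
        ι * Real.sqrt (2 * (2 * ∑ i ∈ Finset.Icc 1 t,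
            (μ[fun ω' => (x i ω') ^ 2 | ℋ (i - 1)]) ω + v ^ 2))
          + (2 / 3) * ι ^ 2 *
            (2 * (Finset.Icc 1 t).sup' (Finset.nonempty_Icc.mpr (by omega)) (fun i => |x i ω|)
              + m)}
      ≤ ENNReal.ofReal δ := by
  obtain ⟨hδ0, hδ1⟩ := hδ
  have hlogV : 0 ≤ Real.log (V / v) := Real.log_nonneg ((one_le_div hv).mpr hV)
  have hlogM : 0 ≤ Real.log (M / m) := Real.log_nonneg ((one_le_div hm).mpr hM)
  set A := (2 * Real.log (V / v) + 2) * (Real.log (M / m) + 2) with hA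
  have hA1 : 1 < A := by nlinarith [mul_nonneg hlogV hlogM]
  have hAδ : 1 < A / δ := by
    rw [one_lt_div hδ0]
    linarith
  have hL : 0 < Real.log (A / δ) := Real.log_pos hAδ
  have hι0 : 0 < ι := hι ▸ Real.sqrt_pos.mpr hL
  have hι2 : ι ^ 2 = Real.log (A / δ) := by rw [hι, Real.sq_sqrt hL.le]
  set s : ℕ → ℝ := fun k => v * Real.exp (k / 2)
  set b : ℕ → ℝ := fun j => m * Real.exp j
  have hs : ∀ k, 0 < s k := fun k => by positivity
  have hb : ∀ j, 0 < b j := fun j => by positivity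
  set l : ℕ × ℕ → ℝ := fun p => (b p.2 / 3 + s p.1 / ι)⁻¹ with hl_def
  set G : ℕ × ℕ → Set Ω := fun p => {ω | ι ^ 2 ≤
    l p * (∑ i ∈ Finset.Icc 1 t, if x i ω ≤ b p.2 then x i ω else 0) -
      l p ^ 2 / (2 * (1 - l p * b p.2 / 3)) *
        ∑ i ∈ Finset.Icc 1 t, (μ[fun ω' => x i ω' ^ 2 | ℋ (i - 1)]) ω}
  have hG : ∀ p, μ (G p) ≤ ENNReal.ofReal (δ / A) := by
    intro p
    have hD : 0 < b p.2 / 3 + s p.1 / ι :=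
      add_pos (div_pos (hb _) three_pos) (div_pos (hs _) hι0)
    have hlb : l p * b p.2 < 3 := by
      rw [hl_def, inv_mul_lt_iff₀ hD]
      linarith [div_pos (hs p.1) hι0]
    have h := measure_le_sum_truncation_le (monotone_nat_of_le_succ hmono) hle hadapted hmean
      hbound (inv_pos.mpr hD).le (hb p.2).le hlb (ι ^ 2)
    rwa [hι2, Real.exp_neg, Real.exp_log (by linarith), inv_div, ← hι2] at h
  set I := Finset.range (⌊2 * Real.log (V / v)⌋₊ + 1) ×ˢ Finset.range (⌈Real.log (M / m)⌉₊ + 1)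
    with hI
  refine (measure_mono_ae (t := ⋃ p ∈ I, G p) ?_).trans ((measure_biUnion_finset_le I G).trans ?_)
  · have hv0 : ∀ᵐ ω ∂μ, ∀ i ∈ Finset.Icc 1 t, 0 ≤ (μ[fun ω' => x i ω' ^ 2 | ℋ (i - 1)]) ω :=
      (Finset.eventually_all _).mpr fun i _ =>
        condExp_nonneg (ae_of_all _ fun ω => sq_nonneg (x i ω))
    filter_upwards [hvar, hv0, (Finset.eventually_all _).mpr hbound] with ω h1 h2 h3 hS
    obtain ⟨k, hk, hsk⟩ := exists_variance_level hv (Finset.sum_nonneg h2) h1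
    have h1t : 1 ∈ Finset.Icc 1 t := Finset.mem_Icc.mpr ⟨le_rfl, ht⟩
    obtain ⟨j, hj, hXj, hjX⟩ := exists_range_level hm
      ((abs_nonneg _).trans (Finset.le_sup' (fun i => |x i ω|) h1t)) (Finset.sup'_le _ _ h3)
    have hsum : (∑ i ∈ Finset.Icc 1 t, if x i ω ≤ b j then x i ω else 0) =
        ∑ i ∈ Finset.Icc 1 t, x i ω :=
      Finset.sum_congr rfl fun i hi => if_pos <|
        (le_abs_self _).trans ((Finset.le_sup' (fun i => |x i ω|) hi).trans hXj)
    refine Set.mem_biUnion (x := (k, j)) (by simp [hI, hk, hj]) ?_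
    change ι ^ 2 ≤ l (k, j) * _ - _
    rw [hsum]
    exact sq_le_of_threshold_lt hι0 (hs k) (hb j).le hsk hjX hS
  · refine (Finset.sum_le_card_nsmul I _ _ fun p _ => hG p).trans ?_
    rw [nsmul_eq_mul, ← ENNReal.ofReal_natCast, ← ENNReal.ofReal_mul (Nat.cast_nonneg _)]
    apply ENNReal.ofReal_le_ofReal
    have hcard : (I.card : ℝ) ≤ A := by
      simp only [hI, Finset.card_product, Finset.card_range, hA]
      push_cast
      have h1 := Nat.floor_le (mul_nonneg zero_le_two hlogV)
      have h2 := (Nat.ceil_lt_add_one hlogM).le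
      exact mul_le_mul (by linarith) (by linarith) (by positivity) (by linarith)
    calc (I.card : ℝ) * (δ / A) ≤ A * (δ / A) := by gcongr
      _ = δ := mul_div_cancel₀ δ (by linarith)
end

section
/- (Weighted martingale concentration for a fixed pair of functions; Lemma C.2 of the paper.) Let Z be a measurable space, L ≥ 1, and F a finite set of measurable functions Z → [0, L] with |F| = N. Let λ > 0, 0 < α ≤ 1, let t, T be positive integers with t − 1 ≤ T, and let δ ∈ (0, 1). Set υ := √( log( N² (2 log(4LT/α) + 2)(log(8L/α²) + 2) / δ ) ). Let (𝒢_s)_{s=0}^{t−1} be a filtration and suppose for each s = 1, …, t−1: z_s is a 𝒢_{s−1}-measurable Z-valued random variable; σ̄_s is a 𝒢_{s−1}-measurable random variable with σ̄_s ≥ α and σ̄_s ≥ 2 √( υ · D_F(z_s; z_{[s−1]}, σ̄_{[s−1]}) ) almost surely; and η_s is a 𝒢_s-measurable random variable with E[η_s | 𝒢_{s−1}] = 0, |η_s| ≤ 2 almost surely, and E[η_s² | 𝒢_{s−1}] ≤ σ̄_s² almost surely. Then for any fixed f, f̃ ∈ F, with probability at least 1 − δ/N²: Σ_{s=1}^{t−1}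 2 (η_s / σ̄_s²) ( f(z_s) − f̃(z_s) ) ≤ (4/3) υ √λ + (2/3) υ² + √2 · υ + (256/9) υ² + (1/4) Σ_{s=1}^{t−1} σ̄_s⁻² ( f(z_s) − f̃(z_s) )². -/
open MeasureTheory Finset

/-- The (squared) uncertainty quantity `D_F²(z; z_{[n]}, σ_{[n]})`; the prefix consists
of the first `n` points `zs 0, …, zs (n-1)` with weights `w 0, …, w (n-1)`. -/
noncomputable def D2 {Z : Type*} (F : Set (Z → ℝ)) (lam : ℝ)
    (z : Z) (n : ℕ) (zs : ℕ → Z) (w : ℕ → ℝ) : ℝ :=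
  sSup {r : ℝ | ∃ f₁ ∈ F, ∃ f₂ ∈ F,
    r = (f₁ z - f₂ z) ^ 2 /
      ((∑ s ∈ Finset.range n, (f₁ (zs s) - f₂ (zs s)) ^ 2 / w s ^ 2) + lam)}

/-- A predictable bounded transform of conditionally centred increments has an exponential
supermartingale compensated by its conditional variance proxy. -/
lemma integral_exp_sum_mul_sub_le_one {Ω : Type*} {m0 : MeasurableSpace Ω} (μ : Measure Ω)
    [IsProbabilityMeasure μ] (𝒢 : ℕ → MeasurableSpace Ω)
    (hmono : ∀ s, 𝒢 s ≤ 𝒢 (s + 1)) (hle : ∀ s, 𝒢 s ≤ m0)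
    (h σ η : ℕ → Ω → ℝ) (n : ℕ)
    (hh : ∀ s ∈ Finset.Icc 1 n, Measurable[𝒢 (s - 1)] (h s))
    (hσ : ∀ s ∈ Finset.Icc 1 n, Measurable[𝒢 (s - 1)] (σ s))
    (hhb : ∀ s ∈ Finset.Icc 1 n, ∀ ω, |h s ω| ≤ 1 / 2)
    (hη : ∀ s ∈ Finset.Icc 1 n, Measurable[𝒢 s] (η s))
    (hmean : ∀ s ∈ Finset.Icc 1 n, μ[η s | 𝒢 (s - 1)] =ᵐ[μ] 0)
    (hbdd : ∀ s ∈ Finset.Icc 1 n, ∀ᵐ ω ∂μ, |η s ω| ≤ 2)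
    (hvar : ∀ s ∈ Finset.Icc 1 n, ∀ᵐ ω ∂μ,
      (μ[fun ω' => (η s ω') ^ 2 | 𝒢 (s - 1)]) ω ≤ (σ s ω) ^ 2) :
    let M := fun ω => Real.exp (∑ s ∈ Finset.Icc 1 n,
      (h s ω * η s ω - (h s ω) ^ 2 * (σ s ω) ^ 2))
    Measurable[𝒢 n] M ∧ Integrable M μ ∧ ∫ ω, M ω ∂μ ≤ 1 := by
  have ebound : ∀ m ≤ n, ∀ᵐ ω ∂μ, Real.exp (∑ s ∈ Finset.Icc 1 m,
      (h s ω * η s ω - (h s ω) ^ 2 * (σ s ω) ^ 2)) ≤ Real.exp m := by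
    intro m hm
    have : ∀ᵐ ω ∂μ, ∀ s ∈ Finset.Icc 1 m, |η s ω| ≤ 2 := by
      rw [Filter.eventually_all_finset]
      intro s hs
      exact hbdd s (by grind)
    filter_upwards [this] with ω hω
    apply Real.exp_le_exp.2
    calc _ ≤ ∑ s ∈ Finset.Icc 1 m, (1 : ℝ) := by
          apply Finset.sum_le_sum
          intro s hs
          have h1 := hhb s (by grind) ω
          have h2 := hω s hs
          have h3 : |h s ω * η s ω| ≤ 1 := by
            rw [abs_mul]
            nlinarith [abs_nonneg (h s ω), abs_nonneg (η s ω)]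
          have h4 := le_abs_self (h s ω * η s ω)
          nlinarith [mul_nonneg (sq_nonneg (h s ω)) (sq_nonneg (σ s ω))]
      _ = m := by simp
  induction n with
  | zero => simp
  | succ n ih =>
    obtain ⟨ihm, ihi, ih1⟩ := ih (fun s hs => hh s (by grind)) (fun s hs => hσ s (by grind))
      (fun s hs => hhb s (by grind)) (fun s hs => hη s (by grind))
      (fun s hs => hmean s (by grind)) (fun s hs => hbdd s (by grind))
      (fun s hs => hvar s (by grind)) (fun m hm => ebound m (by grind))
    have hmem : n + 1 ∈ Finset.Icc 1 (n + 1) := by simp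
    have hh' : Measurable[𝒢 n] (h (n + 1)) := by simpa using hh _ hmem
    have hσ' : Measurable[𝒢 n] (σ (n + 1)) := by simpa using hσ _ hmem
    have hη' := hη _ hmem
    have hmean' : μ[η (n + 1) | 𝒢 n] =ᵐ[μ] 0 := by simpa using hmean _ hmem
    have hvar' : ∀ᵐ ω ∂μ, (μ[fun ω' => (η (n + 1) ω') ^ 2 | 𝒢 n]) ω ≤ (σ (n + 1) ω) ^ 2 := by
      simpa using hvar _ hmem
    have hbdd' := hbdd _ hmem
    have hhb' := hhb _ hmem
    set M := fun ω => Real.exp (∑ s ∈ Finset.Icc 1 n,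
      (h s ω * η s ω - (h s ω) ^ 2 * (σ s ω) ^ 2)) with hM
    set P := fun ω => M ω * Real.exp (-((h (n + 1) ω) ^ 2 * (σ (n + 1) ω) ^ 2)) with hP
    set E := fun ω => Real.exp (h (n + 1) ω * η (n + 1) ω) with hE
    have hPm : Measurable[𝒢 n] P := by
      apply Measurable.mul ihm
      apply Real.measurable_exp.comp
      exact ((hh'.pow_const 2).mul (hσ'.pow_const 2)).neg
    have hη0 : Measurable[m0] (η (n + 1)) := hη'.mono (hle _) le_rfl
    have hh0 : Measurable[m0] (h (n + 1)) := hh'.mono (hle _) le_rfl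
    have hYm : Measurable[m0] (fun ω => h (n + 1) ω * η (n + 1) ω) := hh0.mul hη0
    have hEm : Measurable[m0] E := Real.measurable_exp.comp hYm
    have hprod : (fun ω => Real.exp (∑ s ∈ Finset.Icc 1 (n + 1),
        (h s ω * η s ω - (h s ω) ^ 2 * (σ s ω) ^ 2))) = P * E := by
      ext ω
      rw [Finset.sum_Icc_succ_top (by omega)]
      simp only [hP, hE, hM, Pi.mul_apply, ← Real.exp_add]
      congr 1
      ring
    have hPle : ∀ ω, P ω ≤ M ω := by
      intro ω
      have : Real.exp (-((h (n + 1) ω) ^ 2 * (σ (n + 1) ω) ^ 2)) ≤ 1 := by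
        apply Real.exp_le_one_iff.2
        nlinarith [mul_nonneg (sq_nonneg (h (n + 1) ω)) (sq_nonneg (σ (n + 1) ω))]
      exact mul_le_of_le_one_right (Real.exp_pos _).le this
    have hP0 : ∀ ω, 0 ≤ P ω := fun ω => by positivity
    have hYb : ∀ᵐ ω ∂μ, |h (n + 1) ω * η (n + 1) ω| ≤ 1 := by
      filter_upwards [hbdd'] with ω hω
      rw [abs_mul]
      nlinarith [hhb' ω, abs_nonneg (h (n + 1) ω), abs_nonneg (η (n + 1) ω)]
    have hYint : Integrable (fun ω => h (n + 1) ω * η (n + 1) ω) μ :=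
      Integrable.of_bound hYm.aestronglyMeasurable 1 (by simpa using hYb)
    have hY2int : Integrable (fun ω => (h (n + 1) ω) ^ 2 * (η (n + 1) ω) ^ 2) μ := by
      apply Integrable.of_bound ((hh0.pow_const 2).mul (hη0.pow_const 2)).aestronglyMeasurable 1
      filter_upwards [hYb] with ω hω
      rw [Pi.mul_apply, ← mul_pow, Real.norm_eq_abs, abs_pow]
      exact pow_le_one₀ (abs_nonneg _) hω
    have hηint : Integrable (η (n + 1)) μ :=
      Integrable.of_bound hη0.aestronglyMeasurable 2 (by simpa using hbdd')
    have hη2int : Integrable (fun ω => (η (n + 1) ω) ^ 2) μ := by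
      apply Integrable.of_bound (hη0.pow_const 2).aestronglyMeasurable 4
      filter_upwards [hbdd'] with ω hω
      rw [Real.norm_eq_abs, abs_pow]
      nlinarith [abs_nonneg (η (n + 1) ω)]
    have hEint : Integrable E μ := by
      apply Integrable.of_bound hEm.aestronglyMeasurable (Real.exp 1)
      filter_upwards [hYb] with ω hω
      rw [Real.norm_eq_abs, abs_of_pos (Real.exp_pos _)]
      exact Real.exp_le_exp.2 ((le_abs_self _).trans hω)
    have hPE : Integrable (P * E) μ := by
      rw [← hprod]
      refine Integrable.of_bound ?_ (Real.exp ((n + 1 : ℕ) : ℝ)) ?_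
      · rw [hprod]
        exact ((hPm.mono (hle _) le_rfl).mul hEm).aestronglyMeasurable
      · filter_upwards [ebound (n + 1) le_rfl] with ω hω
        rwa [Real.norm_eq_abs, abs_of_pos (Real.exp_pos _)]
    have hcE : ∀ᵐ ω ∂μ, (μ[E | 𝒢 n]) ω ≤
        Real.exp ((h (n + 1) ω) ^ 2 * (σ (n + 1) ω) ^ 2) := by
      have h1 : μ[E | 𝒢 n] ≤ᵐ[μ] μ[(fun _ => (1 : ℝ)) +
          ((fun ω => h (n + 1) ω * η (n + 1) ω) +
            fun ω => (h (n + 1) ω) ^ 2 * (η (n + 1) ω) ^ 2) | 𝒢 n] := by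
        apply condExp_mono hEint ((integrable_const _).add (hYint.add hY2int))
        filter_upwards [hYb] with ω hω
        have := (abs_le.1 (Real.abs_exp_sub_one_sub_id_le hω)).2
        simp only [hE, Pi.add_apply]
        linarith [mul_pow (h (n + 1) ω) (η (n + 1) ω) 2]
      have h2 := condExp_add (integrable_const (1 : ℝ)) (hYint.add hY2int) (𝒢 n) (μ := μ)
      have h3 := condExp_add hYint hY2int (𝒢 n)
      have h4 : μ[fun ω => h (n + 1) ω * η (n + 1) ω | 𝒢 n] =ᵐ[μ]
          h (n + 1) * μ[η (n + 1) | 𝒢 n] :=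
        condExp_mul_of_stronglyMeasurable_left hh'.stronglyMeasurable hYint hηint
      have h5 : μ[fun ω => (h (n + 1) ω) ^ 2 * (η (n + 1) ω) ^ 2 | 𝒢 n] =ᵐ[μ]
          (fun ω => (h (n + 1) ω) ^ 2) * μ[fun ω => (η (n + 1) ω) ^ 2 | 𝒢 n] :=
        condExp_mul_of_stronglyMeasurable_left (hh'.pow_const 2).stronglyMeasurable hY2int hη2int
      filter_upwards [h1, h2, h3, h4, h5, hmean', hvar'] with ω h1 h2 h3 h4 h5 h6 h7
      rw [h2, Pi.add_apply, h3, Pi.add_apply, h4, h5, Pi.mul_apply, h6,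
        condExp_const (hle n)] at h1
      simp only [Pi.mul_apply, Pi.zero_apply] at h1
      have := Real.add_one_le_exp ((h (n + 1) ω) ^ 2 * (σ (n + 1) ω) ^ 2)
      nlinarith [mul_le_mul_of_nonneg_left h7 (sq_nonneg (h (n + 1) ω))]
    have hcond : μ[P * E | 𝒢 n] =ᵐ[μ] P * μ[E | 𝒢 n] :=
      condExp_mul_of_stronglyMeasurable_left hPm.stronglyMeasurable hPE hEint
    intro M'
    have hM' : M' = P * E := hprod
    rw [hM']
    refine ⟨?_, hPE, ?_⟩
    · refine (hPm.mono (hmono n) le_rfl).mul (Real.measurable_exp.comp ?_)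
      exact (hh'.mono (hmono n) le_rfl).mul hη'
    · rw [← integral_condExp (hle n)]
      refine le_trans (integral_mono_ae integrable_condExp ihi ?_) ih1
      filter_upwards [hcond, hcE] with ω h1 h2
      rw [h1, Pi.mul_apply]
      calc P ω * (μ[E | 𝒢 n]) ω
          ≤ P ω * Real.exp ((h (n + 1) ω) ^ 2 * (σ (n + 1) ω) ^ 2) :=
            mul_le_mul_of_nonneg_left h2 (hP0 ω)
        _ = M ω := by
            simp only [hP]
            rw [mul_assoc, ← Real.exp_add]
            simp

/-- Chernoff bound for an exponential with expectation at most one. -/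
lemma measure_lt_le_exp_neg {Ω : Type*} {m0 : MeasurableSpace Ω} (μ : Measure Ω)
    (S : Ω → ℝ) (hint : Integrable (fun ω => Real.exp (S ω)) μ)
    (hle : ∫ ω, Real.exp (S ω) ∂μ ≤ 1) (x : ℝ) :
    μ {ω | x < S ω} ≤ ENNReal.ofReal (Real.exp (-x)) := by
  have h1 : ∫⁻ ω, ENNReal.ofReal (Real.exp (S ω)) ∂μ ≤ 1 := by
    rw [← ofReal_integral_eq_lintegral_ofReal hint
      (Filter.Eventually.of_forall fun ω => (Real.exp_pos _).le)]
    simpa using ENNReal.ofReal_le_ofReal hle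
  have h2 := mul_meas_ge_le_lintegral₀ (μ := μ) (f := fun ω => ENNReal.ofReal (Real.exp (S ω)))
    hint.aestronglyMeasurable.aemeasurable.ennreal_ofReal (ENNReal.ofReal (Real.exp x))
  have h3 : μ {ω | x < S ω} ≤
      μ {ω | ENNReal.ofReal (Real.exp x) ≤ ENNReal.ofReal (Real.exp (S ω))} := by
    apply measure_mono
    intro ω hω
    exact ENNReal.ofReal_le_ofReal (Real.exp_le_exp.2 (le_of_lt hω))
  rw [Real.exp_neg, ENNReal.ofReal_inv_of_pos (Real.exp_pos x)]
  refine h3.trans ?_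
  rw [ENNReal.le_inv_iff_mul_le, mul_comm]
  exact h2.trans h1

/-- The uncertainty quantity controls the difference of any two functions of a finite class. -/
lemma abs_sub_le_sqrt_D2_mul {Z : Type*} (F : Finset (Z → ℝ)) {lam : ℝ} (hlam : 0 < lam)
    (z : Z) (n : ℕ) (zs : ℕ → Z) (w : ℕ → ℝ) {f₁ f₂ : Z → ℝ} (h₁ : f₁ ∈ F) (h₂ : f₂ ∈ F) :
    |f₁ z - f₂ z| ≤ Real.sqrt (D2 (↑F) lam z n zs w) *
      Real.sqrt ((∑ s ∈ Finset.range n, (f₁ (zs s) - f₂ (zs s)) ^ 2 / w s ^ 2) + lam) := by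
  have hpos : 0 < (∑ s ∈ Finset.range n, (f₁ (zs s) - f₂ (zs s)) ^ 2 / w s ^ 2) + lam := by
    positivity
  have hfin : {r : ℝ | ∃ f₁ ∈ (F : Set (Z → ℝ)), ∃ f₂ ∈ (F : Set (Z → ℝ)),
      r = (f₁ z - f₂ z) ^ 2 /
        ((∑ s ∈ Finset.range n, (f₁ (zs s) - f₂ (zs s)) ^ 2 / w s ^ 2) + lam)}.Finite := by
    refine ((F.finite_toSet.prod F.finite_toSet).image fun p : (Z → ℝ) × (Z → ℝ) =>
      (p.1 z - p.2 z) ^ 2 /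
        ((∑ s ∈ Finset.range n, (p.1 (zs s) - p.2 (zs s)) ^ 2 / w s ^ 2) + lam)).subset ?_
    rintro r ⟨g₁, hg₁, g₂, hg₂, rfl⟩
    exact ⟨(g₁, g₂), ⟨hg₁, hg₂⟩, rfl⟩
  have hD : (f₁ z - f₂ z) ^ 2 /
      ((∑ s ∈ Finset.range n, (f₁ (zs s) - f₂ (zs s)) ^ 2 / w s ^ 2) + lam) ≤
      D2 (↑F) lam z n zs w :=
    le_csSup hfin.bddAbove ⟨f₁, h₁, f₂, h₂, rfl⟩
  rw [← Real.sqrt_mul' _ hpos.le]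
  apply Real.abs_le_sqrt
  rwa [div_le_iff₀ hpos] at hD

/-- A geometric grid with ratio `exp (1/2)` rounds `x` up by at most a factor `16/9`. -/
lemma exists_geometric_grid {x q B : ℝ} (hx : 0 < x) (hq : 0 < q) (hB : x ≤ B * q) :
    ∃ k ∈ Finset.range (⌈2 * Real.log B⌉₊ + 1),
      x ≤ q * Real.exp (k / 2) ∧
      (q * Real.exp (k / 2) ≤ q ∨ q * Real.exp (k / 2) ≤ 16 / 9 * x) := by
  have hxq : 0 < x / q := by positivity
  have hexp : Real.exp (Real.log (x / q)) = x / q := Real.exp_log hxq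
  refine ⟨⌈2 * Real.log (x / q)⌉₊, ?_, ?_, ?_⟩
  · have : Real.log (x / q) ≤ Real.log B := Real.log_le_log hxq (by rwa [div_le_iff₀ hq])
    have := Nat.ceil_mono (show 2 * Real.log (x / q) ≤ 2 * Real.log B by linarith)
    simp only [Finset.mem_range]
    omega
  · have h1 := Nat.le_ceil (2 * Real.log (x / q))
    have h2 : x / q ≤ Real.exp ((⌈2 * Real.log (x / q)⌉₊ : ℝ) / 2) := by
      rw [← hexp, Real.exp_le_exp, hexp]
      linarith
    rw [div_le_iff₀ hq] at h2
    linarith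
  · rcases Nat.eq_zero_or_pos ⌈2 * Real.log (x / q)⌉₊ with h0 | h0
    · left
      simp [h0]
    · right
      have h1 := Nat.ceil_lt_add_one (Nat.ceil_pos.1 h0).le
      have h2 : Real.exp ((⌈2 * Real.log (x / q)⌉₊ : ℝ) / 2) ≤ x / q * Real.exp (1 / 2) := by
        nth_rewrite 2 [← hexp]
        rw [← Real.exp_add, Real.exp_le_exp]
        linarith
      have h3 : Real.exp (1 / 2) ≤ 16 / 9 := by
        have h4 : Real.exp (1 / 2) * Real.exp (1 / 2) = Real.exp 1 := by
          rw [← Real.exp_add]; norm_num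
        nlinarith [Real.exp_one_lt_d9, Real.exp_pos (1 / 2)]
      calc _ ≤ q * (x / q * Real.exp (1 / 2)) := by gcongr
        _ = x * Real.exp (1 / 2) := by field_simp
        _ ≤ _ := by nlinarith

/-- Optimising the Chernoff exponent `θ = u / √Q` over a grid of values of `Q`. -/
lemma le_of_chernoff_exponent {u lam W Q X : ℝ} (hu : 0 < u) (hlam : 0 < lam) (hW : 0 ≤ W)
    (hWQ : W + lam ≤ Q) (hQ : Q ≤ lam + u ^ 2 / 4 ∨ Q ≤ 16 / 9 * (W + lam))
    (hX : u / Real.sqrt Q * X - 4 * (u / Real.sqrt Q) ^ 2 * W ≤ u ^ 2) :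
    X ≤ 4 / 3 * u * Real.sqrt lam + 2 / 3 * u ^ 2 + 256 / 9 * u ^ 2 + 1 / 4 * W := by
  have hQ0 : 0 < Q := by linarith
  have hr := Real.sqrt_pos.2 hQ0
  have hr2 := Real.sq_sqrt hQ0.le
  have ha := Real.sqrt_nonneg lam
  have ha2 := Real.sq_sqrt hlam.le
  have hb := Real.sqrt_nonneg W
  have hb2 := Real.sq_sqrt hW
  have hbr : Real.sqrt W ≤ Real.sqrt Q := Real.sqrt_le_sqrt (by linarith)
  set r := Real.sqrt Q
  set a := Real.sqrt lam
  set b := Real.sqrt W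
  have hrle : r ≤ 4 / 3 * (a + b) + u / 2 := by
    apply Real.sqrt_le_iff.2
    refine ⟨by positivity, ?_⟩
    have := mul_nonneg ha hb
    have := mul_nonneg ha hu.le
    have := mul_nonneg hb hu.le
    rcases hQ with hQ | hQ <;> nlinarith
  have h1 : X ≤ u * r + 4 * u * (W / r) := by
    have : u / r * X ≤ u / r * (u * r + 4 * u * (W / r)) := by
      have : u / r * (u * r + 4 * u * (W / r)) = u ^ 2 + 4 * (u / r) ^ 2 * W := by
        field_simp
      linarith
    exact le_of_mul_le_mul_left this (by positivity)
  have h2 : W / r ≤ b := by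
    rw [div_le_iff₀ hr]
    nlinarith
  nlinarith [mul_le_mul_of_nonneg_left h2 hu.le, mul_le_mul_of_nonneg_left hrle hu.le,
    sq_nonneg (b / 2 - 16 / 3 * u)]

set_option maxHeartbeats 800000 in
/-- **Weighted martingale concentration for a fixed pair of functions (Lemma C.2).**
With predictable points `z_s`, predictable weights `σ̄_s ≥ max(α, 2√(υ·D_F(z_s; z_{[s-1]}, σ̄_{[s-1]})))`
and martingale differences `η_s` with `|η_s| ≤ 2` and `E[η_s²|𝒢_{s-1}] ≤ σ̄_s²`, for any
fixed `f, f̃ ∈ F`, with probability at least `1 - δ/N²`,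
`∑_s 2 (η_s/σ̄_s²)(f(z_s) - f̃(z_s)) ≤ (4/3) υ √λ + (2/3) υ² + √2 υ + (256/9) υ²
  + (1/4) ∑_s σ̄_s⁻² (f(z_s) - f̃(z_s))²`. -/
theorem stmt5 {Ω : Type*} {m0 : MeasurableSpace Ω} (μ : Measure Ω) [IsProbabilityMeasure μ]
    {Z : Type*} [MeasurableSpace Z]
    (L : ℝ) (hL : 1 ≤ L)
    (F : Finset (Z → ℝ)) (hFmeas : ∀ f ∈ F, Measurable f)
    (hFrange : ∀ f ∈ F, ∀ x, f x ∈ Set.Icc 0 L)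
    (N : ℕ) (hN : F.card = N)
    (lam α : ℝ) (hlam : 0 < lam) (hα0 : 0 < α) (hα1 : α ≤ 1)
    (t T : ℕ) (ht : 0 < t) (hT : 0 < T) (htT : t - 1 ≤ T)
    (δ : ℝ) (hδ : δ ∈ Set.Ioo (0 : ℝ) 1)
    (υ : ℝ)
    (hυ : υ = Real.sqrt (Real.log ((N : ℝ) ^ 2 *
      (2 * Real.log (4 * L * (T : ℝ) / α) + 2) * (Real.log (8 * L / α ^ 2) + 2) / δ)))
    (𝒢 : ℕ → MeasurableSpace Ω)
    (hmono : ∀ s, 𝒢 s ≤ 𝒢 (s + 1)) (hle : ∀ s, 𝒢 s ≤ m0)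
    (z : ℕ → Ω → Z) (σb η : ℕ → Ω → ℝ)
    (hzmeas : ∀ s ∈ Finset.Icc 1 (t - 1), Measurable[𝒢 (s - 1)] (z s))
    (hσmeas : ∀ s ∈ Finset.Icc 1 (t - 1), Measurable[𝒢 (s - 1)] (σb s))
    (hσα : ∀ s ∈ Finset.Icc 1 (t - 1), ∀ᵐ ω ∂μ, α ≤ σb s ω)
    (hσD : ∀ s ∈ Finset.Icc 1 (t - 1), ∀ᵐ ω ∂μ,
      2 * Real.sqrt (υ * Real.sqrt
          (D2 (↑F) lam (z s ω) (s - 1) (fun i => z (i + 1) ω) (fun i => σb (i + 1) ω)))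
        ≤ σb s ω)
    (hηmeas : ∀ s ∈ Finset.Icc 1 (t - 1), Measurable[𝒢 s] (η s))
    (hηmean : ∀ s ∈ Finset.Icc 1 (t - 1), μ[η s | 𝒢 (s - 1)] =ᵐ[μ] 0)
    (hηbdd : ∀ s ∈ Finset.Icc 1 (t - 1), ∀ᵐ ω ∂μ, |η s ω| ≤ 2)
    (hηvar : ∀ s ∈ Finset.Icc 1 (t - 1), ∀ᵐ ω ∂μ,
      (μ[fun ω' => (η s ω') ^ 2 | 𝒢 (s - 1)]) ω ≤ (σb s ω) ^ 2)
    (f ftil : Z → ℝ) (hf : f ∈ F) (hftil : ftil ∈ F) :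
    ENNReal.ofReal (1 - δ / (N : ℝ) ^ 2) ≤
      μ {ω | ∑ s ∈ Finset.Icc 1 (t - 1),
            2 * (η s ω / (σb s ω) ^ 2) * (f (z s ω) - ftil (z s ω))
          ≤ (4 / 3) * υ * Real.sqrt lam + (2 / 3) * υ ^ 2 + Real.sqrt 2 * υ
            + (256 / 9) * υ ^ 2
            + (1 / 4) * ∑ s ∈ Finset.Icc 1 (t - 1),
                (f (z s ω) - ftil (z s ω)) ^ 2 / (σb s ω) ^ 2} := by
  have hNpos : (1 : ℝ) ≤ N := by
    have : 0 < F.card := Finset.card_pos.2 ⟨f, hf⟩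
    exact_mod_cast hN ▸ this
  have hN2 : (1 : ℝ) ≤ (N : ℝ) ^ 2 := one_le_pow₀ hNpos
  have hT1 : (1 : ℝ) ≤ T := by exact_mod_cast hT
  have hδ0 := hδ.1
  have hδ1 := hδ.2
  have hLα : 1 ≤ L / α := by rw [le_div_iff₀ hα0]; linarith
  have hx4 : 4 ≤ 4 * L * (T : ℝ) / α := by
    have : 4 * L * (T : ℝ) / α = 4 * (L / α * T) := by ring
    rw [this]
    nlinarith
  have hA : 0 ≤ Real.log (4 * L * (T : ℝ) / α) := Real.log_nonneg (by linarith)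
  have hB : 0 ≤ Real.log (8 * L / α ^ 2) := by
    apply Real.log_nonneg
    rw [le_div_iff₀ (by positivity)]
    nlinarith
  set A := 2 * Real.log (4 * L * (T : ℝ) / α) + 2 with hAdef
  set B := Real.log (8 * L / α ^ 2) + 2 with hBdef
  have hA2 : 2 ≤ A := by linarith
  have hB2 : 2 ≤ B := by linarith
  have hAB : 2 * A ≤ A * B := by nlinarith
  have hY4 : 4 ≤ (N : ℝ) ^ 2 * A * B / δ := by
    rw [le_div_iff₀ hδ0]
    nlinarith
  have hlog : 1 ≤ Real.log ((N : ℝ) ^ 2 * A * B / δ) := by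
    rw [Real.le_log_iff_exp_le (by linarith)]
    linarith [Real.exp_one_lt_d9]
  have hu2 : υ ^ 2 = Real.log ((N : ℝ) ^ 2 * A * B / δ) := by
    rw [hυ, Real.sq_sqrt (by linarith)]
  have hu0 : 0 < υ := by
    rw [hυ]
    exact Real.sqrt_pos.2 (by linarith)
  have hexpu : Real.exp (-υ ^ 2) = δ / ((N : ℝ) ^ 2 * A * B) := by
    rw [hu2, Real.exp_neg, Real.exp_log (by linarith), inv_div]
  set K := ⌈2 * Real.log (4 * (T * L ^ 2 / α ^ 2))⌉₊ + 1 with hK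
  have hKle : (K : ℝ) ≤ A * B := by
    have h1 : Real.log (4 * (T * L ^ 2 / α ^ 2)) ≤ 2 * Real.log (4 * L * (T : ℝ) / α) := by
      rw [show 2 * Real.log (4 * L * (T : ℝ) / α) = Real.log ((4 * L * (T : ℝ) / α) ^ 2) by
        rw [Real.log_pow]; norm_num]
      apply Real.log_le_log (by positivity)
      have : (4 * L * (T : ℝ) / α) ^ 2 = 16 * T * (T * L ^ 2 / α ^ 2) := by ring
      rw [this]
      have : 0 ≤ T * L ^ 2 / α ^ 2 := by positivity
      nlinarith
    have h0 : 0 ≤ 2 * Real.log (4 * (T * L ^ 2 / α ^ 2)) := by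
      have : 1 ≤ (L / α) ^ 2 := one_le_pow₀ hLα
      have h2 : 4 * (T * L ^ 2 / α ^ 2) = 4 * (T * (L / α) ^ 2) := by ring
      have : 0 ≤ Real.log (4 * (T * L ^ 2 / α ^ 2)) := by
        apply Real.log_nonneg
        rw [h2]
        nlinarith
      linarith
    have := Nat.ceil_lt_add_one h0
    rw [hK]
    push_cast
    linarith
  set g : ℕ → Ω → ℝ := fun s ω => f (z s ω) - ftil (z s ω) with hg
  set Q : ℕ → ℝ := fun k => (lam + υ ^ 2 / 4) * Real.exp (k / 2) with hQ
  have hQpos : ∀ k, 0 < Q k := fun k => by positivity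
  set h : ℕ → ℕ → Ω → ℝ := fun k s ω =>
    if |2 * (υ / Real.sqrt (Q k)) * (g s ω / σb s ω ^ 2)| ≤ 1 / 2
    then 2 * (υ / Real.sqrt (Q k)) * (g s ω / σb s ω ^ 2) else 0 with hh
  set S : ℕ → Ω → ℝ := fun k ω => ∑ s ∈ Finset.Icc 1 (t - 1),
    (h k s ω * η s ω - (h k s ω) ^ 2 * (σb s ω) ^ 2) with hS
  have htail : ∀ k, μ {ω | υ ^ 2 < S k ω} ≤ ENNReal.ofReal (Real.exp (-υ ^ 2)) := by
    intro k
    have hmeas : ∀ s ∈ Finset.Icc 1 (t - 1), Measurable[𝒢 (s - 1)] (h k s) := by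
      intro s hs
      have h1 : Measurable[𝒢 (s - 1)] (g s) :=
        ((hFmeas f hf).comp (hzmeas s hs)).sub ((hFmeas ftil hftil).comp (hzmeas s hs))
      have h2 : Measurable[𝒢 (s - 1)]
          (fun ω => 2 * (υ / Real.sqrt (Q k)) * (g s ω / σb s ω ^ 2)) :=
        (h1.div ((hσmeas s hs).pow_const 2)).const_mul _
      refine Measurable.ite ?_ h2 measurable_const
      exact measurableSet_le (continuous_abs.measurable.comp h2) measurable_const
    have hb : ∀ s ∈ Finset.Icc 1 (t - 1), ∀ ω, |h k s ω| ≤ 1 / 2 := by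
      intro s hs ω
      simp only [hh]
      split_ifs with hc
      · exact hc
      · norm_num
    obtain ⟨-, h1, h2⟩ := integral_exp_sum_mul_sub_le_one μ 𝒢 hmono hle (h k) σb η (t - 1)
      hmeas hσmeas hb hηmeas hηmean hηbdd hηvar
    exact measure_lt_le_exp_neg μ (S k) h1 h2 _
  have hunion : μ (⋃ k ∈ Finset.range K, {ω | υ ^ 2 < S k ω}) ≤
      ENNReal.ofReal (δ / (N : ℝ) ^ 2) := by
    calc _ ≤ ∑ k ∈ Finset.range K, μ {ω | υ ^ 2 < S k ω} := measure_biUnion_finset_le _ _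
      _ ≤ ∑ k ∈ Finset.range K, ENNReal.ofReal (Real.exp (-υ ^ 2)) :=
          Finset.sum_le_sum fun k _ => htail k
      _ = ENNReal.ofReal (K * Real.exp (-υ ^ 2)) := by
          rw [Finset.sum_const, Finset.card_range, nsmul_eq_mul,
            ENNReal.ofReal_mul (by positivity), ENNReal.ofReal_natCast]
      _ ≤ _ := by
          apply ENNReal.ofReal_le_ofReal
          rw [hexpu]
          calc (K : ℝ) * (δ / ((N : ℝ) ^ 2 * A * B))
              ≤ A * B * (δ / ((N : ℝ) ^ 2 * A * B)) := by gcongr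
            _ = δ / (N : ℝ) ^ 2 := by field_simp
  have hσα' : ∀ᵐ ω ∂μ, ∀ s ∈ Finset.Icc 1 (t - 1), α ≤ σb s ω := by
    rwa [Filter.eventually_all_finset]
  have hσD' : ∀ᵐ ω ∂μ, ∀ s ∈ Finset.Icc 1 (t - 1), 2 * Real.sqrt (υ * Real.sqrt
      (D2 (↑F) lam (z s ω) (s - 1) (fun i => z (i + 1) ω) (fun i => σb (i + 1) ω))) ≤
      σb s ω := by
    rwa [Filter.eventually_all_finset]
  set G := {ω | ∑ s ∈ Finset.Icc 1 (t - 1),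
            2 * (η s ω / (σb s ω) ^ 2) * (f (z s ω) - ftil (z s ω))
          ≤ (4 / 3) * υ * Real.sqrt lam + (2 / 3) * υ ^ 2 + Real.sqrt 2 * υ
            + (256 / 9) * υ ^ 2
            + (1 / 4) * ∑ s ∈ Finset.Icc 1 (t - 1),
                (f (z s ω) - ftil (z s ω)) ^ 2 / (σb s ω) ^ 2} with hG
  have hcover : ∀ᵐ ω ∂μ, ω ∈ G ∪ ⋃ k ∈ Finset.range K, {ω | υ ^ 2 < S k ω} := by
    filter_upwards [hσα', hσD'] with ω h1 h2
    by_contra hcon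
    simp only [Set.mem_union, Set.mem_iUnion, Set.mem_ofPred_eq, not_or, not_exists, not_lt]
      at hcon
    obtain ⟨hnG, hSle⟩ := hcon
    apply hnG
    set W := ∑ s ∈ Finset.Icc 1 (t - 1), (g s ω) ^ 2 / (σb s ω) ^ 2 with hWdef
    have hW0 : 0 ≤ W := by positivity
    have hWle : W ≤ T * L ^ 2 / α ^ 2 := by
      calc W ≤ ∑ s ∈ Finset.Icc 1 (t - 1), L ^ 2 / α ^ 2 := by
            apply Finset.sum_le_sum
            intro s hs
            have h3 := h1 s hs
            have h4 := hFrange f hf (z s ω)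
            have h5 := hFrange ftil hftil (z s ω)
            have h6 : g s ω ^ 2 ≤ L ^ 2 := by
              apply sq_le_sq'
              · linarith [h4.1, h5.2]
              · linarith [h4.2, h5.1]
            gcongr
        _ = ((t - 1 : ℕ) : ℝ) * (L ^ 2 / α ^ 2) := by simp
        _ ≤ T * (L ^ 2 / α ^ 2) := by gcongr
        _ = _ := by ring
    have hgrid : W + lam ≤ 4 * (T * L ^ 2 / α ^ 2) * (lam + υ ^ 2 / 4) := by
      have h3 : 1 ≤ T * L ^ 2 / α ^ 2 := by
        have h4 : 1 ≤ (L / α) ^ 2 := one_le_pow₀ hLα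
        have h5 : T * L ^ 2 / α ^ 2 = T * (L / α) ^ 2 := by ring
        rw [h5]
        nlinarith
      nlinarith
    obtain ⟨k, hk, hkW, hkQ⟩ := exists_geometric_grid (by positivity)
      (by positivity : 0 < lam + υ ^ 2 / 4) hgrid
    have hr := Real.sqrt_pos.2 (hQpos k)
    have hheq : ∀ s ∈ Finset.Icc 1 (t - 1),
        h k s ω = 2 * (υ / Real.sqrt (Q k)) * (g s ω / σb s ω ^ 2) := by
      intro s hs
      have hσ0 : 0 < σb s ω := hα0.trans_le (h1 s hs)
      obtain ⟨hs1, hs2⟩ := Finset.mem_Icc.1 hs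
      apply if_pos
      have h3 := abs_sub_le_sqrt_D2_mul F hlam (z s ω) (s - 1) (fun i => z (i + 1) ω)
        (fun i => σb (i + 1) ω) hf hftil
      have h4 := h2 s hs
      set D := Real.sqrt (D2 (↑F) lam (z s ω) (s - 1) (fun i => z (i + 1) ω)
        (fun i => σb (i + 1) ω))
      have hD0 : 0 ≤ D := Real.sqrt_nonneg _
      have h5 : 4 * (υ * D) ≤ σb s ω ^ 2 := by
        have h6 := Real.sq_sqrt (mul_nonneg hu0.le hD0)
        have h7 := pow_le_pow_left₀ (by positivity) h4 2
        linarith [mul_pow 2 (Real.sqrt (υ * D)) 2]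
      have h6 : (∑ i ∈ Finset.range (s - 1), (f (z (i + 1) ω) - ftil (z (i + 1) ω)) ^ 2 /
          σb (i + 1) ω ^ 2) ≤ W := by
        have h8 := Finset.sum_Ico_add' (fun i => g i ω ^ 2 / σb i ω ^ 2) 0 (s - 1) 1
        rw [Finset.range_eq_Ico]
        refine h8.le.trans (Finset.sum_le_sum_of_subset_of_nonneg ?_ fun i _ _ => by positivity)
        intro i hi
        simp only [Finset.mem_Ico, Finset.mem_Icc] at hi ⊢
        omega
      have h7 : |g s ω| ≤ D * Real.sqrt (Q k) := by
        refine h3.trans (mul_le_mul_of_nonneg_left (Real.sqrt_le_sqrt ?_) hD0)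
        exact (add_le_add_left h6 lam).trans hkW
      rw [abs_mul, abs_div, abs_of_pos (by positivity : 0 < 2 * (υ / Real.sqrt (Q k))),
        abs_of_pos (by positivity : 0 < σb s ω ^ 2)]
      calc 2 * (υ / Real.sqrt (Q k)) * (|g s ω| / σb s ω ^ 2)
          ≤ 2 * (υ / Real.sqrt (Q k)) * (D * Real.sqrt (Q k) / σb s ω ^ 2) := by gcongr
        _ = 2 * (υ * D) / σb s ω ^ 2 := by field_simp
        _ ≤ 1 / 2 := by
          rw [div_le_iff₀ (by positivity)]
          linarith
    have hSk := hSle k hk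
    have hSeq : S k ω = υ / Real.sqrt (Q k) * (∑ s ∈ Finset.Icc 1 (t - 1),
        2 * (η s ω / (σb s ω) ^ 2) * g s ω) - 4 * (υ / Real.sqrt (Q k)) ^ 2 * W := by
      simp only [hS, hWdef, Finset.mul_sum, ← Finset.sum_sub_distrib]
      apply Finset.sum_congr rfl
      intro s hs
      have hσ0 : 0 < σb s ω := hα0.trans_le (h1 s hs)
      rw [hheq s hs]
      field_simp
      ring
    rw [hSeq] at hSk
    have hkQ' : Q k ≤ lam + υ ^ 2 / 4 ∨ Q k ≤ 16 / 9 * (W + lam) := hkQ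
    have hfinal := le_of_chernoff_exponent hu0 hlam hW0 hkW hkQ' hSk
    have : 0 ≤ Real.sqrt 2 * υ := by positivity
    simp only [hG, Set.mem_ofPred_eq]
    linarith
  have hone : 1 ≤ μ G + ENNReal.ofReal (δ / (N : ℝ) ^ 2) := by
    calc (1 : ENNReal) = μ Set.univ := measure_univ.symm
      _ ≤ μ (G ∪ ⋃ k ∈ Finset.range K, {ω | υ ^ 2 < S k ω}) := by
          apply measure_mono_ae
          filter_upwards [hcover] with ω hω _ using hω
      _ ≤ μ G + μ (⋃ k ∈ Finset.range K, {ω | υ ^ 2 < S k ω}) := measure_union_le _ _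
      _ ≤ _ := by gcongr
  rw [ENNReal.ofReal_sub _ (by positivity), ENNReal.ofReal_one]
  exact tsub_le_iff_right.2 hone
end

section
/- (Weighted martingale concentration with small conditional variance; Lemma C.3 of the paper.) Let Z be a measurable space, L ≥ 1, and F a finite set of measurable functions Z → [0, L] with |F| = N. Let λ > 0, 0 < α ≤ 1, let t, T be positive integers with t − 1 ≤ T, let N_b ≥ 3 be an integer, and let δ ∈ (0, 1). Set ι := 3 √( log( N · N_b (2 log(4LT/α) + 2)(log(8L/α²) + 2) / δ ) ). Let (𝒢_s)_{s=0}^{t−1} be a filtration and suppose for each s = 1, …, t−1: z_s is a 𝒢_{s−1}-measurable Z-valued random variable; σ̄_s is a 𝒢_{s−1}-measurable random variable with σ̄_s ≥ α and σ̄_s ≥ 2 ι √( D_F(z_s; z_{[s−1]}, σ̄_{[s−1]}) ) almost surely; and ξ_s is a 𝒢_s-measurable random variable with E[ξ_s | 𝒢_{s−1}] = 0, |ξ_s| ≤ 2 almost surely, and E[ξ_s² | 𝒢_{s−1}] ≤ ι⁻² σ̄_s² almost surely. Then for any fixed f, f̃ ∈ F, with probability at least 1 − δ/(N³ N_b): Σ_{s=1}^{t−1}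 2 (ξ_s / σ̄_s²) ( f(z_s) − f̃(z_s) ) ≤ (4/3) √λ + (2/3) ι² / log N_b + √2 · ι / √(log N_b) + 256/9 + (1/4) Σ_{s=1}^{t−1} σ̄_s⁻² ( f(z_s) − f̃(z_s) )². -/
open MeasureTheory Finset

/-- One step of the exponential supermartingale: a bounded predictable multiple of a bounded
martingale difference, compensated by its conditional second moment. -/
theorem integral_mul_exp_compensated_le {Ω : Type*} {m m0 : MeasurableSpace Ω} {μ : Measure Ω}
    [IsProbabilityMeasure μ] (hm : m ≤ m0) {W a ξ : Ω → ℝ} {C : ℝ}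
    (hW : Measurable[m] W) (hW0 : ∀ ω, 0 ≤ W ω) (hWC : ∀ᵐ ω ∂μ, W ω ≤ C)
    (ha : Measurable[m] a) (hab : ∀ᵐ ω ∂μ, |a ω| ≤ 1 / 2)
    (hξ : Measurable ξ) (hξb : ∀ᵐ ω ∂μ, |ξ ω| ≤ 2) (hξ0 : μ[ξ | m] =ᵐ[μ] 0) :
    ∫ ω, W ω * Real.exp (a ω * ξ ω - a ω ^ 2 * (μ[fun ω' => ξ ω' ^ 2 | m]) ω) ∂μ
      ≤ ∫ ω, W ω ∂μ := by
  set v : Ω → ℝ := μ[fun ω' => ξ ω' ^ 2 | m]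
  have hvm : Measurable[m] v := stronglyMeasurable_condExp.measurable
  have hξi : Integrable ξ μ := Integrable.of_bound hξ.aestronglyMeasurable 2 hξb
  have hξ2b : ∀ᵐ ω ∂μ, ‖ξ ω ^ 2‖ ≤ 4 := by
    filter_upwards [hξb] with ω h
    rw [Real.norm_eq_abs, abs_of_nonneg (sq_nonneg _)]
    nlinarith [sq_abs (ξ ω), abs_nonneg (ξ ω)]
  have hξ2i : Integrable (fun ω => ξ ω ^ 2) μ :=
    Integrable.of_bound (hξ.pow_const 2).aestronglyMeasurable 4 hξ2b
  have hv0 : ∀ᵐ ω ∂μ, 0 ≤ v ω := condExp_nonneg (Filter.Eventually.of_forall fun _ => sq_nonneg _)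
  set U : Ω → ℝ := fun ω => W ω * Real.exp (-(a ω ^ 2 * v ω)) with hU
  have hUm : Measurable[m] U := by
    have h1 : Measurable[m] fun ω => a ω ^ 2 * v ω := (ha.pow_const 2).mul hvm
    exact hW.mul (Real.measurable_exp.comp h1.neg)
  have hUb : ∀ᵐ ω ∂μ, 0 ≤ U ω ∧ U ω ≤ C := by
    filter_upwards [hWC, hv0] with ω h1 h2
    have h3 : Real.exp (-(a ω ^ 2 * v ω)) ≤ 1 :=
      Real.exp_le_one_iff.2 (by have := mul_nonneg (sq_nonneg (a ω)) h2; linarith)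
    exact ⟨mul_nonneg (hW0 ω) (Real.exp_pos _).le,
      (mul_le_of_le_one_right (hW0 ω) h3).trans h1⟩
  have hUa : Measurable[m] fun ω => U ω * a ω := hUm.mul ha
  have hUa2 : Measurable[m] fun ω => U ω * a ω ^ 2 := hUm.mul (ha.pow_const 2)
  have hUab : ∀ᵐ ω ∂μ, ‖U ω * a ω‖ ≤ C := by
    filter_upwards [hUb, hab] with ω h1 h2
    rw [Real.norm_eq_abs, abs_mul, abs_of_nonneg h1.1]
    nlinarith [abs_nonneg (a ω)]
  have hUa2b : ∀ᵐ ω ∂μ, ‖U ω * a ω ^ 2‖ ≤ C := by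
    filter_upwards [hUb, hab] with ω h1 h2
    rw [Real.norm_eq_abs, abs_mul, abs_of_nonneg h1.1, abs_of_nonneg (sq_nonneg _)]
    have : a ω ^ 2 ≤ 1 := by nlinarith [abs_nonneg (a ω), sq_abs (a ω)]
    nlinarith [sq_nonneg (a ω)]
  have hUi : Integrable U μ := by
    refine Integrable.of_bound (hUm.mono hm le_rfl).aestronglyMeasurable C ?_
    filter_upwards [hUb] with ω h
    rw [Real.norm_eq_abs, abs_of_nonneg h.1]
    exact h.2
  have hi1 : Integrable (fun ω => U ω * a ω * ξ ω) μ :=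
    hξi.bdd_mul (hUa.mono hm le_rfl).aestronglyMeasurable hUab
  have hi2 : Integrable (fun ω => U ω * a ω ^ 2 * ξ ω ^ 2) μ :=
    hξ2i.bdd_mul (hUa2.mono hm le_rfl).aestronglyMeasurable hUa2b
  have hi3 : Integrable (fun ω => U ω * a ω ^ 2 * v ω) μ :=
    integrable_condExp.bdd_mul (hUa2.mono hm le_rfl).aestronglyMeasurable hUa2b
  have e1 : ∫ ω, U ω * a ω * ξ ω ∂μ = 0 := by
    rw [← integral_condExp hm]
    have h := condExp_mul_of_stronglyMeasurable_left (μ := μ) hUa.stronglyMeasurable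
      (g := ξ) hi1 hξi
    refine (integral_congr_ae (h.trans ?_)).trans (integral_zero Ω ℝ)
    filter_upwards [hξ0] with ω hω
    simp [hω]
  have e2 : ∫ ω, U ω * a ω ^ 2 * ξ ω ^ 2 ∂μ = ∫ ω, U ω * a ω ^ 2 * v ω ∂μ := by
    rw [← integral_condExp hm]
    exact integral_congr_ae (condExp_mul_of_stronglyMeasurable_left (μ := μ)
      hUa2.stronglyMeasurable (g := fun ω => ξ ω ^ 2) hi2 hξ2i)
  have hWi : Integrable W μ := by
    refine Integrable.of_bound (hW.mono hm le_rfl).aestronglyMeasurable C ?_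
    filter_upwards [hWC] with ω h
    rwa [Real.norm_eq_abs, abs_of_nonneg (hW0 ω)]
  calc ∫ ω, W ω * Real.exp (a ω * ξ ω - a ω ^ 2 * v ω) ∂μ
      ≤ ∫ ω, (U ω + U ω * a ω * ξ ω + U ω * a ω ^ 2 * ξ ω ^ 2) ∂μ := by
        refine integral_mono_of_nonneg
          (Filter.Eventually.of_forall fun ω => mul_nonneg (hW0 ω) (Real.exp_pos _).le)
          ((hUi.add hi1).add hi2) ?_
        filter_upwards [hab, hξb, hUb] with ω h1 h2 h3
        have h4 : |a ω * ξ ω| ≤ 1 := by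
          rw [abs_mul]; nlinarith [abs_nonneg (a ω), abs_nonneg (ξ ω)]
        have h5 := (abs_le.1 (Real.abs_exp_sub_one_sub_id_le h4)).2
        have h6 : W ω * Real.exp (a ω * ξ ω - a ω ^ 2 * v ω)
            = U ω * Real.exp (a ω * ξ ω) := by
          rw [hU, sub_eq_neg_add, Real.exp_add]; ring
        calc _ = U ω * Real.exp (a ω * ξ ω) := h6
          _ ≤ U ω * (1 + a ω * ξ ω + (a ω * ξ ω) ^ 2) :=
            mul_le_mul_of_nonneg_left (by linarith) h3.1
          _ = _ := by ring
    _ = ∫ ω, (U ω + U ω * a ω ^ 2 * v ω) ∂μ := by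
        have hi4 : Integrable (fun ω => U ω + U ω * a ω * ξ ω) μ := hUi.add hi1
        rw [integral_add hi4 hi2, integral_add hUi hi1, integral_add hUi hi3, e1, e2,
          add_zero]
    _ ≤ ∫ ω, W ω ∂μ := by
        refine integral_mono_ae (hUi.add hi3) hWi (Filter.Eventually.of_forall fun ω => ?_)
        have h1 := Real.add_one_le_exp (a ω ^ 2 * v ω)
        calc U ω + U ω * a ω ^ 2 * v ω
            = W ω * (Real.exp (-(a ω ^ 2 * v ω)) * (a ω ^ 2 * v ω + 1)) := by
              simp only [hU]; ring
          _ ≤ W ω * (Real.exp (-(a ω ^ 2 * v ω)) * Real.exp (a ω ^ 2 * v ω)) := by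
              have := hW0 ω; gcongr
          _ = W ω := by rw [← Real.exp_add]; simp

theorem exp_compensated_sum_integrable_and_integral_le_one {Ω : Type*} {m0 : MeasurableSpace Ω}
    {μ : Measure Ω} [IsProbabilityMeasure μ] {𝒢 : ℕ → MeasurableSpace Ω}
    (hmono : Monotone 𝒢) (hle : ∀ k, 𝒢 k ≤ m0) {a ξ : ℕ → Ω → ℝ} (n : ℕ)
    (ha : ∀ k < n, Measurable[𝒢 k] (a k)) (hab : ∀ k < n, ∀ᵐ ω ∂μ, |a k ω| ≤ 1 / 2)
    (hξ : ∀ k < n, Measurable[𝒢 (k + 1)] (ξ k)) (hξb : ∀ k < n, ∀ᵐ ω ∂μ, |ξ k ω| ≤ 2)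
    (hξ0 : ∀ k < n, μ[ξ k | 𝒢 k] =ᵐ[μ] 0) :
    Integrable (fun ω => Real.exp (∑ k ∈ range n,
        (a k ω * ξ k ω - a k ω ^ 2 * (μ[fun ω' => ξ k ω' ^ 2 | 𝒢 k]) ω))) μ ∧
      ∫ ω, Real.exp (∑ k ∈ range n,
        (a k ω * ξ k ω - a k ω ^ 2 * (μ[fun ω' => ξ k ω' ^ 2 | 𝒢 k]) ω)) ∂μ ≤ 1 := by
  set S : ℕ → Ω → ℝ := fun j ω => ∑ k ∈ range j,
    (a k ω * ξ k ω - a k ω ^ 2 * (μ[fun ω' => ξ k ω' ^ 2 | 𝒢 k]) ω) with hS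
  have hSm : ∀ j ≤ n, Measurable[𝒢 j] (S j) := by
    intro j hj
    refine Finset.measurable_sum _ fun k hk => ?_
    have hkj := Finset.mem_range.1 hk
    have h1 : Measurable[𝒢 j] (a k) := (ha k (by omega)).mono (hmono hkj.le) le_rfl
    have h2 : Measurable[𝒢 j] (ξ k) := (hξ k (by omega)).mono (hmono hkj) le_rfl
    have h3 : Measurable[𝒢 j] (μ[fun ω' => ξ k ω' ^ 2 | 𝒢 k]) :=
      stronglyMeasurable_condExp.measurable.mono (hmono hkj.le) le_rfl
    exact (h1.mul h2).sub ((h1.pow_const 2).mul h3)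
  have hSb : ∀ j ≤ n, ∀ᵐ ω ∂μ, S j ω ≤ j := by
    intro j hj
    have h : ∀ᵐ ω ∂μ, ∀ k ∈ range j,
        a k ω * ξ k ω - a k ω ^ 2 * (μ[fun ω' => ξ k ω' ^ 2 | 𝒢 k]) ω ≤ 1 := by
      refine (Filter.eventually_all_finset _).2 fun k hk => ?_
      have hkn : k < n := (Finset.mem_range.1 hk).trans_le hj
      have hv0 : ∀ᵐ ω ∂μ, 0 ≤ (μ[fun ω' => ξ k ω' ^ 2 | 𝒢 k]) ω :=
        condExp_nonneg (Filter.Eventually.of_forall fun _ => sq_nonneg _)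
      filter_upwards [hab k hkn, hξb k hkn, hv0] with ω h1 h2 h3
      have h4 : |a k ω * ξ k ω| ≤ 1 := by
        rw [abs_mul]; nlinarith [abs_nonneg (a k ω), abs_nonneg (ξ k ω)]
      have := mul_nonneg (sq_nonneg (a k ω)) h3
      linarith [le_abs_self (a k ω * ξ k ω)]
    filter_upwards [h] with ω hω
    exact (Finset.sum_le_sum hω).trans (by simp)
  have hint : ∀ j ≤ n, Integrable (fun ω => Real.exp (S j ω)) μ := by
    intro j hj
    refine Integrable.of_bound
      (Real.measurable_exp.comp ((hSm j hj).mono (hle j) le_rfl)).aestronglyMeasurable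
      (Real.exp j) ?_
    filter_upwards [hSb j hj] with ω h
    rw [Real.norm_eq_abs, Real.abs_exp]
    exact Real.exp_le_exp.2 h
  refine ⟨hint n le_rfl, ?_⟩
  suffices H : ∀ j ≤ n, ∫ ω, Real.exp (S j ω) ∂μ ≤ 1 from H n le_rfl
  intro j
  induction j with
  | zero => intro _; simp [hS]
  | succ j ih =>
    intro hj
    refine le_trans ?_ (ih (by omega))
    have hexp : ∀ ω, Real.exp (S (j + 1) ω) = Real.exp (S j ω) *
        Real.exp (a j ω * ξ j ω - a j ω ^ 2 * (μ[fun ω' => ξ j ω' ^ 2 | 𝒢 j]) ω) := by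
      intro ω
      simp only [hS, Finset.sum_range_succ, Real.exp_add]
    simp only [hexp]
    refine integral_mul_exp_compensated_le (hle j) (C := Real.exp j)
      (Real.measurable_exp.comp (hSm j (by omega))) (fun ω => (Real.exp_pos _).le) ?_
      (ha j hj) (hab j hj) ((hξ j hj).mono (hle _) le_rfl) (hξb j hj) (hξ0 j hj)
    filter_upwards [hSb j (by omega)] with ω h
    exact Real.exp_le_exp.2 h

theorem measureReal_compensated_sum_ge_le {Ω : Type*} {m0 : MeasurableSpace Ω}
    {μ : Measure Ω} [IsProbabilityMeasure μ] {𝒢 : ℕ → MeasurableSpace Ω}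
    (hmono : Monotone 𝒢) (hle : ∀ k, 𝒢 k ≤ m0) {a ξ : ℕ → Ω → ℝ} (n : ℕ)
    (ha : ∀ k < n, Measurable[𝒢 k] (a k)) (hab : ∀ k < n, ∀ᵐ ω ∂μ, |a k ω| ≤ 1 / 2)
    (hξ : ∀ k < n, Measurable[𝒢 (k + 1)] (ξ k)) (hξb : ∀ k < n, ∀ᵐ ω ∂μ, |ξ k ω| ≤ 2)
    (hξ0 : ∀ k < n, μ[ξ k | 𝒢 k] =ᵐ[μ] 0) (ε : ℝ) :
    μ.real {ω | ε ≤ ∑ k ∈ range n,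
        (a k ω * ξ k ω - a k ω ^ 2 * (μ[fun ω' => ξ k ω' ^ 2 | 𝒢 k]) ω)} ≤ Real.exp (-ε) := by
  obtain ⟨h1, h2⟩ :=
    exp_compensated_sum_integrable_and_integral_le_one hmono hle n ha hab hξ hξb hξ0
  have h3 := mul_meas_ge_le_integral_of_nonneg
    (Filter.Eventually.of_forall fun ω => (Real.exp_pos _).le) h1 (Real.exp ε)
  simp only [Real.exp_le_exp] at h3
  rw [Real.exp_neg, ← one_div, le_div_iff₀' (Real.exp_pos _)]
  exact h3.trans h2

theorem sq_sub_le_D2_mul {Z : Type*} (F : Finset (Z → ℝ)) {lam : ℝ} (hlam : 0 < lam)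
    {f g : Z → ℝ} (hf : f ∈ F) (hg : g ∈ F) (z : Z) (n : ℕ) (zs : ℕ → Z) (w : ℕ → ℝ) :
    (f z - g z) ^ 2 ≤ D2 (↑F) lam z n zs w *
      ((∑ s ∈ range n, (f (zs s) - g (zs s)) ^ 2 / w s ^ 2) + lam) := by
  have hpos : 0 < (∑ s ∈ range n, (f (zs s) - g (zs s)) ^ 2 / w s ^ 2) + lam :=
    add_pos_of_nonneg_of_pos (Finset.sum_nonneg fun _ _ => by positivity) hlam
  rw [← div_le_iff₀ hpos]
  refine le_csSup ?_ ⟨f, hf, g, hg, rfl⟩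
  refine ((F ×ˢ F).finite_toSet.image fun p : (Z → ℝ) × (Z → ℝ) => (p.1 z - p.2 z) ^ 2 /
    ((∑ s ∈ range n, (p.1 (zs s) - p.2 (zs s)) ^ 2 / w s ^ 2) + lam)).subset ?_ |>.bddAbove
  rintro r ⟨f₁, h₁, f₂, h₂, rfl⟩
  exact ⟨(f₁, f₂), by simpa using ⟨h₁, h₂⟩, rfl⟩

theorem mul_abs_le_of_sq_le_of_sqrt_sqrt_le {g D V ι σ : ℝ} (hι : 0 ≤ ι) (hg : g ^ 2 ≤ D * V)
    (hV : 0 < V) (hσ : 2 * ι * Real.sqrt (Real.sqrt D) ≤ σ) :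
    4 * ι ^ 2 * |g| ≤ σ ^ 2 * Real.sqrt V := by
  have h1 : |g| ≤ Real.sqrt D * Real.sqrt V := by
    rw [← Real.sqrt_mul' D hV.le]
    exact Real.abs_le_sqrt hg
  have h2 : 4 * ι ^ 2 * Real.sqrt D ≤ σ ^ 2 := by
    have h3 : (2 * ι * Real.sqrt (Real.sqrt D)) ^ 2 ≤ σ ^ 2 :=
      pow_le_pow_left₀ (by positivity) hσ 2
    rw [mul_pow, Real.sq_sqrt (Real.sqrt_nonneg D)] at h3
    linarith
  calc 4 * ι ^ 2 * |g| ≤ 4 * ι ^ 2 * (Real.sqrt D * Real.sqrt V) := by gcongr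
    _ = 4 * ι ^ 2 * Real.sqrt D * Real.sqrt V := by ring
    _ ≤ σ ^ 2 * Real.sqrt V := by gcongr

theorem exists_le_two_pow_and_le_two_mul_log {x : ℝ} (hx : 1 ≤ x) :
    ∃ k : ℕ, x ≤ 2 ^ k ∧ (k : ℝ) + 1 ≤ 2 * Real.log x + 2 := by
  have hl2 : 1 / 2 ≤ Real.log 2 := by linarith [Real.log_two_gt_d9]
  have hlx : 0 ≤ Real.log x := Real.log_nonneg hx
  refine ⟨⌈Real.log x / Real.log 2⌉₊, ?_, ?_⟩
  · have h := Nat.le_ceil (Real.log x / Real.log 2)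
    rw [div_le_iff₀ (by linarith)] at h
    rw [← Real.log_le_log_iff (by linarith) (by positivity), Real.log_pow]
    exact h
  · have h := Nat.ceil_lt_add_one (div_nonneg hlx (by linarith : 0 ≤ Real.log 2))
    have h2 : Real.log x / Real.log 2 ≤ 2 * Real.log x := by
      rw [div_le_iff₀ (by linarith)]
      nlinarith
    linarith

theorem mul_exp_neg_three_log_le {k N M A B δ : ℝ} (hN : 1 ≤ N) (hM : 1 ≤ M) (hA : 1 ≤ A)
    (hB : 1 ≤ B) (hδ0 : 0 < δ) (hδ1 : δ ≤ 1) (hk : k ≤ A) :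
    k * Real.exp (-(3 * Real.log (N * M * A * B / δ))) ≤ δ / (N ^ 3 * M) := by
  have hQ : 0 < N * M * A * B / δ := by positivity
  have h1 : Real.exp (-(3 * Real.log (N * M * A * B / δ))) = ((N * M * A * B / δ) ^ 3)⁻¹ := by
    rw [Real.exp_neg, mul_comm, Real.exp_mul, Real.exp_log hQ]
    norm_cast
  rw [h1]
  have h2 : 1 ≤ M ^ 2 * A ^ 2 * B ^ 3 / δ ^ 2 := by
    rw [one_le_div (by positivity)]
    calc δ ^ 2 ≤ 1 := pow_le_one₀ hδ0.le hδ1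
      _ ≤ M ^ 2 * A ^ 2 * B ^ 3 :=
        one_le_mul_of_one_le_of_one_le (one_le_mul_of_one_le_of_one_le (one_le_pow₀ hM)
          (one_le_pow₀ hA)) (one_le_pow₀ hB)
  calc k * ((N * M * A * B / δ) ^ 3)⁻¹ ≤ A * ((N * M * A * B / δ) ^ 3)⁻¹ := by gcongr
    _ = δ / (N ^ 3 * M) * (M ^ 2 * A ^ 2 * B ^ 3 / δ ^ 2)⁻¹ := by field_simp
    _ ≤ δ / (N ^ 3 * M) := mul_le_of_le_one_right (by positivity) (inv_le_one_of_one_le₀ h2)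

theorem exists_le_four_pow_and_two_pow_le {V : ℝ} {K : ℕ} (hV : V ≤ 4 ^ K) :
    ∃ j ≤ K, V ≤ 4 ^ j ∧ (2 : ℝ) ^ j ≤ 2 * Real.sqrt V + 1 := by
  classical
  have hex : ∃ j : ℕ, V ≤ 4 ^ j := ⟨K, hV⟩
  refine ⟨Nat.find hex, Nat.find_min' hex hV, Nat.find_spec hex, ?_⟩
  rcases h : Nat.find hex with _ | i
  · simp
  · have h1 : (4 : ℝ) ^ i < V := not_le.1 (Nat.find_min hex (by omega : i < Nat.find hex))
    have h2 : (2 : ℝ) ^ i ≤ Real.sqrt V := by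
      refine Real.le_sqrt_of_sq_le ?_
      rw [← pow_mul, mul_comm, pow_mul]
      norm_num
      exact h1.le
    rw [pow_succ]
    linarith

theorem le_of_tilted_le {S V lam ι m : ℝ} (hι : 0 < ι) (hV : 0 ≤ V) (hm : 0 < m)
    (hVm : V ≤ m ^ 2) (hmV : m ≤ 2 * Real.sqrt V + 1)
    (h : ι ^ 2 / (Real.sqrt lam + m) * S ≤
      ι ^ 2 / 3 + (ι ^ 2 / (Real.sqrt lam + m)) ^ 2 * (4 * V / ι ^ 2)) :
    S ≤ Real.sqrt lam / 3 + 199 / 9 + V / 4 := by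
  have hl := Real.sqrt_nonneg lam
  set p := Real.sqrt lam + m with hp
  have hp0 : 0 < p := by positivity
  have h1 : S ≤ p / 3 + 4 * V / p := by
    have hθ : 0 < ι ^ 2 / p := by positivity
    refine le_of_mul_le_mul_left (h.trans_eq ?_) hθ
    field_simp
  have h2 : V / p ≤ Real.sqrt V := by
    rw [div_le_iff₀ hp0]
    have h3 : Real.sqrt V ≤ p := by
      have : Real.sqrt V ≤ m := Real.sqrt_le_iff.2 ⟨hm.le, hVm⟩
      linarith
    nlinarith [Real.mul_self_sqrt hV, Real.sqrt_nonneg V]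
  have h4 : 4 * V / p = 4 * (V / p) := by ring
  nlinarith [sq_nonneg (Real.sqrt V / 2 - 14 / 3), Real.sq_sqrt hV]

theorem sum_Icc_one_eq_sum_range {M : Type*} [AddCommMonoid M] (h : ℕ → M) (n : ℕ) :
    ∑ s ∈ Icc 1 n, h s = ∑ k ∈ range n, h (k + 1) := by
  induction n with
  | zero => simp
  | succ n ih => rw [Finset.sum_Icc_succ_top (by omega), Finset.sum_range_succ, ih]

/-- Peeling over dyadic levels of the weighted quadratic sum: on each level the exponential
supermartingale bound is applied to the increments with that level's tilt. -/
theorem one_sub_measure_le_of_peeling {Ω : Type*} {m0 : MeasurableSpace Ω} {μ : Measure Ω}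
    [IsProbabilityMeasure μ] {Z : Type*} [MeasurableSpace Z] {𝒢 : ℕ → MeasurableSpace Ω}
    (F : Finset (Z → ℝ)) {lam α L ι : ℝ} (hlam : 0 < lam) (hα : 0 < α) {n K : ℕ}
    {f ftil : Z → ℝ} {z : ℕ → Ω → Z} {σ ξ : ℕ → Ω → ℝ} (hf : f ∈ F) (hftil : ftil ∈ F)
    (hfm : Measurable f) (hftilm : Measurable ftil) (hfb : ∀ x, |f x - ftil x| ≤ L)
    (hK : n * (L ^ 2 / α ^ 2) ≤ 4 ^ K) (hι : 0 < ι) (hmono : Monotone 𝒢)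
    (hle : ∀ k, 𝒢 k ≤ m0)
    (hz : ∀ k < n, Measurable[𝒢 k] (z k)) (hσ : ∀ k < n, Measurable[𝒢 k] (σ k))
    (hσα : ∀ k < n, ∀ᵐ ω ∂μ, α ≤ σ k ω)
    (hσD : ∀ k < n, ∀ᵐ ω ∂μ, 2 * ι * Real.sqrt (Real.sqrt
      (D2 (↑F) lam (z k ω) k (fun i => z i ω) (fun i => σ i ω))) ≤ σ k ω)
    (hξ : ∀ k < n, Measurable[𝒢 (k + 1)] (ξ k)) (hξ0 : ∀ k < n, μ[ξ k | 𝒢 k] =ᵐ[μ] 0)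
    (hξb : ∀ k < n, ∀ᵐ ω ∂μ, |ξ k ω| ≤ 2)
    (hξv : ∀ k < n, ∀ᵐ ω ∂μ,
      (μ[fun ω' => ξ k ω' ^ 2 | 𝒢 k]) ω ≤ (ι ^ 2)⁻¹ * σ k ω ^ 2) :
    ENNReal.ofReal (1 - (K + 1) * Real.exp (-(ι ^ 2 / 3))) ≤
      μ {ω | ∑ k ∈ range n, 2 * (ξ k ω / σ k ω ^ 2) * (f (z k ω) - ftil (z k ω)) ≤
        Real.sqrt lam / 3 + 199 / 9 +
          (∑ k ∈ range n, (f (z k ω) - ftil (z k ω)) ^ 2 / σ k ω ^ 2) / 4} := by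
  classical
  set V : ℕ → Ω → ℝ := fun j ω =>
    ∑ k ∈ range j, (f (z k ω) - ftil (z k ω)) ^ 2 / σ k ω ^ 2
  set θ : ℕ → ℝ := fun j => ι ^ 2 / (Real.sqrt lam + 2 ^ j) with hθ
  have hθ0 : ∀ j, 0 < θ j := fun j => by positivity
  set a : ℕ → ℕ → Ω → ℝ := fun j k ω =>
    if V k ω ≤ 4 ^ j then θ j * (2 * ((f (z k ω) - ftil (z k ω)) / σ k ω ^ 2)) else 0 with ha
  have hgm : ∀ k < n, Measurable[𝒢 k] fun ω => f (z k ω) - ftil (z k ω) := fun k hk =>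
    (hfm.comp (hz k hk)).sub (hftilm.comp (hz k hk))
  have hVm : ∀ k < n, Measurable[𝒢 k] (V k) := by
    intro k hk
    refine Finset.measurable_sum _ fun i hi => ?_
    have hik := Finset.mem_range.1 hi
    exact (((hgm i (by omega)).pow_const 2).div ((hσ i (by omega)).pow_const 2)).mono
      (hmono hik.le) le_rfl
  have hV0 : ∀ k ω, 0 ≤ V k ω := fun k ω => Finset.sum_nonneg fun _ _ => by positivity
  have ham : ∀ j, ∀ k < n, Measurable[𝒢 k] (a j k) := by
    intro j k hk
    refine Measurable.ite (measurableSet_le (hVm k hk) measurable_const) ?_ measurable_const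
    exact (((hgm k hk).div ((hσ k hk).pow_const 2)).const_mul 2).const_mul (θ j)
  have hab : ∀ j, ∀ k < n, ∀ᵐ ω ∂μ, |a j k ω| ≤ 1 / 2 := by
    intro j k hk
    filter_upwards [hσα k hk, hσD k hk] with ω h1 h2
    simp only [ha]
    split_ifs with hVj
    · have hσ0 : 0 < σ k ω := hα.trans_le h1
      have h3 := mul_abs_le_of_sq_le_of_sqrt_sqrt_le hι.le
        (sq_sub_le_D2_mul F hlam hf hftil (z k ω) k (fun i => z i ω) (fun i => σ i ω))
        (add_pos_of_nonneg_of_pos (hV0 k ω) hlam) h2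
      have h4 : Real.sqrt (V k ω + lam) ≤ Real.sqrt lam + 2 ^ j := by
        refine Real.sqrt_le_iff.2 ⟨by positivity, ?_⟩
        have h5 : ((2 : ℝ) ^ j) ^ 2 = 4 ^ j := by rw [← pow_mul, mul_comm, pow_mul]; norm_num
        have h6 : 0 ≤ Real.sqrt lam * 2 ^ j := by positivity
        nlinarith [Real.sq_sqrt hlam.le]
      rw [abs_mul, abs_of_pos (hθ0 j), abs_mul, abs_div, abs_of_pos (pow_pos hσ0 2), abs_two,
        show θ j * (2 * (|f (z k ω) - ftil (z k ω)| / σ k ω ^ 2)) =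
          2 * ι ^ 2 * |f (z k ω) - ftil (z k ω)| / ((Real.sqrt lam + 2 ^ j) * σ k ω ^ 2) by
            simp only [hθ]; field_simp,
        div_le_iff₀ (by positivity)]
      have h7 := mul_le_mul_of_nonneg_left h4 (sq_nonneg (σ k ω))
      have h8 := h3.trans h7
      linarith
    · norm_num
  set bad : ℕ → Set Ω := fun j => {ω | ι ^ 2 / 3 ≤ ∑ k ∈ range n,
    (a j k ω * ξ k ω - a j k ω ^ 2 * (μ[fun ω' => ξ k ω' ^ 2 | 𝒢 k]) ω)} with hbad
  have hbadm : μ.real (⋃ j ∈ range (K + 1), bad j) ≤ (K + 1) * Real.exp (-(ι ^ 2 / 3)) := by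
    refine (measureReal_biUnion_finset_le _ _).trans ((Finset.sum_le_sum fun j _ =>
      measureReal_compensated_sum_ge_le hmono hle n (ham j) (hab j) hξ hξb hξ0
        (ι ^ 2 / 3)).trans_eq ?_)
    simp
  have hae : ∀ᵐ ω ∂μ, ∀ k ∈ range n, α ≤ σ k ω ∧
      (μ[fun ω' => ξ k ω' ^ 2 | 𝒢 k]) ω ≤ (ι ^ 2)⁻¹ * σ k ω ^ 2 :=
    (Filter.eventually_all_finset _).2 fun k hk =>
      (hσα k (Finset.mem_range.1 hk)).and (hξv k (Finset.mem_range.1 hk))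
  set good : Set Ω := {ω | ∑ k ∈ range n,
    2 * (ξ k ω / σ k ω ^ 2) * (f (z k ω) - ftil (z k ω)) ≤
      Real.sqrt lam / 3 + 199 / 9 + V n ω / 4}
  have hsub : ∀ᵐ ω ∂μ, ω ∈ goodᶜ → ω ∈ ⋃ j ∈ range (K + 1), bad j := by
    filter_upwards [hae] with ω hω
    contrapose!
    intro hnb
    rw [Set.notMem_compl_iff]
    have hVK : V n ω ≤ 4 ^ K := by
      refine le_trans ?_ hK
      have : ∀ k ∈ range n, (f (z k ω) - ftil (z k ω)) ^ 2 / σ k ω ^ 2 ≤ L ^ 2 / α ^ 2 := by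
        intro k hk
        have h1 := (hω k hk).1
        rw [← sq_abs (f (z k ω) - ftil (z k ω))]
        have h2 := hfb (z k ω)
        gcongr
      simpa using Finset.sum_le_card_nsmul _ _ _ this
    obtain ⟨j, hjK, hVj, hj⟩ := exists_le_four_pow_and_two_pow_le hVK
    have hnj : ω ∉ bad j := fun h =>
      hnb (Set.mem_biUnion (Finset.mem_coe.2 (Finset.mem_range.2 (by omega))) h)
    simp only [hbad, Set.mem_ofPred_eq, not_le] at hnj
    refine le_of_tilted_le (m := 2 ^ j) hι (hV0 n ω) (by positivity) ?_ hj ?_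
    · rw [← pow_mul, mul_comm, pow_mul]
      norm_num
      exact hVj
    · change θ j * _ ≤ ι ^ 2 / 3 + θ j ^ 2 * (4 * V n ω / ι ^ 2)
      have hterm : ∀ k ∈ range n,
          θ j * (2 * (ξ k ω / σ k ω ^ 2) * (f (z k ω) - ftil (z k ω))) -
            θ j ^ 2 * (4 / ι ^ 2) * ((f (z k ω) - ftil (z k ω)) ^ 2 / σ k ω ^ 2) ≤
          a j k ω * ξ k ω - a j k ω ^ 2 * (μ[fun ω' => ξ k ω' ^ 2 | 𝒢 k]) ω := by
        intro k hk
        obtain ⟨h1, h2⟩ := hω k hk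
        have hσ0 : 0 < σ k ω := hα.trans_le h1
        have hVk : V k ω ≤ 4 ^ j := by
          refine le_trans (Finset.sum_le_sum_of_subset_of_nonneg ?_ fun _ _ _ => ?_) hVj
          · exact Finset.range_subset_range.2 (Finset.mem_range.1 hk).le
          · positivity
        have hak : a j k ω = θ j * (2 * ((f (z k ω) - ftil (z k ω)) / σ k ω ^ 2)) :=
          if_pos hVk
        have h3 := mul_le_mul_of_nonneg_left h2 (sq_nonneg (a j k ω))
        have h4 : a j k ω ^ 2 * ((ι ^ 2)⁻¹ * σ k ω ^ 2) =
            θ j ^ 2 * (4 / ι ^ 2) * ((f (z k ω) - ftil (z k ω)) ^ 2 / σ k ω ^ 2) := by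
          rw [hak]; field_simp; ring
        have h5 : a j k ω * ξ k ω =
            θ j * (2 * (ξ k ω / σ k ω ^ 2) * (f (z k ω) - ftil (z k ω))) := by
          rw [hak]; ring
        linarith
      have hsum := (Finset.sum_le_sum hterm).trans hnj.le
      rw [Finset.sum_sub_distrib, ← Finset.mul_sum, ← Finset.mul_sum] at hsum
      have h6 : θ j ^ 2 * (4 * V n ω / ι ^ 2) = θ j ^ 2 * (4 / ι ^ 2) * V n ω := by ring
      rw [h6]
      linarith
  have hgoodc : μ goodᶜ ≤ ENNReal.ofReal ((K + 1) * Real.exp (-(ι ^ 2 / 3))) := by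
    have h : μ goodᶜ ≤ μ (⋃ j ∈ range (K + 1), bad j) := measure_mono_ae hsub
    refine h.trans ?_
    rw [← ofReal_measureReal (measure_ne_top μ _)]
    exact ENNReal.ofReal_le_ofReal hbadm
  rw [ENNReal.ofReal_sub _ (by positivity), ENNReal.ofReal_one, tsub_le_iff_right,
    ← measure_univ (μ := μ), ← Set.union_compl_self good]
  exact (measure_union_le _ _).trans (by gcongr)

/-- **Weighted martingale concentration with small conditional variance (Lemma C.3).**
With predictable points `z_s`, predictable weights
`σ̄_s ≥ max(α, 2ι√(D_F(z_s; z_{[s-1]}, σ̄_{[s-1]})))` and martingale differences `ξ_s`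
with `|ξ_s| ≤ 2` and `E[ξ_s²|𝒢_{s-1}] ≤ ι⁻² σ̄_s²`, for any fixed `f, f̃ ∈ F`, with
probability at least `1 - δ/(N³ N_b)`,
`∑_s 2 (ξ_s/σ̄_s²)(f(z_s) - f̃(z_s)) ≤ (4/3)√λ + (2/3) ι²/log N_b + √2 ι/√(log N_b)
  + 256/9 + (1/4) ∑_s σ̄_s⁻² (f(z_s) - f̃(z_s))²`. -/
theorem stmt6 {Ω : Type*} {m0 : MeasurableSpace Ω} (μ : Measure Ω) [IsProbabilityMeasure μ]
    {Z : Type*} [MeasurableSpace Z]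
    (L : ℝ) (hL : 1 ≤ L)
    (F : Finset (Z → ℝ)) (hFmeas : ∀ f ∈ F, Measurable f)
    (hFrange : ∀ f ∈ F, ∀ x, f x ∈ Set.Icc 0 L)
    (N : ℕ) (hN : F.card = N)
    (lam α : ℝ) (hlam : 0 < lam) (hα0 : 0 < α) (hα1 : α ≤ 1)
    (t T : ℕ) (ht : 0 < t) (hT : 0 < T) (htT : t - 1 ≤ T)
    (Nb : ℕ) (hNb : 3 ≤ Nb)
    (δ : ℝ) (hδ : δ ∈ Set.Ioo (0 : ℝ) 1)
    (ι : ℝ)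
    (hι : ι = 3 * Real.sqrt (Real.log ((N : ℝ) * (Nb : ℝ) *
      (2 * Real.log (4 * L * (T : ℝ) / α) + 2) * (Real.log (8 * L / α ^ 2) + 2) / δ)))
    (𝒢 : ℕ → MeasurableSpace Ω)
    (hmono : ∀ s, 𝒢 s ≤ 𝒢 (s + 1)) (hle : ∀ s, 𝒢 s ≤ m0)
    (z : ℕ → Ω → Z) (σb ξ : ℕ → Ω → ℝ)
    (hzmeas : ∀ s ∈ Finset.Icc 1 (t - 1), Measurable[𝒢 (s - 1)] (z s))
    (hσmeas : ∀ s ∈ Finset.Icc 1 (t - 1), Measurable[𝒢 (s - 1)] (σb s))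
    (hσα : ∀ s ∈ Finset.Icc 1 (t - 1), ∀ᵐ ω ∂μ, α ≤ σb s ω)
    (hσD : ∀ s ∈ Finset.Icc 1 (t - 1), ∀ᵐ ω ∂μ,
      2 * ι * Real.sqrt (Real.sqrt
          (D2 (↑F) lam (z s ω) (s - 1) (fun i => z (i + 1) ω) (fun i => σb (i + 1) ω)))
        ≤ σb s ω)
    (hξmeas : ∀ s ∈ Finset.Icc 1 (t - 1), Measurable[𝒢 s] (ξ s))
    (hξmean : ∀ s ∈ Finset.Icc 1 (t - 1), μ[ξ s | 𝒢 (s - 1)] =ᵐ[μ] 0)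
    (hξbdd : ∀ s ∈ Finset.Icc 1 (t - 1), ∀ᵐ ω ∂μ, |ξ s ω| ≤ 2)
    (hξvar : ∀ s ∈ Finset.Icc 1 (t - 1), ∀ᵐ ω ∂μ,
      (μ[fun ω' => (ξ s ω') ^ 2 | 𝒢 (s - 1)]) ω ≤ (ι ^ 2)⁻¹ * (σb s ω) ^ 2)
    (f ftil : Z → ℝ) (hf : f ∈ F) (hftil : ftil ∈ F) :
    ENNReal.ofReal (1 - δ / ((N : ℝ) ^ 3 * (Nb : ℝ))) ≤
      μ {ω | ∑ s ∈ Finset.Icc 1 (t - 1),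
            2 * (ξ s ω / (σb s ω) ^ 2) * (f (z s ω) - ftil (z s ω))
          ≤ (4 / 3) * Real.sqrt lam + (2 / 3) * ι ^ 2 / Real.log (Nb : ℝ)
            + Real.sqrt 2 * ι / Real.sqrt (Real.log (Nb : ℝ)) + 256 / 9
            + (1 / 4) * ∑ s ∈ Finset.Icc 1 (t - 1),
                (f (z s ω) - ftil (z s ω)) ^ 2 / (σb s ω) ^ 2} := by
  have hNb1 : (1 : ℝ) ≤ Nb := by exact_mod_cast (by omega : 1 ≤ Nb)
  have hN1 : (1 : ℝ) ≤ N := by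
    have : 0 < N := hN ▸ Finset.card_pos.2 ⟨f, hf⟩
    exact_mod_cast this
  have hT1 : (1 : ℝ) ≤ T := by exact_mod_cast hT
  obtain ⟨hδ0, hδ1⟩ := hδ
  have hx1 : 1 ≤ L * T / α := by
    rw [one_le_div hα0]
    nlinarith
  obtain ⟨K, hK, hKlog⟩ := exists_le_two_pow_and_le_two_mul_log hx1
  set A : ℝ := 2 * Real.log (4 * L * (T : ℝ) / α) + 2
  set B : ℝ := Real.log (8 * L / α ^ 2) + 2
  have hlog : Real.log (L * T / α) ≤ Real.log (4 * L * (T : ℝ) / α) := by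
    refine Real.log_le_log (by linarith) ?_
    rw [show 4 * L * (T : ℝ) / α = 4 * (L * T / α) by ring]
    linarith
  have hKA : (K : ℝ) + 1 ≤ A := by linarith
  have hA2 : 2 ≤ A := by linarith [Real.log_nonneg hx1]
  have hB2 : 2 ≤ B := by
    have : 1 ≤ 8 * L / α ^ 2 := by
      rw [one_le_div (by positivity)]
      nlinarith
    linarith [Real.log_nonneg this]
  have hQ1 : 1 < (N : ℝ) * Nb * A * B / δ := by
    rw [one_lt_div hδ0]
    have h1 : 1 ≤ (N : ℝ) * Nb * A * B :=
      one_le_mul_of_one_le_of_one_le (one_le_mul_of_one_le_of_one_le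
        (one_le_mul_of_one_le_of_one_le hN1 hNb1) (by linarith)) (by linarith)
    linarith
  have hlogQ : 0 < Real.log ((N : ℝ) * Nb * A * B / δ) := Real.log_pos hQ1
  have hι0 : 0 < ι := by
    rw [hι]
    have := Real.sqrt_pos.2 hlogQ
    positivity
  have hι2 : ι ^ 2 / 3 = 3 * Real.log ((N : ℝ) * Nb * A * B / δ) := by
    rw [hι, mul_pow, Real.sq_sqrt hlogQ.le]
    ring
  have hgood := one_sub_measure_le_of_peeling (μ := μ) (𝒢 := 𝒢) F hlam hα0 (L := L)
    (n := t - 1) (K := K) (ι := ι) (f := f) (ftil := ftil)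
    (z := fun k => z (k + 1)) (σ := fun k => σb (k + 1)) (ξ := fun k => ξ (k + 1))
    hf hftil (hFmeas f hf) (hFmeas ftil hftil)
    (fun x => abs_le.2 ⟨by linarith [(hFrange f hf x).1, (hFrange ftil hftil x).2],
      by linarith [(hFrange f hf x).2, (hFrange ftil hftil x).1]⟩)
    ?_ hι0 (monotone_nat_of_le_succ hmono) hle
    (fun k hk => hzmeas (k + 1) (Finset.mem_Icc.2 (by omega)))
    (fun k hk => hσmeas (k + 1) (Finset.mem_Icc.2 (by omega)))
    (fun k hk => hσα (k + 1) (Finset.mem_Icc.2 (by omega)))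
    (fun k hk => hσD (k + 1) (Finset.mem_Icc.2 (by omega)))
    (fun k hk => hξmeas (k + 1) (Finset.mem_Icc.2 (by omega)))
    (fun k hk => hξmean (k + 1) (Finset.mem_Icc.2 (by omega)))
    (fun k hk => hξbdd (k + 1) (Finset.mem_Icc.2 (by omega)))
    (fun k hk => hξvar (k + 1) (Finset.mem_Icc.2 (by omega)))
  · have hfail : (K + 1 : ℝ) * Real.exp (-(ι ^ 2 / 3)) ≤ δ / ((N : ℝ) ^ 3 * Nb) := by
      rw [hι2]
      exact mul_exp_neg_three_log_le hN1 hNb1 (by linarith) (by linarith) hδ0 hδ1.le hKA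
    refine (ENNReal.ofReal_le_ofReal (sub_le_sub_left hfail 1)).trans
      (hgood.trans (measure_mono fun ω hω => ?_))
    simp only [Set.mem_ofPred_eq, sum_Icc_one_eq_sum_range] at hω ⊢
    have hlNb : 0 ≤ Real.log (Nb : ℝ) := Real.log_nonneg hNb1
    have h1 : 0 ≤ (2 / 3) * ι ^ 2 / Real.log (Nb : ℝ) := by positivity
    have h2 : 0 ≤ Real.sqrt 2 * ι / Real.sqrt (Real.log (Nb : ℝ)) := by positivity
    have h3 := Real.sqrt_nonneg lam
    linarith
  · have hnT : ((t - 1 : ℕ) : ℝ) ≤ T := by exact_mod_cast htT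
    calc ((t - 1 : ℕ) : ℝ) * (L ^ 2 / α ^ 2) ≤ T * T * (L ^ 2 / α ^ 2) := by
          gcongr
          nlinarith
      _ = (L * T / α) ^ 2 := by ring
      _ ≤ (2 ^ K) ^ 2 := by gcongr
      _ = 4 ^ K := by rw [← pow_mul, mul_comm, pow_mul]; norm_num
end

section
/- (Unweighted martingale concentration against a predictable function; helper lemma for the overly optimistic confidence interval.) Let L ≥ 1 and K ≥ 1 be reals, let t, T be positive integers with t − 1 ≤ T, and let δ ∈ (0, 1). Set ι := √( 2 log( K (2 log(18LT) + 2)(log(18L) + 2) / δ ) ). Let (𝒢_s)_{s=0}^{t−1} be a filtration, and for each s = 1, …, t−1 let Y_s be a 𝒢_s-measurable random variable with Y_s ∈ [0, 3] almost surely, let g_s := E[Y_s | 𝒢_{s−1}], and let u_s be a 𝒢_{s−1}-measurable random variable with u_s ∈ [0, L] almost surely. Then with probability at least 1 − δ/K²: Σ_{s=1}^{t−1} 2 (Y_s − g_s)(u_s − g_s) ≤ (24L + 21) ι² + (1/2) Σ_{s=1}^{t−1} (u_s − g_s)². -/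
open MeasureTheory Finset

/-- A bounded `m`-measurable weight is orthogonal to `Y - μ[Y | m]`. -/
lemma integral_mul_sub_condExp_eq_zero {Ω : Type*} {m m0 : MeasurableSpace Ω} {μ : Measure Ω}
    [IsFiniteMeasure μ] (hm : m ≤ m0) {h Y : Ω → ℝ} (hh : Measurable[m] h) {C : ℝ}
    (hC : ∀ᵐ ω ∂μ, |h ω| ≤ C) (hY : Integrable Y μ) :
    ∫ ω, h ω * (Y ω - (μ[Y | m]) ω) ∂μ = 0 := by
  have hh0 : AEStronglyMeasurable h μ := (hh.mono hm le_rfl).aestronglyMeasurable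
  have hi : Integrable (h * Y) μ := hY.bdd_mul hh0 hC
  have hi' : Integrable (h * μ[Y | m]) μ := integrable_condExp.bdd_mul hh0 hC
  have hpull := condExp_mul_of_stronglyMeasurable_left hh.stronglyMeasurable hi hY
  have heq : ∫ ω, (h * Y) ω ∂μ = ∫ ω, (h * μ[Y | m]) ω ∂μ := by
    rw [← integral_condExp hm]
    exact integral_congr_ae hpull
  calc ∫ ω, h ω * (Y ω - (μ[Y | m]) ω) ∂μ
      = ∫ ω, ((h * Y) ω - (h * μ[Y | m]) ω) ∂μ := by
        simp only [Pi.mul_apply, mul_sub]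
    _ = 0 := by rw [integral_sub hi hi', heq, sub_self]

/-- If each `exp (X s)` is dominated by `1` plus a predictable multiple of the martingale
difference `Y s - μ[Y s | 𝒢 (s - 1)]`, then `exp (∑ X s)` has expectation at most `1`. -/
lemma integral_exp_sum_le_one {Ω : Type*} {m0 : MeasurableSpace Ω} {μ : Measure Ω}
    [IsProbabilityMeasure μ] {𝒢 : ℕ → MeasurableSpace Ω} (hmono : Monotone 𝒢)
    (hle : ∀ s, 𝒢 s ≤ m0) {X Y b : ℕ → Ω → ℝ} {N : ℕ} {C B : ℝ}
    (hX : ∀ s ∈ Icc 1 N, Measurable[𝒢 s] (X s))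
    (hXC : ∀ s ∈ Icc 1 N, ∀ᵐ ω ∂μ, |X s ω| ≤ C)
    (hY : ∀ s ∈ Icc 1 N, Integrable (Y s) μ)
    (hb : ∀ s ∈ Icc 1 N, Measurable[𝒢 (s - 1)] (b s))
    (hbB : ∀ s ∈ Icc 1 N, ∀ᵐ ω ∂μ, |b s ω| ≤ B)
    (hdom : ∀ s ∈ Icc 1 N, ∀ᵐ ω ∂μ,
      Real.exp (X s ω) ≤ 1 + b s ω * (Y s ω - (μ[Y s | 𝒢 (s - 1)]) ω)) :
    Integrable (fun ω => Real.exp (∑ s ∈ Icc 1 N, X s ω)) μ ∧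
      ∫ ω, Real.exp (∑ s ∈ Icc 1 N, X s ω) ∂μ ≤ 1 := by
  have hmeas : ∀ n ≤ N, Measurable[𝒢 n] (fun ω => Real.exp (∑ s ∈ Icc 1 n, X s ω)) := by
    intro n hn
    refine Real.measurable_exp.comp (Finset.measurable_sum _ fun s hs => ?_)
    rw [mem_Icc] at hs
    exact (hX s (mem_Icc.2 ⟨hs.1, hs.2.trans hn⟩)).mono (hmono hs.2) le_rfl
  have hbdd : ∀ n ≤ N, ∀ᵐ ω ∂μ, |Real.exp (∑ s ∈ Icc 1 n, X s ω)| ≤ Real.exp (n * C) := by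
    intro n hn
    have hall : ∀ᵐ ω ∂μ, ∀ s ∈ Icc 1 N, |X s ω| ≤ C := (Finset.eventually_all _).2 hXC
    filter_upwards [hall] with ω hω
    rw [Real.abs_exp, Real.exp_le_exp]
    calc ∑ s ∈ Icc 1 n, X s ω ≤ ∑ s ∈ Icc 1 n, C := sum_le_sum fun s hs =>
          (le_abs_self _).trans (hω s (Icc_subset_Icc_right hn hs))
      _ = n * C := by simp
  have hint : ∀ n ≤ N, Integrable (fun ω => Real.exp (∑ s ∈ Icc 1 n, X s ω)) μ := fun n hn =>
    Integrable.of_bound ((hmeas n hn).mono (hle n) le_rfl).aestronglyMeasurable _ (hbdd n hn)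
  have hmain : ∀ n ≤ N, ∫ ω, Real.exp (∑ s ∈ Icc 1 n, X s ω) ∂μ ≤ 1 := by
    intro n
    induction n with
    | zero => simp
    | succ n ih =>
      intro hn
      have hn' : n ≤ N := (Nat.le_succ n).trans hn
      have hmem : n + 1 ∈ Icc 1 N := mem_Icc.2 ⟨by omega, hn⟩
      set M : Ω → ℝ := fun ω => Real.exp (∑ s ∈ Icc 1 n, X s ω) with hM
      have hw : Measurable[𝒢 n] (fun ω => M ω * b (n + 1) ω) :=
        (hmeas n hn').mul (hb (n + 1) hmem)
      have hwC : ∀ᵐ ω ∂μ, |M ω * b (n + 1) ω| ≤ Real.exp (n * C) * B := by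
        filter_upwards [hbdd n hn', hbB (n + 1) hmem] with ω h1 h2
        rw [abs_mul]
        exact mul_le_mul h1 h2 (abs_nonneg _) (Real.exp_pos _).le
      have hzero := integral_mul_sub_condExp_eq_zero (hle n) hw hwC (hY (n + 1) hmem)
      have hincr : Integrable (fun ω => M ω * b (n + 1) ω *
          (Y (n + 1) ω - (μ[Y (n + 1) | 𝒢 n]) ω)) μ :=
        ((hY (n + 1) hmem).sub integrable_condExp).bdd_mul
          (hw.mono (hle n) le_rfl).aestronglyMeasurable hwC
      calc ∫ ω, Real.exp (∑ s ∈ Icc 1 (n + 1), X s ω) ∂μ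
          ≤ ∫ ω, (M ω + M ω * b (n + 1) ω *
              (Y (n + 1) ω - (μ[Y (n + 1) | 𝒢 n]) ω)) ∂μ := by
            refine integral_mono_ae (hint _ hn) ((hint n hn').add hincr) ?_
            filter_upwards [hdom (n + 1) hmem] with ω hω
            rw [sum_Icc_succ_top (by omega), Real.exp_add]
            have := mul_le_mul_of_nonneg_left hω (Real.exp_pos (∑ s ∈ Icc 1 n, X s ω)).le
            simp only [Nat.add_sub_cancel] at this
            simp only [hM]
            linarith
        _ = ∫ ω, M ω ∂μ := by
            rw [integral_add (hint n hn') hincr, hzero, add_zero]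
        _ ≤ 1 := ih hn'
  exact ⟨hint N le_rfl, hmain N le_rfl⟩

/-- An upper bound, affine in `y`, for the exponential of a centred and compensated increment. -/
lemma exp_compensated_le {r y g v : ℝ} (hr : 0 ≤ r) (hr' : r ≤ 1 / 18)
    (hy : y ∈ Set.Icc (0 : ℝ) 3) (hg : g ∈ Set.Icc (0 : ℝ) 3) (hv : 6 * r * |v| ≤ 1) :
    Real.exp (r * (2 * (y - g) * v - 1 / 2 * v ^ 2)) ≤
      1 + Real.exp (-(r / 2 * v ^ 2)) * (2 * r * v + (2 * r * v) ^ 2 * (3 - 2 * g)) *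
        (y - g) := by
  obtain ⟨hy0, hy3⟩ := hy
  obtain ⟨hg0, hg3⟩ := hg
  set c := 2 * r * v with hc
  have habs : |c * (y - g)| ≤ 1 := by
    have h1 : |y - g| ≤ 3 := abs_le.2 ⟨by linarith, by linarith⟩
    calc |c * (y - g)| = 2 * r * |v| * |y - g| := by
          rw [abs_mul, hc, abs_mul, abs_of_nonneg (by positivity : 0 ≤ 2 * r)]
      _ ≤ 2 * r * |v| * 3 := by gcongr
      _ ≤ 1 := by linarith
  have hexp : Real.exp (c * (y - g)) ≤
      (1 + c ^ 2 * (3 * g - g ^ 2)) + (c + c ^ 2 * (3 - 2 * g)) * (y - g) := by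
    have h1 := (abs_le.1 (Real.abs_exp_sub_one_sub_id_le habs)).2
    have h2 : 0 ≤ c ^ 2 * (y * (3 - y)) :=
      mul_nonneg (sq_nonneg c) (mul_nonneg hy0 (by linarith))
    nlinarith
  have hcomp : Real.exp (-(r / 2 * v ^ 2)) * (1 + c ^ 2 * (3 * g - g ^ 2)) ≤ 1 := by
    have h1 : c ^ 2 * (3 * g - g ^ 2) ≤ r / 2 * v ^ 2 := by
      calc c ^ 2 * (3 * g - g ^ 2) ≤ c ^ 2 * (9 / 4) :=
            mul_le_mul_of_nonneg_left (by nlinarith [sq_nonneg (g - 3 / 2)]) (sq_nonneg c)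
        _ = 9 * r * (r * v ^ 2) := by rw [hc]; ring
        _ ≤ 1 / 2 * (r * v ^ 2) :=
            mul_le_mul_of_nonneg_right (by linarith) (by positivity)
        _ = r / 2 * v ^ 2 := by ring
    calc Real.exp (-(r / 2 * v ^ 2)) * (1 + c ^ 2 * (3 * g - g ^ 2))
        ≤ Real.exp (-(r / 2 * v ^ 2)) * Real.exp (r / 2 * v ^ 2) := by
          gcongr
          linarith [Real.add_one_le_exp (r / 2 * v ^ 2)]
      _ = 1 := by rw [← Real.exp_add, neg_add_cancel, Real.exp_zero]
  have hsplit : r * (2 * (y - g) * v - 1 / 2 * v ^ 2) =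
      -(r / 2 * v ^ 2) + c * (y - g) := by rw [hc]; ring
  rw [hsplit, Real.exp_add]
  have := mul_le_mul_of_nonneg_left hexp (Real.exp_pos (-(r / 2 * v ^ 2))).le
  linarith

/-- **Unweighted martingale concentration against a predictable function (helper lemma
for the overly optimistic confidence interval).** With `Y_s ∈ [0,3]` adapted,
`g_s := E[Y_s|𝒢_{s-1}]`, and `u_s ∈ [0,L]` predictable, with probability at least
`1 - δ/K²`,
`∑_s 2 (Y_s - g_s)(u_s - g_s) ≤ (24L + 21) ι² + (1/2) ∑_s (u_s - g_s)²` where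
`ι := √(2 log(K (2 log(18LT) + 2)(log(18L) + 2)/δ))`. -/
theorem stmt7 {Ω : Type*} {m0 : MeasurableSpace Ω} (μ : Measure Ω) [IsProbabilityMeasure μ]
    (L K : ℝ) (hL : 1 ≤ L) (hK : 1 ≤ K)
    (t T : ℕ) (ht : 0 < t) (hT : 0 < T) (htT : t - 1 ≤ T)
    (δ : ℝ) (hδ : δ ∈ Set.Ioo (0 : ℝ) 1)
    (ι : ℝ)
    (hι : ι = Real.sqrt (2 * Real.log (K *
      (2 * Real.log (18 * L * (T : ℝ)) + 2) * (Real.log (18 * L) + 2) / δ)))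
    (𝒢 : ℕ → MeasurableSpace Ω)
    (hmono : ∀ s, 𝒢 s ≤ 𝒢 (s + 1)) (hle : ∀ s, 𝒢 s ≤ m0)
    (Y u : ℕ → Ω → ℝ)
    (hYmeas : ∀ s ∈ Finset.Icc 1 (t - 1), Measurable[𝒢 s] (Y s))
    (hYbdd : ∀ s ∈ Finset.Icc 1 (t - 1), ∀ᵐ ω ∂μ, Y s ω ∈ Set.Icc (0 : ℝ) 3)
    (humeas : ∀ s ∈ Finset.Icc 1 (t - 1), Measurable[𝒢 (s - 1)] (u s))
    (hubdd : ∀ s ∈ Finset.Icc 1 (t - 1), ∀ᵐ ω ∂μ, u s ω ∈ Set.Icc (0 : ℝ) L) :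
    ENNReal.ofReal (1 - δ / K ^ 2) ≤
      μ {ω | ∑ s ∈ Finset.Icc 1 (t - 1),
            2 * (Y s ω - (μ[Y s | 𝒢 (s - 1)]) ω) * (u s ω - (μ[Y s | 𝒢 (s - 1)]) ω)
          ≤ (24 * L + 21) * ι ^ 2
            + (1 / 2) * ∑ s ∈ Finset.Icc 1 (t - 1),
                (u s ω - (μ[Y s | 𝒢 (s - 1)]) ω) ^ 2} := by
  obtain ⟨hδ0, hδ1⟩ := hδ
  have hmono' : Monotone 𝒢 := monotone_nat_of_le_succ hmono
  set g : ℕ → Ω → ℝ := fun s => μ[Y s | 𝒢 (s - 1)] with hg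
  have hYint : ∀ s ∈ Icc 1 (t - 1), Integrable (Y s) μ := fun s hs =>
    Integrable.of_bound ((hYmeas s hs).mono (hle s) le_rfl).aestronglyMeasurable 3 <| by
      filter_upwards [hYbdd s hs] with ω hω
      rw [Real.norm_eq_abs, abs_of_nonneg hω.1]
      exact hω.2
  have hgmeas : ∀ s, Measurable[𝒢 (s - 1)] (g s) := fun s =>
    stronglyMeasurable_condExp.measurable
  have hgbdd : ∀ s ∈ Icc 1 (t - 1), ∀ᵐ ω ∂μ, g s ω ∈ Set.Icc (0 : ℝ) 3 := by
    intro s hs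
    have h0 : 0 ≤ᵐ[μ] μ[Y s | 𝒢 (s - 1)] :=
      condExp_nonneg ((hYbdd s hs).mono fun ω hω => hω.1)
    have h3 : μ[Y s | 𝒢 (s - 1)] ≤ᵐ[μ] μ[fun _ => (3 : ℝ) | 𝒢 (s - 1)] :=
      condExp_mono (hYint s hs) (integrable_const _) ((hYbdd s hs).mono fun ω hω => hω.2)
    rw [condExp_const (hle _)] at h3
    filter_upwards [h0, h3] with ω h1 h2
    exact ⟨h1, h2⟩
  have hpos : 0 < 24 * L + 21 := by linarith
  set r : ℝ := (24 * L + 21)⁻¹ with hr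
  have hr0 : 0 ≤ r := by positivity
  have hrL : r * (24 * L + 21) = 1 := inv_mul_cancel₀ hpos.ne'
  have hr1 : r ≤ 1 / 18 := by nlinarith
  have hv : ∀ s ∈ Icc 1 (t - 1), ∀ᵐ ω ∂μ, |u s ω - g s ω| ≤ L + 3 := by
    intro s hs
    filter_upwards [hubdd s hs, hgbdd s hs] with ω h1 h2
    exact abs_le.2 ⟨by linarith [h1.1, h2.2], by linarith [h1.2, h2.1]⟩
  set X : ℕ → Ω → ℝ := fun s ω =>
    r * (2 * (Y s ω - g s ω) * (u s ω - g s ω) - 1 / 2 * (u s ω - g s ω) ^ 2) with hX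
  set b : ℕ → Ω → ℝ := fun s ω => Real.exp (-(r / 2 * (u s ω - g s ω) ^ 2)) *
    (2 * r * (u s ω - g s ω) + (2 * r * (u s ω - g s ω)) ^ 2 * (3 - 2 * g s ω)) with hb
  have hpre : ∀ s, 𝒢 (s - 1) ≤ 𝒢 s := fun s => hmono' (Nat.sub_le s 1)
  have hcv : ∀ s ∈ Icc 1 (t - 1), ∀ᵐ ω ∂μ, 6 * r * |u s ω - g s ω| ≤ 1 := by
    intro s hs
    filter_upwards [hv s hs] with ω hω
    calc 6 * r * |u s ω - g s ω| ≤ 6 * r * (L + 3) := by gcongr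
      _ ≤ r * (24 * L + 21) := by nlinarith
      _ = 1 := hrL
  obtain ⟨hint, hle1⟩ := integral_exp_sum_le_one (μ := μ) (X := X) (Y := Y) (b := b)
    (N := t - 1) (C := 6 * (L + 3) + (L + 3) ^ 2) (B := 4) hmono' hle
    (fun s hs => by
      have h1 := hYmeas s hs
      have h2 := (humeas s hs).mono (hpre s) le_rfl
      have h3 := (hgmeas s).mono (hpre s) le_rfl
      exact ((((h1.sub h3).const_mul 2).mul (h2.sub h3)).sub
        (((h2.sub h3).pow_const 2).const_mul (1 / 2))).const_mul r)
    (fun s hs => by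
      filter_upwards [hv s hs, hYbdd s hs, hgbdd s hs] with ω h1 h2 h3
      have hD : |Y s ω - g s ω| ≤ 3 :=
        abs_le.2 ⟨by linarith [h2.1, h3.2], by linarith [h2.2, h3.1]⟩
      have hprod : |2 * (Y s ω - g s ω) * (u s ω - g s ω)| ≤ 6 * (L + 3) := by
        rw [abs_mul, abs_mul, abs_two]
        exact mul_le_mul (by linarith) h1 (abs_nonneg _) (by norm_num)
      have hsq : (u s ω - g s ω) ^ 2 ≤ (L + 3) ^ 2 :=
        sq_le_sq' (abs_le.1 h1).1 (abs_le.1 h1).2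
      have hdiff : |2 * (Y s ω - g s ω) * (u s ω - g s ω) - 1 / 2 * (u s ω - g s ω) ^ 2| ≤
          6 * (L + 3) + (L + 3) ^ 2 := by
        have h5 := sq_nonneg (u s ω - g s ω)
        have h6 := abs_le.1 hprod
        exact abs_le.2 ⟨by linarith [h6.1], by linarith [h6.2]⟩
      calc |X s ω| = r * |2 * (Y s ω - g s ω) * (u s ω - g s ω) -
            1 / 2 * (u s ω - g s ω) ^ 2| := by
            simp only [hX]
            rw [abs_mul, abs_of_nonneg hr0]
        _ ≤ 1 * (6 * (L + 3) + (L + 3) ^ 2) :=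
            mul_le_mul (by linarith) hdiff (abs_nonneg _) zero_le_one
        _ = _ := one_mul _)
    hYint
    (fun s hs => by
      have h2 := (humeas s hs).sub (hgmeas s)
      have h3 := hgmeas s
      exact (Real.measurable_exp.comp (((h2.pow_const 2).const_mul (r / 2)).neg)).mul
        ((h2.const_mul (2 * r)).add
          (((h2.const_mul (2 * r)).pow_const 2).mul ((h3.const_mul 2).const_sub 3))))
    (fun s hs => by
      filter_upwards [hcv s hs, hgbdd s hs] with ω h1 h2
      have hc : |2 * r * (u s ω - g s ω)| ≤ 1 := by
        rw [abs_mul, abs_of_nonneg (by positivity : 0 ≤ 2 * r)]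
        nlinarith [mul_nonneg hr0 (abs_nonneg (u s ω - g s ω))]
      have hw : |3 - 2 * g s ω| ≤ 3 :=
        abs_le.2 ⟨by linarith [h2.2], by linarith [h2.1]⟩
      have he : Real.exp (-(r / 2 * (u s ω - g s ω) ^ 2)) ≤ 1 :=
        Real.exp_le_one_iff.2 (by have : 0 ≤ r / 2 * (u s ω - g s ω) ^ 2 := by positivity
                                  linarith)
      have hq : |(2 * r * (u s ω - g s ω)) ^ 2 * (3 - 2 * g s ω)| ≤ 1 * 3 := by
        rw [abs_mul, abs_pow]
        exact mul_le_mul (pow_le_one₀ (abs_nonneg _) hc) hw (abs_nonneg _) zero_le_one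
      calc |b s ω| = Real.exp (-(r / 2 * (u s ω - g s ω) ^ 2)) *
            |2 * r * (u s ω - g s ω) + (2 * r * (u s ω - g s ω)) ^ 2 * (3 - 2 * g s ω)| := by
            simp only [hb]
            rw [abs_mul, Real.abs_exp]
        _ ≤ 1 * 4 := mul_le_mul he ((abs_add_le _ _).trans (by linarith)) (abs_nonneg _)
            zero_le_one
        _ = 4 := one_mul _)
    (fun s hs => by
      filter_upwards [hYbdd s hs, hgbdd s hs, hcv s hs] with ω h1 h2 h3
      exact exp_compensated_le hr0 hr1 h1 h2 h3)
  set S : Ω → ℝ := fun ω => ∑ s ∈ Icc 1 (t - 1), X s ω with hS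
  have htail : μ.real {ω | ι ^ 2 ≤ S ω} ≤ Real.exp (-ι ^ 2) := by
    have h := ProbabilityTheory.measure_ge_le_exp_mul_mgf (μ := μ) (X := S) (ι ^ 2)
      (zero_le_one' ℝ) (by simpa using hint)
    calc μ.real {ω | ι ^ 2 ≤ S ω}
        ≤ Real.exp (-1 * ι ^ 2) * ProbabilityTheory.mgf S μ 1 := h
      _ ≤ Real.exp (-1 * ι ^ 2) * 1 := by
          gcongr
          simpa [ProbabilityTheory.mgf] using hle1
      _ = Real.exp (-ι ^ 2) := by rw [mul_one, neg_one_mul]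
  have hexp : Real.exp (-ι ^ 2) ≤ δ / K ^ 2 := by
    have hT1 : (1 : ℝ) ≤ T := by exact_mod_cast hT
    have hlog1 : 0 ≤ Real.log (18 * L * T) := Real.log_nonneg (by nlinarith)
    have hlog2 : 0 ≤ Real.log (18 * L) := Real.log_nonneg (by linarith)
    set R := K * (2 * Real.log (18 * L * (T : ℝ)) + 2) * (Real.log (18 * L) + 2) / δ with hR
    have hKR : K / δ ≤ R := by
      rw [hR]
      gcongr
      rw [mul_assoc]
      exact le_mul_of_one_le_right (by linarith) (by nlinarith)
    have hKδ : 1 ≤ K / δ := by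
      rw [le_div_iff₀ hδ0]
      linarith
    have hR1 : 1 ≤ R := hKδ.trans hKR
    rw [hι, Real.sq_sqrt (mul_nonneg zero_le_two (Real.log_nonneg hR1)), Real.exp_neg,
      mul_comm, Real.exp_mul, Real.exp_log (by linarith), Real.rpow_two]
    calc (R ^ 2)⁻¹ ≤ ((K / δ) ^ 2)⁻¹ := by gcongr
      _ = δ ^ 2 / K ^ 2 := by rw [div_pow, inv_div]
      _ ≤ δ / K ^ 2 := by
          gcongr
          nlinarith
  have hsub : (Set.univ : Set Ω) ⊆ {ω | ∑ s ∈ Icc 1 (t - 1),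
      2 * (Y s ω - g s ω) * (u s ω - g s ω) ≤ (24 * L + 21) * ι ^ 2
        + (1 / 2) * ∑ s ∈ Icc 1 (t - 1), (u s ω - g s ω) ^ 2} ∪ {ω | ι ^ 2 ≤ S ω} := by
    intro ω _
    by_cases hω : ι ^ 2 ≤ S ω
    · exact Or.inr hω
    · left
      have hSω : S ω = r * (∑ s ∈ Icc 1 (t - 1), 2 * (Y s ω - g s ω) * (u s ω - g s ω) -
          1 / 2 * ∑ s ∈ Icc 1 (t - 1), (u s ω - g s ω) ^ 2) := by
        simp only [hS, hX]
        rw [← mul_sum, sum_sub_distrib, ← mul_sum (a := (1 / 2 : ℝ))]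
      have h1 := (not_le.1 hω).le
      rw [hSω, hr, inv_mul_le_iff₀ hpos] at h1
      simp only [Set.mem_ofPred_eq]
      linarith
  have htail' : μ {ω | ι ^ 2 ≤ S ω} ≤ ENNReal.ofReal (δ / K ^ 2) := by
    rw [← ofReal_measureReal]
    exact ENNReal.ofReal_le_ofReal (htail.trans hexp)
  have hcover := (measure_mono (μ := μ) hsub).trans (measure_union_le _ _)
  rw [measure_univ] at hcover
  rw [ENNReal.ofReal_sub _ (by positivity), ENNReal.ofReal_one]
  exact tsub_le_iff_right.2 (hcover.trans (by gcongr))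
end

section
/- (Unweighted martingale concentration for second-moment regression; Lemma C.9 of the paper.) Let L ≥ 1 and K ≥ 1 be reals, let t, T be positive integers with t − 1 ≤ T, and let δ ∈ (0, 1). Set ι′ := √( 2 log( K (2 log(32LT) + 2)(log(32L) + 2) / δ ) ). Let (𝒢_s)_{s=0}^{t−1} be a filtration, and for each s = 1, …, t−1 let Y_s be a 𝒢_s-measurable random variable with Y_s ∈ [0, 4] almost surely, let g_s := E[Y_s | 𝒢_{s−1}], and let u_s be a 𝒢_{s−1}-measurable random variable with u_s ∈ [0, L] almost surely. Then with probability at least 1 − δ/K²: Σ_{s=1}^{t−1} 2 (Y_s − g_s)(u_s − g_s) ≤ 4 (11L + 9) (ι′)² + (1/2) Σ_{s=1}^{t−1} (u_s − g_s)². -/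
open MeasureTheory Finset

namespace SecondMomentRegression

/-- The chord bound for `exp` on `[-4, 4]`. -/
lemma exp_mul_le_cosh_add (a x : ℝ) (hx : |x| ≤ 4) :
    Real.exp (a * x) ≤ Real.cosh (4 * a) + x * (Real.sinh (4 * a) / 4) := by
  obtain ⟨h1, h2⟩ := abs_le.1 hx
  have h := convexOn_exp.2 (Set.mem_univ (-(4 * a))) (Set.mem_univ (4 * a))
    (show 0 ≤ (4 - x) / 8 by linarith) (show 0 ≤ (4 + x) / 8 by linarith) (by ring)
  simp only [smul_eq_mul] at h
  rw [show (4 - x) / 8 * -(4 * a) + (4 + x) / 8 * (4 * a) = a * x by ring] at h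
  rw [Real.cosh_eq, Real.sinh_eq]
  linarith

lemma cosh_mul_exp_neg_le_one (a : ℝ) :
    Real.cosh (4 * a) * Real.exp (-(8 * a ^ 2)) ≤ 1 := by
  calc _ ≤ Real.exp ((4 * a) ^ 2 / 2) * Real.exp (-(8 * a ^ 2)) := by
        gcongr; exact Real.cosh_le_exp_half_sq _
    _ = 1 := by rw [← Real.exp_add, Real.exp_eq_one_iff]; ring

variable {Ω : Type*} {m m0 : MeasurableSpace Ω} {μ : Measure Ω} [IsProbabilityMeasure μ]

lemma integrable_of_ae_mem_Icc {Y : Ω → ℝ} {c : ℝ} (hY : AEStronglyMeasurable Y μ)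
    (hYb : ∀ᵐ ω ∂μ, Y ω ∈ Set.Icc 0 c) : Integrable Y μ :=
  Integrable.of_bound hY c (hYb.mono fun ω h => by
    rw [Real.norm_eq_abs, abs_of_nonneg h.1]; exact h.2)

lemma condExp_mem_Icc {Y : Ω → ℝ} {c : ℝ} (hm : m ≤ m0) (hY : AEStronglyMeasurable Y μ)
    (hYb : ∀ᵐ ω ∂μ, Y ω ∈ Set.Icc 0 c) : ∀ᵐ ω ∂μ, (μ[Y | m]) ω ∈ Set.Icc 0 c := by
  have hi := integrable_of_ae_mem_Icc hY hYb
  have h1 := condExp_mono (m := m) (integrable_const (0 : ℝ)) hi (hYb.mono fun ω h => h.1)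
  have h2 := condExp_mono (m := m) hi (integrable_const c) (hYb.mono fun ω h => h.2)
  rw [condExp_const hm] at h1 h2
  filter_upwards [h1, h2] with ω h1 h2 using ⟨h1, h2⟩

lemma integral_mul_sub_condExp {Y f : Ω → ℝ} {C : ℝ} (hm : m ≤ m0) (hY : Integrable Y μ)
    (hf : StronglyMeasurable[m] f) (hfb : ∀ᵐ ω ∂μ, ‖f ω‖ ≤ C) :
    ∫ ω, f ω * (Y ω - (μ[Y | m]) ω) ∂μ = 0 := by
  have hfY : Integrable (fun ω => f ω * Y ω) μ :=
    hY.bdd_mul (hf.mono hm).aestronglyMeasurable hfb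
  have hfg : Integrable (fun ω => f ω * (μ[Y | m]) ω) μ :=
    integrable_condExp.bdd_mul (hf.mono hm).aestronglyMeasurable hfb
  have h := integral_congr_ae (condExp_mul_of_stronglyMeasurable_left hf hfY hY)
  rw [integral_condExp hm] at h
  simp only [mul_sub]
  rw [integral_sub hfY hfg]
  exact sub_eq_zero.2 h

/-- One step of the exponential supermartingale. -/
lemma integral_mul_exp_le {W a Y : Ω → ℝ} {C : ℝ} (hm : m ≤ m0)
    (hW : StronglyMeasurable[m] W) (hW0 : ∀ ω, 0 ≤ W ω) (hWb : ∀ᵐ ω ∂μ, W ω ≤ C)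
    (ha : StronglyMeasurable[m] a)
    (hY : AEStronglyMeasurable Y μ) (hYb : ∀ᵐ ω ∂μ, Y ω ∈ Set.Icc 0 4) :
    ∫ ω, W ω * Real.exp (a ω * (Y ω - (μ[Y | m]) ω) - 8 * a ω ^ 2) ∂μ ≤ ∫ ω, W ω ∂μ := by
  have hYi := integrable_of_ae_mem_Icc hY hYb
  have hgb := condExp_mem_Icc hm hY hYb
  set f : Ω → ℝ := fun ω => W ω * Real.exp (-(8 * a ω ^ 2)) * (Real.sinh (4 * a ω) / 4) with hf
  have hfm : StronglyMeasurable[m] f := by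
    have := hW.measurable
    have := ha.measurable
    refine Measurable.stronglyMeasurable ?_
    fun_prop
  have hfb : ∀ᵐ ω ∂μ, ‖f ω‖ ≤ C := by
    filter_upwards [hWb] with ω hω
    have h1 : |Real.sinh (4 * a ω) / 4| ≤ Real.cosh (4 * a ω) := by
      rw [abs_div, abs_of_pos (by norm_num : (0 : ℝ) < 4), Real.abs_sinh, ← Real.cosh_abs]
      have := Real.sinh_lt_cosh |4 * a ω|
      have := Real.cosh_pos |4 * a ω|
      linarith
    rw [Real.norm_eq_abs, hf]
    simp only
    rw [abs_mul, abs_mul, abs_of_nonneg (hW0 ω), Real.abs_exp, mul_assoc]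
    calc _ ≤ W ω * (Real.cosh (4 * a ω) * Real.exp (-(8 * a ω ^ 2))) := by
          rw [mul_comm (Real.exp _)]; gcongr; exact hW0 ω
      _ ≤ W ω * 1 := by
          gcongr
          · exact hW0 ω
          · exact cosh_mul_exp_neg_le_one _
      _ ≤ C := by simpa using hω
  have hWi : Integrable W μ := Integrable.of_bound (hW.mono hm).aestronglyMeasurable C
    (hWb.mono fun ω h => by rwa [Real.norm_eq_abs, abs_of_nonneg (hW0 ω)])
  have hfi : Integrable (fun ω => f ω * (Y ω - (μ[Y | m]) ω)) μ :=
    (hYi.sub integrable_condExp).bdd_mul (hfm.mono hm).aestronglyMeasurable hfb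
  calc _ ≤ ∫ ω, (W ω + f ω * (Y ω - (μ[Y | m]) ω)) ∂μ := by
        refine integral_mono_of_nonneg (ae_of_all _ fun ω => mul_nonneg (hW0 ω) (Real.exp_pos _).le)
          (hWi.add hfi) ?_
        filter_upwards [hYb, hgb] with ω h1 h2
        have hx : |Y ω - (μ[Y | m]) ω| ≤ 4 :=
          abs_le.2 ⟨by linarith [h1.1, h2.2], by linarith [h1.2, h2.1]⟩
        have h := exp_mul_le_cosh_add (a ω) _ hx
        have hc := cosh_mul_exp_neg_le_one (a ω)
        have he := mul_le_mul_of_nonneg_right h (Real.exp_pos (-(8 * a ω ^ 2))).le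
        have hw := mul_le_mul_of_nonneg_left (show
          Real.exp (a ω * (Y ω - (μ[Y | m]) ω)) * Real.exp (-(8 * a ω ^ 2)) ≤
            1 + (Y ω - (μ[Y | m]) ω) * (Real.sinh (4 * a ω) / 4) * Real.exp (-(8 * a ω ^ 2))
          by linarith) (hW0 ω)
        simp only [hf]
        rw [sub_eq_add_neg (a ω * _), Real.exp_add]
        linarith
    _ = ∫ ω, W ω ∂μ := by
        rw [integral_add hWi hfi, integral_mul_sub_condExp hm hYi hfm hfb, add_zero]

/-- The exponential supermartingale has expectation at most one. -/
lemma integral_exp_sum_le_one {𝒢 : ℕ → MeasurableSpace Ω} {Y a : ℕ → Ω → ℝ} {N : ℕ} {B : ℝ}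
    (hmono : Monotone 𝒢) (hle : ∀ s, 𝒢 s ≤ m0)
    (hY : ∀ s ∈ Icc 1 N, Measurable[𝒢 s] (Y s))
    (hYb : ∀ s ∈ Icc 1 N, ∀ᵐ ω ∂μ, Y s ω ∈ Set.Icc (0 : ℝ) 4)
    (ha : ∀ s ∈ Icc 1 N, Measurable[𝒢 (s - 1)] (a s))
    (hab : ∀ s ∈ Icc 1 N, ∀ᵐ ω ∂μ, |a s ω| ≤ B) :
    Integrable (fun ω => Real.exp (∑ s ∈ Icc 1 N,
      (a s ω * (Y s ω - (μ[Y s | 𝒢 (s - 1)]) ω) - 8 * a s ω ^ 2))) μ ∧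
    ∫ ω, Real.exp (∑ s ∈ Icc 1 N,
      (a s ω * (Y s ω - (μ[Y s | 𝒢 (s - 1)]) ω) - 8 * a s ω ^ 2)) ∂μ ≤ 1 := by
  set X : ℕ → Ω → ℝ := fun s ω =>
    a s ω * (Y s ω - (μ[Y s | 𝒢 (s - 1)]) ω) - 8 * a s ω ^ 2 with hX
  have hXm : ∀ s ∈ Icc 1 N, Measurable[𝒢 s] (X s) := fun s hs => by
    have h1 := hY s hs
    have h2 := (ha s hs).mono (hmono (Nat.sub_le s 1)) le_rfl
    have h3 : Measurable[𝒢 s] (μ[Y s | 𝒢 (s - 1)]) :=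
      stronglyMeasurable_condExp.measurable.mono (hmono (Nat.sub_le s 1)) le_rfl
    exact (h2.mul (h1.sub h3)).sub ((h2.pow_const 2).const_mul 8)
  have hXb : ∀ s ∈ Icc 1 N, ∀ᵐ ω ∂μ, X s ω ≤ B * 4 := fun s hs => by
    have hYs := ((hY s hs).mono (hle s) le_rfl).aestronglyMeasurable (μ := μ)
    filter_upwards [hYb s hs, condExp_mem_Icc (hle (s - 1)) hYs (hYb s hs), hab s hs]
      with ω h1 h2 h3
    have hx : |Y s ω - (μ[Y s | 𝒢 (s - 1)]) ω| ≤ 4 :=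
      abs_le.2 ⟨by linarith [h1.1, h2.2], by linarith [h1.2, h2.1]⟩
    have h4 := mul_le_mul h3 hx (abs_nonneg _) ((abs_nonneg _).trans h3)
    rw [← abs_mul] at h4
    simp only [hX]
    linarith [le_abs_self (a s ω * (Y s ω - (μ[Y s | 𝒢 (s - 1)]) ω)), sq_nonneg (a s ω)]
  have hm : ∀ n ≤ N, Measurable[𝒢 n] (fun ω => Real.exp (∑ s ∈ Icc 1 n, X s ω)) :=
    fun n hn => (Finset.measurable_fun_sum _ fun s hs => by
      rw [mem_Icc] at hs
      exact (hXm s (mem_Icc.2 ⟨hs.1, hs.2.trans hn⟩)).mono (hmono hs.2) le_rfl).exp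
  have hb : ∀ n ≤ N, ∀ᵐ ω ∂μ,
      Real.exp (∑ s ∈ Icc 1 n, X s ω) ≤ Real.exp (∑ s ∈ Icc 1 n, B * 4) := fun n hn => by
    have : ∀ᵐ ω ∂μ, ∀ s ∈ Icc 1 N, X s ω ≤ B * 4 := (ae_ball_iff (Icc 1 N).countable_toSet).2 hXb
    filter_upwards [this] with ω h
    gcongr with s hs
    exact h s (Icc_subset_Icc_right hn hs)
  have key : ∀ n ≤ N, ∫ ω, Real.exp (∑ s ∈ Icc 1 n, X s ω) ∂μ ≤ 1 := by
    intro n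
    induction n with
    | zero => simp
    | succ n ih =>
      intro hn
      have hs : n + 1 ∈ Icc 1 N := mem_Icc.2 ⟨by lia, hn⟩
      refine le_trans ?_ (ih (by lia))
      simp only [sum_Icc_succ_top (show 1 ≤ n + 1 by lia), Real.exp_add]
      exact integral_mul_exp_le (hle n) (hm n (by lia)).stronglyMeasurable
        (fun ω => (Real.exp_pos _).le) (hb n (by lia)) (ha _ hs).stronglyMeasurable
        ((hY _ hs).mono (hle _) le_rfl).aestronglyMeasurable (hYb _ hs)
  refine ⟨Integrable.of_bound ((hm N le_rfl).mono (hle N) le_rfl).aestronglyMeasurable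
    (Real.exp (∑ s ∈ Icc 1 N, B * 4)) ((hb N le_rfl).mono fun ω h => ?_), key N le_rfl⟩
  rwa [Real.norm_eq_abs, Real.abs_exp]

/-- The failure probability `exp (-c / 64)` at the threshold `c = 4(11L + 9)(ι′)²`. -/
lemma exp_neg_threshold_le {L K δ T : ℝ} (hL : 1 ≤ L) (hK : 1 ≤ K) (hT : 1 ≤ T)
    (hδ : δ ∈ Set.Ioo (0 : ℝ) 1) :
    Real.exp (-(4 * (11 * L + 9) * Real.sqrt (2 * Real.log (K *
      (2 * Real.log (32 * L * T) + 2) * (Real.log (32 * L) + 2) / δ)) ^ 2 / 64)) ≤ δ / K ^ 2 := by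
  obtain ⟨hδ0, hδ1⟩ := hδ
  have hp : 0 ≤ Real.log (32 * L * T) := Real.log_nonneg (by nlinarith)
  have hq : 0 ≤ Real.log (32 * L) := Real.log_nonneg (by linarith)
  set x := K * (2 * Real.log (32 * L * T) + 2) * (Real.log (32 * L) + 2) / δ with hx
  have hKx : K / δ ≤ x := by
    rw [hx]
    gcongr
    calc K = K * 1 * 1 := by ring
      _ ≤ _ := by gcongr <;> linarith
  have h1 : 1 ≤ K / δ := by rw [le_div_iff₀ hδ0]; linarith
  have hl : 0 ≤ Real.log x := Real.log_nonneg (h1.trans hKx)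
  rw [Real.sq_sqrt (by positivity)]
  calc _ ≤ Real.exp (-(2 * Real.log x)) := by
        rw [Real.exp_le_exp]; nlinarith [mul_nonneg (sub_nonneg.2 hL) hl]
    _ = (x ^ 2)⁻¹ := by
        rw [Real.exp_neg, two_mul, Real.exp_add, Real.exp_log (by linarith), sq]
    _ ≤ ((K / δ) ^ 2)⁻¹ := by gcongr
    _ = δ ^ 2 / K ^ 2 := by rw [div_pow, inv_div]
    _ ≤ δ / K ^ 2 := by gcongr; nlinarith

end SecondMomentRegression

/-- **Unweighted martingale concentration for second-moment regression (Lemma C.9).**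
With `Y_s ∈ [0,4]` adapted, `g_s := E[Y_s|𝒢_{s-1}]`, and `u_s ∈ [0,L]` predictable,
with probability at least `1 - δ/K²`,
`∑_s 2 (Y_s - g_s)(u_s - g_s) ≤ 4(11L + 9)(ι′)² + (1/2) ∑_s (u_s - g_s)²` where
`ι′ := √(2 log(K (2 log(32LT) + 2)(log(32L) + 2)/δ))`. -/
theorem stmt8 {Ω : Type*} {m0 : MeasurableSpace Ω} (μ : Measure Ω) [IsProbabilityMeasure μ]
    (L K : ℝ) (hL : 1 ≤ L) (hK : 1 ≤ K)
    (t T : ℕ) (ht : 0 < t) (hT : 0 < T) (htT : t - 1 ≤ T)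
    (δ : ℝ) (hδ : δ ∈ Set.Ioo (0 : ℝ) 1)
    (ι' : ℝ)
    (hι' : ι' = Real.sqrt (2 * Real.log (K *
      (2 * Real.log (32 * L * (T : ℝ)) + 2) * (Real.log (32 * L) + 2) / δ)))
    (𝒢 : ℕ → MeasurableSpace Ω)
    (hmono : ∀ s, 𝒢 s ≤ 𝒢 (s + 1)) (hle : ∀ s, 𝒢 s ≤ m0)
    (Y u : ℕ → Ω → ℝ)
    (hYmeas : ∀ s ∈ Finset.Icc 1 (t - 1), Measurable[𝒢 s] (Y s))
    (hYbdd : ∀ s ∈ Finset.Icc 1 (t - 1), ∀ᵐ ω ∂μ, Y s ω ∈ Set.Icc (0 : ℝ) 4)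
    (humeas : ∀ s ∈ Finset.Icc 1 (t - 1), Measurable[𝒢 (s - 1)] (u s))
    (hubdd : ∀ s ∈ Finset.Icc 1 (t - 1), ∀ᵐ ω ∂μ, u s ω ∈ Set.Icc (0 : ℝ) L) :
    ENNReal.ofReal (1 - δ / K ^ 2) ≤
      μ {ω | ∑ s ∈ Finset.Icc 1 (t - 1),
            2 * (Y s ω - (μ[Y s | 𝒢 (s - 1)]) ω) * (u s ω - (μ[Y s | 𝒢 (s - 1)]) ω)
          ≤ 4 * (11 * L + 9) * ι' ^ 2
            + (1 / 2) * ∑ s ∈ Finset.Icc 1 (t - 1),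
                (u s ω - (μ[Y s | 𝒢 (s - 1)]) ω) ^ 2} := by
  have hmono' : Monotone 𝒢 := monotone_nat_of_le_succ hmono
  set N := t - 1
  set g : ℕ → Ω → ℝ := fun s => μ[Y s | 𝒢 (s - 1)] with hg
  set c := 4 * (11 * L + 9) * ι' ^ 2 with hc
  have hgm : ∀ s, Measurable[𝒢 (s - 1)] (g s) := fun s => stronglyMeasurable_condExp.measurable
  obtain ⟨hi, hle1⟩ := SecondMomentRegression.integral_exp_sum_le_one (μ := μ) (N := N)
    (a := fun s ω => (u s ω - g s ω) / 32) (B := L + 4) hmono' hle hYmeas hYbdd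
    (fun s hs => ((humeas s hs).sub (hgm s)).div_const 32) (fun s hs => by
      filter_upwards [hubdd s hs, SecondMomentRegression.condExp_mem_Icc (hle (s - 1))
        ((hYmeas s hs).mono (hle s) le_rfl).aestronglyMeasurable (hYbdd s hs)] with ω h1 h2
      exact abs_le.2 ⟨by linarith [h1.1, h2.2], by linarith [h1.2, h2.1]⟩)
  set S : Ω → ℝ := fun ω => ∑ s ∈ Icc 1 N, ((u s ω - g s ω) / 32 * (Y s ω - g s ω)
    - 8 * ((u s ω - g s ω) / 32) ^ 2) with hS
  have hset : {ω | ∑ s ∈ Icc 1 N, 2 * (Y s ω - g s ω) * (u s ω - g s ω)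
      ≤ c + 1 / 2 * ∑ s ∈ Icc 1 N, (u s ω - g s ω) ^ 2} = {ω | c / 64 < S ω}ᶜ := by
    ext ω
    have : S ω = (∑ s ∈ Icc 1 N, 2 * (Y s ω - g s ω) * (u s ω - g s ω)
        - 1 / 2 * ∑ s ∈ Icc 1 N, (u s ω - g s ω) ^ 2) / 64 := by
      rw [mul_sum, ← sum_sub_distrib, sum_div]
      exact sum_congr rfl fun s _ => by ring
    simp only [Set.mem_ofPred_eq, Set.mem_compl_iff, not_lt, this]
    constructor <;> intro h <;> linarith
  have hSm : Measurable S := Finset.measurable_fun_sum _ fun s hs => by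
    have h1 := (hYmeas s hs).mono (hle _) le_rfl
    have h2 := (humeas s hs).mono (hle _) le_rfl
    have h3 := (hgm s).mono (hle _) le_rfl
    fun_prop
  have hmarkov := mul_meas_ge_le_integral_of_nonneg
    (ae_of_all μ fun ω => (Real.exp_pos (S ω)).le) hi (Real.exp (c / 64))
  have hreal : μ.real {ω | c / 64 < S ω} ≤ δ / K ^ 2 := by
    calc _ ≤ μ.real {ω | Real.exp (c / 64) ≤ Real.exp (S ω)} :=
          measureReal_mono fun ω hω => Real.exp_le_exp.2 (le_of_lt hω)
      _ ≤ Real.exp (-(c / 64)) := by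
          rw [Real.exp_neg, ← one_div, le_div_iff₀' (Real.exp_pos _)]
          exact hmarkov.trans hle1
      _ ≤ δ / K ^ 2 := by
          rw [hc, hι']
          exact SecondMomentRegression.exp_neg_threshold_le hL hK (by exact_mod_cast hT) hδ
  rw [hset, ← ofReal_measureReal, probReal_compl_eq_one_sub (measurableSet_lt measurable_const hSm)]
  exact ENNReal.ofReal_le_ofReal (by linarith)
end

section
/- (In-sample error of least squares over a finite class; fixed-target form of Lemma C.5.) Let Z be a measurable space, L ≥ 1, and F a finite set of measurable functions Z → [0, L] with |F| = N. Let t, T be positive integers with t − 1 ≤ T, let ε ≥ 0 and δ ∈ (0, 1), and set ι := √( 2 log( N (2 log(18LT) + 2)(log(18L) + 2) / δ ) ). Let (𝒢_s)_{s=0}^{t−1} be a filtration; for each s = 1, …, t−1 let z_s be a 𝒢_{s−1}-measurable Z-valued random variable and Y_s a 𝒢_s-measurable random variable with Y_s ∈ [0, 3] almost surely, and suppose there is a measurable function ḡ : Z → [0, 3] with E[Y_s | 𝒢_{s−1}] = ḡ(z_s) almost surely for every s. Suppose f̄ ∈ F satisfies sup_{z∈Z} |f̄(z) − ḡ(z)|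 ≤ ε. Let f̂ be a measurable F-valued random element such that almost surely Σ_{s=1}^{t−1} (f̂(z_s) − Y_s)² ≤ Σ_{s=1}^{t−1} (f(z_s) − Y_s)² for every f ∈ F. Then with probability at least 1 − δ: Σ_{s=1}^{t−1} ( f̂(z_s) − f̄(z_s) )² ≤ 2 (24L + 21) ι² + 20 (t−1) L ε. -/
open MeasureTheory Finset

/-- A bounded predictable multiple of a centred bounded increment has, after subtracting a
multiple of its squared size, a conditional moment generating function of at most one. -/
theorem integral_mul_exp_sub_sq_le {Ω : Type*} {m m0 : MeasurableSpace Ω} {μ : Measure Ω}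
    [IsProbabilityMeasure μ] (hm : m ≤ m0) {W D g Y : Ω → ℝ}
    (hW : StronglyMeasurable[m] W) (hW_nonneg : 0 ≤ W) (hW_int : Integrable W μ)
    (hD : StronglyMeasurable[m] D) (hD_le : ∀ ω, |D ω| ≤ 1 / 3)
    (hg : StronglyMeasurable[m] g) (hg_mem : ∀ ω, g ω ∈ Set.Icc (0 : ℝ) 3)
    (hY : StronglyMeasurable[m0] Y) (hY_mem : ∀ᵐ ω ∂μ, Y ω ∈ Set.Icc (0 : ℝ) 3)
    (hcond : μ[Y | m] =ᵐ[μ] g) :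
    Integrable (fun ω => W ω * Real.exp (D ω * (Y ω - g ω) - 9 / 4 * D ω ^ 2)) μ ∧
      ∫ ω, W ω * Real.exp (D ω * (Y ω - g ω) - 9 / 4 * D ω ^ 2) ∂μ ≤ ∫ ω, W ω ∂μ := by
  have hD' := hD.mono hm
  have hg' := hg.mono hm
  have hξ_le : ∀ᵐ ω ∂μ, |Y ω - g ω| ≤ 3 := by
    filter_upwards [hY_mem] with ω hω
    have := hg_mem ω
    exact abs_le.2 ⟨by linarith [hω.1, this.2], by linarith [hω.2, this.1]⟩
  have hDξ_le : ∀ᵐ ω ∂μ, |D ω * (Y ω - g ω)| ≤ 1 := by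
    filter_upwards [hξ_le] with ω hω
    rw [abs_mul]
    calc |D ω| * |Y ω - g ω| ≤ 1 / 3 * 3 :=
          mul_le_mul (hD_le ω) hω (abs_nonneg _) (by norm_num)
      _ = 1 := by norm_num
  have hint : Integrable
      (fun ω => W ω * Real.exp (D ω * (Y ω - g ω) - 9 / 4 * D ω ^ 2)) μ := by
    refine hW_int.mul_bdd (c := Real.exp 1) ?_ ?_
    · exact (Real.continuous_exp.comp_stronglyMeasurable
        ((hD'.mul (hY.sub hg')).sub ((hD'.pow 2).const_mul _))).aestronglyMeasurable
    · filter_upwards [hDξ_le] with ω hω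
      rw [Real.norm_eq_abs, Real.abs_exp, Real.exp_le_exp]
      nlinarith [(abs_le.1 hω).2, sq_nonneg (D ω)]
  refine ⟨hint, ?_⟩
  have hE_meas : StronglyMeasurable[m] (fun ω => Real.exp (-(9 / 4 * D ω ^ 2))) :=
    Real.continuous_exp.comp_stronglyMeasurable ((hD.pow 2).const_mul _).neg
  have hE_le : ∀ ω, Real.exp (-(9 / 4 * D ω ^ 2)) ≤ 1 := fun ω => by
    rw [Real.exp_le_one_iff]; nlinarith [sq_nonneg (D ω)]
  set V : Ω → ℝ := fun ω => W ω *
    (Real.exp (-(9 / 4 * D ω ^ 2)) * (D ω + D ω ^ 2 * (3 - 2 * g ω))) with hV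
  have hfac : StronglyMeasurable[m]
      (fun ω => Real.exp (-(9 / 4 * D ω ^ 2)) * (D ω + D ω ^ 2 * (3 - 2 * g ω))) :=
    hE_meas.mul (hD.add ((hD.pow 2).mul (stronglyMeasurable_const.sub (hg.const_mul 2))))
  have hV_meas : StronglyMeasurable[m] V := hW.mul hfac
  have hV_int : Integrable V μ := by
    refine hW_int.mul_bdd (c := 1) (hfac.mono hm).aestronglyMeasurable (ae_of_all _ fun ω => ?_)
    rw [Real.norm_eq_abs, abs_mul, Real.abs_exp]
    refine mul_le_one₀ (hE_le ω) (abs_nonneg _) (abs_le.2 ?_)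
    have h1 := abs_le.1 (hD_le ω)
    have h2 := hg_mem ω
    have h3 : D ω ^ 2 ≤ 1 / 9 := by nlinarith
    have h4 := sq_nonneg (D ω)
    constructor <;> nlinarith [h2.1, h2.2]
  have hY_int : Integrable Y μ :=
    Integrable.of_bound hY.aestronglyMeasurable 3 (by
      filter_upwards [hY_mem] with ω hω
      exact abs_le.2 ⟨by linarith [hω.1], hω.2⟩)
  have hg_int : Integrable g μ :=
    Integrable.of_bound hg'.aestronglyMeasurable 3 (ae_of_all _ fun ω =>
      abs_le.2 ⟨by linarith [(hg_mem ω).1], (hg_mem ω).2⟩)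
  have hVξ_int : Integrable (V * (Y - g)) μ :=
    hV_int.mul_bdd (c := 3) (hY.sub hg').aestronglyMeasurable hξ_le
  have hVξ : ∫ ω, (V * (Y - g)) ω ∂μ = 0 := by
    rw [← integral_condExp hm]
    refine integral_eq_zero_of_ae ?_
    have h1 := condExp_mul_of_stronglyMeasurable_left hV_meas hVξ_int (hY_int.sub hg_int)
    have h2 := condExp_sub hY_int hg_int m
    filter_upwards [h1, h2, hcond] with ω h1 h2 h3
    rw [h1, Pi.mul_apply, h2, Pi.sub_apply, h3, condExp_of_stronglyMeasurable hm hg hg_int]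
    simp
  calc ∫ ω, W ω * Real.exp (D ω * (Y ω - g ω) - 9 / 4 * D ω ^ 2) ∂μ
      ≤ ∫ ω, (W ω + (V * (Y - g)) ω) ∂μ := by
        refine integral_mono_ae hint (hW_int.add hVξ_int) ?_
        filter_upwards [hY_mem, hDξ_le] with ω hω hx
        have hg0 := hg_mem ω
        set x := D ω * (Y ω - g ω) with hx_def
        have hexp : Real.exp x ≤ 1 + x + x ^ 2 := by
          have := (abs_le.1 (Real.abs_exp_sub_one_sub_id_le hx)).2
          linarith
        have hsq : x ^ 2 ≤ D ω ^ 2 * ((3 - 2 * g ω) * (Y ω - g ω)) + 9 / 4 * D ω ^ 2 := by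
          have : (Y ω - g ω) ^ 2 ≤ (3 - 2 * g ω) * (Y ω - g ω) + 9 / 4 := by
            nlinarith [hω.1, hω.2, sq_nonneg (g ω - 3 / 2), mul_nonneg hω.1 (sub_nonneg.2 hω.2)]
          rw [hx_def]
          nlinarith [mul_le_mul_of_nonneg_left this (sq_nonneg (D ω))]
        have hone : Real.exp (-(9 / 4 * D ω ^ 2)) * (1 + 9 / 4 * D ω ^ 2) ≤ 1 := by
          rw [Real.exp_neg, inv_mul_le_iff₀ (Real.exp_pos _), mul_one]
          linarith [Real.add_one_le_exp (9 / 4 * D ω ^ 2)]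
        have hE0 := (Real.exp_pos (-(9 / 4 * D ω ^ 2))).le
        have hfactor : Real.exp (x - 9 / 4 * D ω ^ 2) ≤ 1 + Real.exp (-(9 / 4 * D ω ^ 2)) *
            (D ω + D ω ^ 2 * (3 - 2 * g ω)) * (Y ω - g ω) := by
          rw [sub_eq_neg_add, Real.exp_add]
          have := mul_le_mul_of_nonneg_left (hexp.trans (add_le_add_right hsq (1 + x))) hE0
          rw [hx_def] at this ⊢
          linarith
        have := mul_le_mul_of_nonneg_left hfactor (hW_nonneg ω)
        simp only [hV, Pi.mul_apply, Pi.sub_apply]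
        linarith
    _ = ∫ ω, W ω ∂μ := by
        rw [integral_add hW_int hVξ_int, hVξ, add_zero]

/-- The exponential process attached to predictable multiples of centred increments of
`[0, 3]`-valued responses has expectation at most one. -/
theorem integral_exp_sum_sub_sq_le_one {Ω : Type*} {m0 : MeasurableSpace Ω} {μ : Measure Ω}
    [IsProbabilityMeasure μ] {𝒢 : ℕ → MeasurableSpace Ω}
    (hmono : ∀ s, 𝒢 s ≤ 𝒢 (s + 1)) (hle : ∀ s, 𝒢 s ≤ m0) {D g Y : ℕ → Ω → ℝ} {n : ℕ}
    (hD : ∀ s ∈ Icc 1 n, Measurable[𝒢 (s - 1)] (D s))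
    (hD_le : ∀ s ∈ Icc 1 n, ∀ ω, |D s ω| ≤ 1 / 3)
    (hg : ∀ s ∈ Icc 1 n, Measurable[𝒢 (s - 1)] (g s))
    (hg_mem : ∀ s ∈ Icc 1 n, ∀ ω, g s ω ∈ Set.Icc (0 : ℝ) 3)
    (hY : ∀ s ∈ Icc 1 n, Measurable[𝒢 s] (Y s))
    (hY_mem : ∀ s ∈ Icc 1 n, ∀ᵐ ω ∂μ, Y s ω ∈ Set.Icc (0 : ℝ) 3)
    (hcond : ∀ s ∈ Icc 1 n, μ[Y s | 𝒢 (s - 1)] =ᵐ[μ] g s) :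
    StronglyMeasurable[𝒢 n] (fun ω => Real.exp
        (∑ s ∈ Icc 1 n, (D s ω * (Y s ω - g s ω) - 9 / 4 * D s ω ^ 2))) ∧
      Integrable (fun ω => Real.exp
        (∑ s ∈ Icc 1 n, (D s ω * (Y s ω - g s ω) - 9 / 4 * D s ω ^ 2))) μ ∧
      ∫ ω, Real.exp
        (∑ s ∈ Icc 1 n, (D s ω * (Y s ω - g s ω) - 9 / 4 * D s ω ^ 2)) ∂μ ≤ 1 := by
  induction n with
  | zero => simp [stronglyMeasurable_const]
  | succ k ih =>
    have hsub : ∀ s ∈ Icc 1 k, s ∈ Icc 1 (k + 1) := fun s hs =>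
      Icc_subset_Icc_right k.le_succ hs
    obtain ⟨hmeas, hint, hbound⟩ := ih (fun s hs => hD s (hsub s hs))
      (fun s hs => hD_le s (hsub s hs)) (fun s hs => hg s (hsub s hs))
      (fun s hs => hg_mem s (hsub s hs)) (fun s hs => hY s (hsub s hs))
      (fun s hs => hY_mem s (hsub s hs)) (fun s hs => hcond s (hsub s hs))
    have hlast : k + 1 ∈ Icc 1 (k + 1) := right_mem_Icc.2 (by omega)
    have hDk : StronglyMeasurable[𝒢 k] (D (k + 1)) := (hD _ hlast).stronglyMeasurable
    have hgk : StronglyMeasurable[𝒢 k] (g (k + 1)) := (hg _ hlast).stronglyMeasurable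
    have hYk : StronglyMeasurable[𝒢 (k + 1)] (Y (k + 1)) := (hY _ hlast).stronglyMeasurable
    obtain ⟨hint', hbound'⟩ := integral_mul_exp_sub_sq_le (hle k) hmeas
      (fun ω => (Real.exp_pos _).le) hint hDk (hD_le _ hlast) hgk (hg_mem _ hlast)
      (hYk.mono (hle _)) (hY_mem _ hlast) (hcond _ hlast)
    simp only [sum_Icc_succ_top (Nat.le_add_left 1 k), Real.exp_add]
    refine ⟨?_, hint', hbound'.trans hbound⟩
    have hDk' := hDk.mono (hmono k)
    exact (hmeas.mono (hmono k)).mul (Real.continuous_exp.comp_stronglyMeasurable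
      ((hDk'.mul (hYk.sub (hgk.mono (hmono k)))).sub ((hDk'.pow 2).const_mul _)))

/-- **In-sample error of least squares over a finite class (fixed-target form of
Lemma C.5).** With predictable points `z_s`, adapted responses `Y_s ∈ [0,3]` whose
conditional means are `ḡ(z_s)`, an `ε`-accurate approximation `f̄ ∈ F` of `ḡ`, and an
empirical-risk minimizer `f̂` of the least-squares objective over `F`, with probability
at least `1 - δ`,
`∑_s (f̂(z_s) - f̄(z_s))² ≤ 2(24L + 21) ι² + 20 (t-1) L ε`. -/
theorem stmt9 {Ω : Type*} {m0 : MeasurableSpace Ω} (μ : Measure Ω) [IsProbabilityMeasure μ]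
    {Z : Type*} [MeasurableSpace Z]
    (L : ℝ) (hL : 1 ≤ L)
    (F : Finset (Z → ℝ)) (hFmeas : ∀ f ∈ F, Measurable f)
    (hFrange : ∀ f ∈ F, ∀ x, f x ∈ Set.Icc 0 L)
    (N : ℕ) (hN : F.card = N)
    (t T : ℕ) (ht : 0 < t) (hT : 0 < T) (htT : t - 1 ≤ T)
    (ε : ℝ) (hε : 0 ≤ ε) (δ : ℝ) (hδ : δ ∈ Set.Ioo (0 : ℝ) 1)
    (ι : ℝ)
    (hι : ι = Real.sqrt (2 * Real.log ((N : ℝ) *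
      (2 * Real.log (18 * L * (T : ℝ)) + 2) * (Real.log (18 * L) + 2) / δ)))
    (𝒢 : ℕ → MeasurableSpace Ω)
    (hmono : ∀ s, 𝒢 s ≤ 𝒢 (s + 1)) (hle : ∀ s, 𝒢 s ≤ m0)
    (z : ℕ → Ω → Z) (Y : ℕ → Ω → ℝ)
    (hzmeas : ∀ s ∈ Finset.Icc 1 (t - 1), Measurable[𝒢 (s - 1)] (z s))
    (hYmeas : ∀ s ∈ Finset.Icc 1 (t - 1), Measurable[𝒢 s] (Y s))
    (hYbdd : ∀ s ∈ Finset.Icc 1 (t - 1), ∀ᵐ ω ∂μ, Y s ω ∈ Set.Icc (0 : ℝ) 3)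
    (gbar : Z → ℝ) (hgmeas : Measurable gbar) (hgrange : ∀ x, gbar x ∈ Set.Icc (0 : ℝ) 3)
    (hgcond : ∀ s ∈ Finset.Icc 1 (t - 1),
      μ[Y s | 𝒢 (s - 1)] =ᵐ[μ] fun ω => gbar (z s ω))
    (fbar : Z → ℝ) (hfbar : fbar ∈ F) (hfg : ∀ x, |fbar x - gbar x| ≤ ε)
    (fhat : Ω → Z → ℝ) (hfhatF : ∀ ω, fhat ω ∈ F)
    (hfhatmeas : ∀ f ∈ F, MeasurableSet {ω | fhat ω = f})
    (hERM : ∀ᵐ ω ∂μ, ∀ f ∈ F,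
      ∑ s ∈ Finset.Icc 1 (t - 1), (fhat ω (z s ω) - Y s ω) ^ 2
        ≤ ∑ s ∈ Finset.Icc 1 (t - 1), (f (z s ω) - Y s ω) ^ 2) :
    ENNReal.ofReal (1 - δ) ≤
      μ {ω | ∑ s ∈ Finset.Icc 1 (t - 1), (fhat ω (z s ω) - fbar (z s ω)) ^ 2
        ≤ 2 * (24 * L + 21) * ι ^ 2 + 20 * ((t - 1 : ℕ) : ℝ) * L * ε} := by
  have hδ0 := hδ.1
  have hL0 : 0 < L := by linarith
  have hN1 : (1 : ℝ) ≤ N := by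
    rw [← hN]; exact_mod_cast card_pos.2 ⟨fbar, hfbar⟩
  have hNδ : 1 ≤ (N : ℝ) / δ := by
    rw [le_div_iff₀ hδ0]; linarith [hδ.2]
  have hNδ0 : 0 < (N : ℝ) / δ := by linarith
  have hT1 : (1 : ℝ) ≤ T := by exact_mod_cast hT
  have hιsq : 2 * Real.log (N / δ) ≤ ι ^ 2 := by
    have ha : 1 ≤ 2 * Real.log (18 * L * (T : ℝ)) + 2 := by
      have := Real.log_nonneg (x := 18 * L * (T : ℝ)) (by nlinarith)
      linarith
    have hb : 1 ≤ Real.log (18 * L) + 2 := by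
      have := Real.log_nonneg (x := 18 * L) (by linarith)
      linarith
    have hmul : (N : ℝ) / δ ≤ (N : ℝ) *
        (2 * Real.log (18 * L * (T : ℝ)) + 2) * (Real.log (18 * L) + 2) / δ := by
      gcongr
      rw [mul_assoc]
      exact le_mul_of_one_le_right (by linarith) (one_le_mul_of_one_le_of_one_le ha hb)
    have hlog := Real.log_le_log hNδ0 hmul
    have hlog0 := Real.log_nonneg hNδ
    rw [hι, Real.sq_sqrt (by linarith)]
    linarith
  set M : (Z → ℝ) → Ω → ℝ := fun f ω => Real.exp (∑ s ∈ Icc 1 (t - 1),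
    ((f (z s ω) - fbar (z s ω)) / (9 * L) * (Y s ω - gbar (z s ω)) -
      9 / 4 * ((f (z s ω) - fbar (z s ω)) / (9 * L)) ^ 2)) with hM
  have habs : ∀ f ∈ F, ∀ x, |f x - fbar x| ≤ L := fun f hf x => by
    have h1 := hFrange f hf x
    have h2 := hFrange fbar hfbar x
    exact abs_le.2 ⟨by linarith [h1.1, h2.2], by linarith [h1.2, h2.1]⟩
  have htail : ∀ f ∈ F, μ {ω | (N : ℝ) / δ ≤ M f ω} ≤ ENNReal.ofReal (δ / N) := by
    intro f hf
    obtain ⟨-, hint, hbound⟩ := integral_exp_sum_sub_sq_le_one (μ := μ) (n := t - 1) hmono hle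
      (D := fun s ω => (f (z s ω) - fbar (z s ω)) / (9 * L)) (g := fun s ω => gbar (z s ω))
      (Y := Y)
      (fun s hs => (((hFmeas f hf).sub (hFmeas fbar hfbar)).div_const _).comp (hzmeas s hs))
      (fun s _ ω => by
        rw [abs_div, abs_of_pos (by positivity : 0 < 9 * L), div_le_iff₀ (by positivity)]
        linarith [habs f hf (z s ω)])
      (fun s hs => hgmeas.comp (hzmeas s hs)) (fun s _ ω => hgrange _) hYmeas hYbdd hgcond
    have hmarkov := mul_meas_ge_le_integral_of_nonneg
      (ae_of_all μ fun ω => (Real.exp_pos _).le) hint (N / δ)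
    have hreal : μ.real {ω | (N : ℝ) / δ ≤ M f ω} ≤ δ / N := by
      rw [← one_div_div (N : ℝ) δ, le_div_iff₀' hNδ0]
      exact hmarkov.trans hbound
    rw [← ofReal_measureReal]
    exact ENNReal.ofReal_le_ofReal hreal
  have hbad : μ (⋃ f ∈ F, {ω | (N : ℝ) / δ ≤ M f ω}) ≤ ENNReal.ofReal δ := by
    refine (measure_biUnion_finset_le F _).trans ((sum_le_sum htail).trans_eq ?_)
    rw [sum_const, hN, nsmul_eq_mul, ← ENNReal.ofReal_natCast,
      ← ENNReal.ofReal_mul (by positivity), mul_div_cancel₀ _ (by positivity)]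
  have hgood : ENNReal.ofReal (1 - δ) ≤ μ (⋃ f ∈ F, {ω | (N : ℝ) / δ ≤ M f ω})ᶜ := by
    rw [ENNReal.ofReal_sub _ hδ0.le, ENNReal.ofReal_one, tsub_le_iff_right,
      ← measure_univ (μ := μ), ← Set.compl_union_self (⋃ f ∈ F, {ω | (N : ℝ) / δ ≤ M f ω})]
    exact (measure_union_le _ _).trans (by gcongr)
  refine hgood.trans (measure_mono_ae ?_)
  filter_upwards [hERM] with ω hERMω hω
  have hω' : M (fhat ω) ω < N / δ := by
    by_contra! h
    exact hω (Set.mem_biUnion (hfhatF ω) h)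
  rw [hM, ← Real.lt_log_iff_exp_lt hNδ0] at hω'
  set S := ∑ s ∈ Icc 1 (t - 1), (fhat ω (z s ω) - fbar (z s ω)) ^ 2 with hS
  set P := ∑ s ∈ Icc 1 (t - 1),
    (fhat ω (z s ω) - fbar (z s ω)) * (Y s ω - gbar (z s ω)) with hP
  have hsum : ∑ s ∈ Icc 1 (t - 1),
      ((fhat ω (z s ω) - fbar (z s ω)) / (9 * L) * (Y s ω - gbar (z s ω)) -
        9 / 4 * ((fhat ω (z s ω) - fbar (z s ω)) / (9 * L)) ^ 2) =
      (P - S / (4 * L)) / (9 * L) := by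
    rw [hP, hS, sum_div, ← sum_sub_distrib, sum_div]
    refine sum_congr rfl fun s _ => ?_
    field_simp
  rw [hsum, div_lt_iff₀ (by positivity)] at hω'
  have hS0 : 0 ≤ S := sum_nonneg fun _ _ => sq_nonneg _
  have hS4 : S / (4 * L) ≤ S / 4 := by gcongr; linarith
  have hbasic : S ≤ 2 * P + 2 * ((t - 1 : ℕ) : ℝ) * L * ε := by
    have hterm : ∀ s ∈ Icc 1 (t - 1), (fhat ω (z s ω) - fbar (z s ω)) ^ 2 ≤
        (fhat ω (z s ω) - Y s ω) ^ 2 - (fbar (z s ω) - Y s ω) ^ 2 +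
        2 * ((fhat ω (z s ω) - fbar (z s ω)) * (Y s ω - gbar (z s ω))) + 2 * (L * ε) := by
      intro s _
      have h := (le_abs_self _).trans ((abs_mul (fhat ω (z s ω) - fbar (z s ω))
        (-(fbar (z s ω) - gbar (z s ω)))).trans_le (mul_le_mul (habs _ (hfhatF ω) _)
          ((abs_neg _).trans_le (hfg _)) (abs_nonneg _) hL0.le))
      nlinarith
    have h1 := sum_le_sum hterm
    have h2 := hERMω fbar hfbar
    rw [sum_add_distrib, sum_add_distrib, sum_sub_distrib, ← mul_sum, sum_const,
      Nat.card_Icc, Nat.add_sub_cancel, nsmul_eq_mul] at h1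
    linarith
  have hℓ := Real.log_nonneg hNδ
  have hLℓ : 0 ≤ L * Real.log (N / δ) := by positivity
  have hrem : 0 ≤ ((t - 1 : ℕ) : ℝ) * L * ε := by positivity
  have hιL := mul_le_mul_of_nonneg_left hιsq (by positivity : 0 ≤ 2 * (24 * L + 21))
  change S ≤ _
  linarith
end

section
/- (Stability of normalized squared predictions under covering; key step in property 3 of Lemma 5.2.) Let T be a positive integer, λ > 0, and ε ≥ 0 with ε² ≤ λ / (8T). Let u_0, u_1, …, u_T and ũ_0, ũ_1, …, ũ_T be real numbers with |u_i − ũ_i| ≤ 2ε for every i = 0, 1, …, T. Then u_0² / ( Σ_{i=1}^T u_i² + λ ) ≤ 4 ũ_0² / ( Σ_{i=1}^T ũ_i² + λ ) + 16 ε² / λ. -/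
/-- The square of a number is at most twice the square of any number within `2ε` of it, plus
`8ε²`. -/
theorem sq_le_of_abs_sub_le_two_mul {a b ε : ℝ} (h : |a - b| ≤ 2 * ε) :
    a ^ 2 ≤ 2 * b ^ 2 + 8 * ε ^ 2 := by
  have h2 : (a - b) ^ 2 ≤ (2 * ε) ^ 2 := sq_le_sq' (neg_le_of_abs_le h) (le_of_abs_le h)
  nlinarith [sq_nonneg (a - 2 * b)]

open Finset

/-- **Stability of normalized squared predictions under covering (key step in property 3
of Lemma 5.2).** If `ε² ≤ λ/(8T)` and `|u_i - ũ_i| ≤ 2ε` for `i = 0, 1, …, T`, then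
`u_0² / (∑_{i=1}^T u_i² + λ) ≤ 4 ũ_0² / (∑_{i=1}^T ũ_i² + λ) + 16 ε² / λ`. -/
theorem stmt12 (T : ℕ) (hT : 0 < T) (lam ε : ℝ) (hlam : 0 < lam) (hε : 0 ≤ ε)
    (hε2 : ε ^ 2 ≤ lam / (8 * (T : ℝ)))
    (u ut : ℕ → ℝ) (hclose : ∀ i ≤ T, |u i - ut i| ≤ 2 * ε) :
    u 0 ^ 2 / ((∑ i ∈ Finset.Icc 1 T, u i ^ 2) + lam)
      ≤ 4 * ut 0 ^ 2 / ((∑ i ∈ Finset.Icc 1 T, ut i ^ 2) + lam) + 16 * ε ^ 2 / lam := by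
  have hTpos : (0 : ℝ) < T := by exact_mod_cast hT
  have hTε : 8 * (T : ℝ) * ε ^ 2 ≤ lam := by
    rw [le_div_iff₀ (by positivity)] at hε2
    linarith
  have hsum : ∑ i ∈ Finset.Icc 1 T, ut i ^ 2 ≤
      2 * (∑ i ∈ Finset.Icc 1 T, u i ^ 2) + 8 * (T : ℝ) * ε ^ 2 := by
    calc ∑ i ∈ Finset.Icc 1 T, ut i ^ 2
        ≤ ∑ i ∈ Finset.Icc 1 T, (2 * u i ^ 2 + 8 * ε ^ 2) := by
          refine Finset.sum_le_sum fun i hi => sq_le_of_abs_sub_le_two_mul ?_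
          rw [abs_sub_comm]
          exact hclose i (Finset.mem_Icc.mp hi).2
      _ = 2 * (∑ i ∈ Finset.Icc 1 T, u i ^ 2) + 8 * (T : ℝ) * ε ^ 2 := by
          rw [Finset.sum_add_distrib, ← Finset.mul_sum]
          simp
          ring
  have h0 : u 0 ^ 2 ≤ 2 * ut 0 ^ 2 + 8 * ε ^ 2 :=
    sq_le_of_abs_sub_le_two_mul (hclose 0 (Nat.zero_le T))
  have hA : 0 ≤ ∑ i ∈ Finset.Icc 1 T, u i ^ 2 := Finset.sum_nonneg fun i _ => sq_nonneg _
  have hB : 0 ≤ ∑ i ∈ Finset.Icc 1 T, ut i ^ 2 := Finset.sum_nonneg fun i _ => sq_nonneg _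
  generalize (∑ i ∈ Finset.Icc 1 T, u i ^ 2) = A at *
  generalize (∑ i ∈ Finset.Icc 1 T, ut i ^ 2) = B at *
  have hquery : 2 * ut 0 ^ 2 / (A + lam) ≤ 4 * ut 0 ^ 2 / (B + lam) := by
    rw [div_le_div_iff₀ (by linarith) (by linarith)]
    nlinarith [sq_nonneg (ut 0)]
  have herr : 8 * ε ^ 2 / (A + lam) ≤ 16 * ε ^ 2 / lam := by
    gcongr
    · norm_num
    · linarith
  calc u 0 ^ 2 / (A + lam)
      ≤ (2 * ut 0 ^ 2 + 8 * ε ^ 2) / (A + lam) := by gcongr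
    _ = 2 * ut 0 ^ 2 / (A + lam) + 8 * ε ^ 2 / (A + lam) := add_div _ _ _
    _ ≤ 4 * ut 0 ^ 2 / (B + lam) + 16 * ε ^ 2 / lam := add_le_add hquery herr
end

section
/- (Uncertainty of a bounded linear class is dominated by a Mahalanobis norm.) Let d be a positive integer, B, λ > 0, let φ, φ_1, …, φ_{t−1} ∈ ℝ^d, let σ_1, …, σ_{t−1} > 0, and define the positive definite matrix Σ := (λ / (4B²)) I_d + Σ_{s=1}^{t−1} σ_s⁻² φ_s φ_sᵀ. Then sup over Δ ∈ ℝ^d with 0 < ‖Δ‖₂ ≤ 2B of ⟨Δ, φ⟩² / ( Σ_{s=1}^{t−1} σ_s⁻² ⟨Δ, φ_s⟩² + λ ) ≤ φᵀ Σ⁻¹ φ. -/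
open Finset Matrix

namespace Matrix

/-- Cauchy–Schwarz for a positive definite matrix, in its dual form. -/
theorem PosDef.sq_dotProduct_le {n : Type*} [Fintype n] [DecidableEq n] {A : Matrix n n ℝ}
    (hA : A.PosDef) (v x : n → ℝ) :
    (v ⬝ᵥ x) ^ 2 ≤ (v ⬝ᵥ A *ᵥ v) * (x ⬝ᵥ A⁻¹ *ᵥ x) := by
  rcases eq_or_ne v 0 with rfl | hv
  · simp
  have hdet : IsUnit A.det := (isUnit_iff_isUnit_det A).mp hA.isUnit
  obtain ⟨w, hw⟩ : ∃ w, w = A⁻¹ *ᵥ x := ⟨_, rfl⟩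
  have hAw : A *ᵥ w = x := by
    rw [hw, mulVec_mulVec, mul_nonsing_inv A hdet, one_mulVec]
  have hq : 0 < v ⬝ᵥ A *ᵥ v := by simpa using hA.dotProduct_mulVec_pos hv
  have hsymm : w ⬝ᵥ A *ᵥ v = v ⬝ᵥ x := by
    have hT : Aᵀ = A := by simpa using hA.isHermitian.eq
    rw [dotProduct_mulVec, ← mulVec_transpose, hT, hAw, dotProduct_comm]
  have key := hA.posSemidef.dotProduct_mulVec_nonneg
    ((v ⬝ᵥ A *ᵥ v) • w - (v ⬝ᵥ x) • v)
  simp only [star_trivial, mulVec_sub, mulVec_smul, dotProduct_sub, sub_dotProduct,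
    smul_dotProduct, dotProduct_smul, smul_eq_mul, hAw, hsymm] at key
  rw [← hw, dotProduct_comm x w]
  refine sub_nonneg.mp (nonneg_of_mul_nonneg_right ?_ hq)
  linarith

/-- The quadratic form of a ridge-regularized sum of weighted rank-one matrices. -/
theorem dotProduct_smul_one_add_sum_vecMulVec_mulVec {n ι : Type*} [Fintype n] [DecidableEq n]
    (S : Finset ι) (c : ℝ) (a : ι → ℝ) (u : ι → n → ℝ) (v : n → ℝ) :
    v ⬝ᵥ (c • (1 : Matrix n n ℝ) + ∑ s ∈ S, a s • vecMulVec (u s) (u s)) *ᵥ v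
      = c * ∑ i, v i ^ 2 + ∑ s ∈ S, a s * (v ⬝ᵥ u s) ^ 2 := by
  rw [add_mulVec, dotProduct_add, smul_mulVec, one_mulVec, dotProduct_smul, sum_mulVec,
    dotProduct_sum]
  congr 1
  · simp [dotProduct, sq]
  · refine Finset.sum_congr rfl fun s _ => ?_
    rw [smul_mulVec, vecMulVec_mulVec, dotProduct_smul, op_smul_eq_smul, dotProduct_smul,
      dotProduct_comm (u s) v, smul_eq_mul, smul_eq_mul, sq]

/-- Positive ridge regularization makes a nonnegatively weighted sum of rank-one matrices
positive definite. -/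
theorem posDef_smul_one_add_sum_vecMulVec {n ι : Type*} [Fintype n] [DecidableEq n]
    (S : Finset ι) {c : ℝ} (hc : 0 < c) {a : ι → ℝ} (ha : ∀ s ∈ S, 0 ≤ a s) (u : ι → n → ℝ) :
    (c • (1 : Matrix n n ℝ) + ∑ s ∈ S, a s • vecMulVec (u s) (u s)).PosDef := by
  refine (PosDef.one.smul hc).add_posSemidef (posSemidef_sum S fun s hs => ?_)
  have h := posSemidef_vecMulVec_self_star (u s)
  rw [star_trivial] at h
  exact h.smul (ha s hs)

end Matrix

/-- **Uncertainty of a bounded linear class is dominated by a Mahalanobis norm.** With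
`Σ := (λ/(4B²)) I + ∑_s σ_s⁻² φ_s φ_sᵀ`, one has
`sup { ⟨Δ, φ⟩² / (∑_s σ_s⁻² ⟨Δ, φ_s⟩² + λ) : 0 < ‖Δ‖₂ ≤ 2B } ≤ φᵀ Σ⁻¹ φ`. -/
theorem stmt13 (d : ℕ) (hd : 0 < d) (B lam : ℝ) (hB : 0 < B) (hlam : 0 < lam)
    (t : ℕ) (φ : Fin d → ℝ) (φs : ℕ → (Fin d → ℝ))
    (σ : ℕ → ℝ) (hσ : ∀ s ∈ Finset.Icc 1 (t - 1), 0 < σ s)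
    (Sig : Matrix (Fin d) (Fin d) ℝ)
    (hSig : Sig = (lam / (4 * B ^ 2)) • (1 : Matrix (Fin d) (Fin d) ℝ)
      + ∑ s ∈ Finset.Icc 1 (t - 1), ((σ s) ^ 2)⁻¹ • Matrix.vecMulVec (φs s) (φs s)) :
    sSup {r : ℝ | ∃ v : Fin d → ℝ,
        0 < Real.sqrt (∑ i, v i ^ 2) ∧ Real.sqrt (∑ i, v i ^ 2) ≤ 2 * B ∧
        r = (v ⬝ᵥ φ) ^ 2 /
          ((∑ s ∈ Finset.Icc 1 (t - 1), ((σ s) ^ 2)⁻¹ * (v ⬝ᵥ φs s) ^ 2) + lam)}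
      ≤ φ ⬝ᵥ (Sig⁻¹).mulVec φ := by
  have hpd : Sig.PosDef := hSig ▸ posDef_smul_one_add_sum_vecMulVec _ (by positivity)
    (fun s _ => by positivity) φs
  have hnonneg : 0 ≤ φ ⬝ᵥ Sig⁻¹ *ᵥ φ := by
    simpa using hpd.inv.posSemidef.dotProduct_mulVec_nonneg φ
  refine Real.sSup_le ?_ hnonneg
  rintro r ⟨v, -, hv, rfl⟩
  have hsum : 0 ≤ ∑ s ∈ Finset.Icc 1 (t - 1), ((σ s) ^ 2)⁻¹ * (v ⬝ᵥ φs s) ^ 2 :=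
    Finset.sum_nonneg fun s _ => by positivity
  have hnorm : ∑ i, v i ^ 2 ≤ 4 * B ^ 2 := by
    have h := (Real.sqrt_le_left (by positivity)).mp hv
    linarith
  have hridge : lam / (4 * B ^ 2) * ∑ i, v i ^ 2 ≤ lam := by
    rw [div_mul_eq_mul_div, div_le_iff₀ (by positivity)]
    gcongr
  rw [div_le_iff₀ (by positivity)]
  calc (v ⬝ᵥ φ) ^ 2 ≤ (v ⬝ᵥ Sig *ᵥ v) * (φ ⬝ᵥ Sig⁻¹ *ᵥ φ) := hpd.sq_dotProduct_le v φ
    _ ≤ _ := by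
      rw [mul_comm]
      refine mul_le_mul_of_nonneg_left ?_ hnonneg
      rw [hSig, dotProduct_smul_one_add_sum_vecMulVec_mulVec]
      linarith
end

section
/- (Elliptical potential bound.) Let d, T be positive integers, let V_1 be a symmetric positive definite d×d real matrix, let u_1, …, u_T ∈ ℝ^d, and define V_{t+1} := V_t + u_t u_tᵀ for t = 1, …, T. Then Σ_{t=1}^T min(1, u_tᵀ V_t⁻¹ u_t) ≤ 2 ( log det V_{T+1} − log det V_1 ). -/
open Finset Matrix

lemma Real.min_one_le_two_mul_log_one_add {x : ℝ} (hx : 0 ≤ x) :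
    min 1 x ≤ 2 * Real.log (1 + x) := by
  have hpos : 0 < 1 + x := by linarith
  have hlog : 1 - (1 + x)⁻¹ ≤ Real.log (1 + x) := Real.one_sub_inv_le_log_of_pos hpos
  have hmin : min 1 x ≤ 2 * (1 - (1 + x)⁻¹) := by
    have heq : 2 * (1 - (1 + x)⁻¹) = 2 * x / (1 + x) := by
      field_simp
      ring
    rw [heq, le_div_iff₀ hpos]
    rcases le_total 1 x with h | h
    · rw [min_eq_left h]
      linarith
    · rw [min_eq_right h]
      nlinarith
  linarith

lemma Matrix.det_add_vecMulVec {n R : Type*} [Fintype n] [DecidableEq n] [CommRing R]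
    {A : Matrix n n R} (hA : IsUnit A.det) (u v : n → R) :
    (A + vecMulVec u v).det = A.det * (1 + v ⬝ᵥ A⁻¹ *ᵥ u) := by
  rw [vecMulVec_eq Unit, det_add_replicateCol_mul_replicateRow hA, Matrix.mul_assoc,
    ← replicateCol_mulVec, det_unique (n := Unit)]
  simp

lemma Matrix.PosDef.add_vecMulVec_self {n : Type*} [Fintype n] {A : Matrix n n ℝ}
    (hA : A.PosDef) (u : n → ℝ) : (A + vecMulVec u u).PosDef := by
  simpa using hA.add_posSemidef (posSemidef_vecMulVec_self_star u)

lemma Matrix.PosDef.min_one_dotProduct_inv_mulVec_le {n : Type*} [Fintype n] [DecidableEq n]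
    {A : Matrix n n ℝ} (hA : A.PosDef) (u : n → ℝ) :
    min 1 (u ⬝ᵥ A⁻¹ *ᵥ u) ≤
      2 * (Real.log (A + vecMulVec u u).det - Real.log A.det) := by
  have hq : 0 ≤ u ⬝ᵥ A⁻¹ *ᵥ u := by
    simpa using hA.inv.posSemidef.dotProduct_mulVec_nonneg u
  have hdet : A.det ≠ 0 := hA.det_pos.ne'
  rw [det_add_vecMulVec hdet.isUnit, Real.log_mul hdet (by positivity), add_sub_cancel_left]
  exact Real.min_one_le_two_mul_log_one_add hq

/-- **Elliptical potential bound.** If `V_1` is symmetric positive definite and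
`V_{t+1} = V_t + u_t u_tᵀ` for `t = 1, …, T`, then
`∑_{t=1}^T min(1, u_tᵀ V_t⁻¹ u_t) ≤ 2 (log det V_{T+1} - log det V_1)`. -/
theorem stmt14 (d T : ℕ) (hd : 0 < d) (hT : 0 < T)
    (V : ℕ → Matrix (Fin d) (Fin d) ℝ) (hV1 : (V 1).PosDef)
    (u : ℕ → (Fin d → ℝ))
    (hrec : ∀ t ∈ Finset.Icc 1 T, V (t + 1) = V t + Matrix.vecMulVec (u t) (u t)) :
    ∑ t ∈ Finset.Icc 1 T, min 1 (u t ⬝ᵥ ((V t)⁻¹).mulVec (u t))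
      ≤ 2 * (Real.log (V (T + 1)).det - Real.log (V 1).det) := by
  have hpos : ∀ t ∈ Finset.Icc 1 T, (V t).PosDef := by
    intro t ht
    obtain ⟨h1, hle⟩ := Finset.mem_Icc.mp ht
    clear ht
    induction t, h1 using Nat.le_induction with
    | base => exact hV1
    | succ t h1 ih =>
      rw [hrec t (Finset.mem_Icc.mpr ⟨h1, by omega⟩)]
      exact (ih (by omega)).add_vecMulVec_self (u t)
  calc ∑ t ∈ Finset.Icc 1 T, min 1 (u t ⬝ᵥ ((V t)⁻¹).mulVec (u t))
      ≤ ∑ t ∈ Finset.Icc 1 T, 2 * (Real.log (V (t + 1)).det - Real.log (V t).det) := by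
        refine Finset.sum_le_sum fun t ht => ?_
        rw [hrec t ht]
        exact (hpos t ht).min_one_dotProduct_inv_mulVec_le (u t)
    _ = 2 * (Real.log (V (T + 1)).det - Real.log (V 1).det) := by
        rw [← Finset.mul_sum, ← Finset.Ico_add_one_right_eq_Icc,
          Finset.sum_Ico_sub (fun t => Real.log (V t).det) (by omega)]
end

section
/- (Splitting lemma for truncated sums.) Let S be a finite index set and let (D_t)_{t ∈ S} be nonnegative real numbers. Then Σ_{t ∈ S} min(1, D_t) ≤ Σ_{t ∈ S} min(1, D_t²) + √( |S| · Σ_{t ∈ S} min(1, D_t²) ). -/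
open Finset

theorem min_one_sq_of_nonneg {x : ℝ} (hx : 0 ≤ x) : min 1 x ^ 2 = min 1 (x ^ 2) := by
  rcases le_total 1 x with h | h
  · rw [min_eq_left h, min_eq_left (one_le_pow₀ h), one_pow]
  · rw [min_eq_right h, min_eq_right (pow_le_one₀ hx h)]

/-- By Cauchy–Schwarz, the square-root term alone bounds the truncated sum. -/
theorem sum_min_one_le_sqrt {ι : Type*} (S : Finset ι) (D : ι → ℝ) (hD : ∀ t ∈ S, 0 ≤ D t) :
    ∑ t ∈ S, min 1 (D t) ≤ Real.sqrt ((S.card : ℝ) * ∑ t ∈ S, min 1 (D t ^ 2)) := by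
  apply Real.le_sqrt_of_sq_le
  rw [← Finset.sum_congr rfl fun t ht => min_one_sq_of_nonneg (hD t ht)]
  exact sq_sum_le_card_mul_sum_sq

/-- **Splitting lemma for truncated sums.** For nonnegative reals `D_t`, `t ∈ S`,
`∑_{t∈S} min(1, D_t) ≤ ∑_{t∈S} min(1, D_t²) + √(|S| · ∑_{t∈S} min(1, D_t²))`. -/
theorem stmt15 {ι : Type*} (S : Finset ι) (D : ι → ℝ) (hD : ∀ t ∈ S, 0 ≤ D t) :
    ∑ t ∈ S, min 1 (D t) ≤
      (∑ t ∈ S, min 1 (D t ^ 2)) +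
        Real.sqrt ((S.card : ℝ) * ∑ t ∈ S, min 1 (D t ^ 2)) := by
  exact (sum_min_one_le_sqrt S D hD).trans <|
    le_add_of_nonneg_left <| Finset.sum_nonneg fun t _ => le_min zero_le_one (sq_nonneg (D t))
end
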